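/- arXiv:2312.04454 — 4 statements merged into one kernel-verified Lean document; each statement's English description precedes it below -/
import Mathlib

section
/- Let R ⊂ ℤ be finite and d ∈ ℕ. Then there is a constant D depending only on R and d such that the following holds. Let f(θ) = Σ_{n=0}^N A_n cos(nθ) + Σ_{n=1}^N B_n sin(nθ) be a trigonometric polynomial with coefficients A_n, B_n ∈ R having at most d distinct zeros in [0, 2π]. Then there exist L < D and pairwise disjoint intervals I_1, …, I_L of integers with I_1 ∪ ⋯ ∪ I_L = {1, …, N} such that for each j the sequences (A_n)_{n∈I_j} and (B_n)_{n∈I_j} are periodic with period D, i.e. A_n = A_{n+D} and B_n = B_{n+D} whenever both n and n + D lie in I_j. -/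
open scoped LaurentPolynomial ComplexConjugate

namespace LaurentPolynomial

/-- Evaluation of a complex Laurent polynomial at the point `exp (iθ)` of the unit circle. -/
noncomputable def evalCircle (θ : ℝ) : ℂ[T;T⁻¹] →ₐ[ℂ] ℂ :=
  AddMonoidAlgebra.lift ℂ ℂ ℤ
    { toFun := fun n => Complex.exp (n.toAdd * θ * Complex.I)
      map_one' := by simp
      map_mul' := fun a b => by
        rw [← Complex.exp_add]
        congr 1
        simp only [toAdd_mul]
        push_cast
        ring }

lemma evalCircle_single (θ : ℝ) (n : ℤ) (c : ℂ) :
    evalCircle θ (AddMonoidAlgebra.single n c) = c * Complex.exp (n * θ * Complex.I) := by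
  simp [evalCircle, AddMonoidAlgebra.lift_single, -single_eq_C_mul_T]

lemma norm_exp_int_mul (θ : ℝ) (n : ℤ) : ‖Complex.exp (n * θ * Complex.I)‖ = 1 := by
  have := Complex.norm_exp_ofReal_mul_I (n * θ)
  push_cast at this
  exact this

/-- The Wiener norm of a complex Laurent polynomial, i.e. the `ℓ¹`-norm of its coefficients. -/
noncomputable def wienerNorm (p : ℂ[T;T⁻¹]) : ℝ := p.coeff.sum fun _ c => ‖c‖

lemma wienerNorm_eq_sum {p : ℂ[T;T⁻¹]} {s : Finset ℤ} (h : p.coeff.support ⊆ s) :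
    wienerNorm p = ∑ n ∈ s, ‖p.coeff n‖ :=
  Finsupp.sum_of_support_subset _ h _ (by simp)

lemma wienerNorm_nonneg (p : ℂ[T;T⁻¹]) : 0 ≤ wienerNorm p :=
  Finset.sum_nonneg fun _ _ => norm_nonneg _

lemma sum_norm_coeff_le_wienerNorm (p : ℂ[T;T⁻¹]) (s : Finset ℤ) :
    ∑ n ∈ s, ‖p.coeff n‖ ≤ wienerNorm p := by
  rw [wienerNorm_eq_sum (Finset.subset_union_left (s₂ := s))]
  exact Finset.sum_le_sum_of_subset_of_nonneg Finset.subset_union_right fun _ _ _ => norm_nonneg _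

@[simp] lemma wienerNorm_zero : wienerNorm 0 = 0 := by simp [wienerNorm]

lemma wienerNorm_single (n : ℤ) (c : ℂ) : wienerNorm (AddMonoidAlgebra.single n c) = ‖c‖ := by
  simp [wienerNorm, -single_eq_C_mul_T]

@[simp] lemma wienerNorm_one : wienerNorm 1 = 1 := by
  rw [AddMonoidAlgebra.one_def, wienerNorm_single, norm_one]

lemma wienerNorm_add_le (p q : ℂ[T;T⁻¹]) : wienerNorm (p + q) ≤ wienerNorm p + wienerNorm q := by
  classical
  rw [wienerNorm_eq_sum (p := p + q) (s := p.coeff.support ∪ q.coeff.support)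
      Finsupp.support_add,
    wienerNorm_eq_sum (p := p) Finset.subset_union_left,
    wienerNorm_eq_sum (p := q) Finset.subset_union_right, ← Finset.sum_add_distrib]
  exact Finset.sum_le_sum fun n _ => norm_add_le _ _

lemma wienerNorm_neg (p : ℂ[T;T⁻¹]) : wienerNorm (-p) = wienerNorm p := by
  rw [wienerNorm_eq_sum (s := p.coeff.support) (by simp), wienerNorm_eq_sum subset_rfl]
  simp

lemma wienerNorm_smul_le (c : ℂ) (p : ℂ[T;T⁻¹]) : wienerNorm (c • p) ≤ ‖c‖ * wienerNorm p := by
  rw [wienerNorm_eq_sum (p := c • p) (s := p.coeff.support)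
      (by rw [AddMonoidAlgebra.coeff_smul]; exact Finsupp.support_smul),
    wienerNorm_eq_sum subset_rfl, Finset.mul_sum]
  exact Finset.sum_le_sum fun n _ => by rw [AddMonoidAlgebra.coeff_smul_apply, norm_smul]

lemma wienerNorm_sum_le {ι : Type*} (s : Finset ι) (f : ι → ℂ[T;T⁻¹]) :
    wienerNorm (∑ i ∈ s, f i) ≤ ∑ i ∈ s, wienerNorm (f i) :=
  Finset.le_sum_of_subadditive _ wienerNorm_zero.le wienerNorm_add_le s f

lemma wienerNorm_mul_le (p q : ℂ[T;T⁻¹]) : wienerNorm (p * q) ≤ wienerNorm p * wienerNorm q := by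
  rw [AddMonoidAlgebra.mul_def]
  refine (wienerNorm_sum_le _ _).trans ?_
  rw [wienerNorm, Finsupp.sum, Finset.sum_mul]
  refine Finset.sum_le_sum fun a _ => (wienerNorm_sum_le _ _).trans ?_
  rw [wienerNorm, Finsupp.sum, Finset.mul_sum]
  exact Finset.sum_le_sum fun b _ => by rw [wienerNorm_single, norm_mul]

lemma wienerNorm_pow_le (p : ℂ[T;T⁻¹]) (n : ℕ) : wienerNorm (p ^ n) ≤ wienerNorm p ^ n := by
  induction n with
  | zero => simp
  | succ n ih =>
    rw [pow_succ, pow_succ]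
    exact (wienerNorm_mul_le _ _).trans
      (mul_le_mul_of_nonneg_right ih (wienerNorm_nonneg p))

lemma norm_coeff_mul_le (p q : ℂ[T;T⁻¹]) {c : ℝ} (h : ∀ n, ‖q.coeff n‖ ≤ c) (n : ℤ) :
    ‖(p * q).coeff n‖ ≤ wienerNorm p * c := by
  rw [AddMonoidAlgebra.coeff_mul_apply_left, wienerNorm, Finsupp.sum, Finsupp.sum, Finset.sum_mul]
  refine (norm_sum_le _ _).trans (Finset.sum_le_sum fun a _ => ?_)
  rw [norm_mul]
  exact mul_le_mul_of_nonneg_left (h _) (norm_nonneg _)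

lemma coeff_mul_eq_zero {p q : ℂ[T;T⁻¹]} {n : ℤ} (hp : ∀ k ≤ n, p.coeff k = 0)
    (hq : ∀ k < 0, q.coeff k = 0) : (p * q).coeff n = 0 := by
  rw [AddMonoidAlgebra.coeff_mul_apply_left]
  refine Finset.sum_eq_zero fun k _ => ?_
  by_cases hk : k ≤ n
  · simp [hp k hk]
  · simp [hq (-k + n) (by omega)]

lemma norm_evalCircle_le (θ : ℝ) (p : ℂ[T;T⁻¹]) : ‖evalCircle θ p‖ ≤ wienerNorm p := by
  conv_lhs => rw [← AddMonoidAlgebra.sum_coeff_single p, Finsupp.sum, map_sum]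
  refine (norm_sum_le _ _).trans (Finset.sum_le_sum fun n _ => ?_)
  rw [evalCircle_single, norm_mul, norm_exp_int_mul, mul_one]

/-- The sum of `v k / #X · z ^ k` over `k ∈ X`. -/
noncomputable def blockPoly (X : Finset ℤ) (v : ℤ → ℂ) : ℂ[T;T⁻¹] :=
  ∑ k ∈ X, AddMonoidAlgebra.single k (v k / X.card)

lemma coeff_blockPoly (X : Finset ℤ) (v : ℤ → ℂ) (n : ℤ) :
    (blockPoly X v).coeff n = if n ∈ X then v n / X.card else 0 := by
  simp [blockPoly, Finsupp.single_apply, -single_eq_C_mul_T]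

lemma wienerNorm_blockPoly_le {X : Finset ℤ} {v : ℤ → ℂ} (hv : ∀ k ∈ X, ‖v k‖ = 1) :
    wienerNorm (blockPoly X v) ≤ 1 := by
  refine (wienerNorm_sum_le _ _).trans ?_
  have : ∀ k ∈ X, wienerNorm (AddMonoidAlgebra.single k (v k / X.card)) = 1 / X.card := by
    intro k hk
    rw [wienerNorm_single, norm_div, hv k hk, Complex.norm_natCast]
  rw [Finset.sum_congr rfl this, Finset.sum_const, nsmul_eq_mul, mul_one_div]
  exact div_self_le_one _

/-- A Laurent polynomial without terms of negative degree whose real part on the unit circle is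
`|blockPoly X v|²`. -/
noncomputable def analyticSquare (X : Finset ℤ) (v : ℤ → ℂ) : ℂ[T;T⁻¹] :=
  ∑ k ∈ X, ∑ l ∈ X, AddMonoidAlgebra.single (k - l)
    ((if k < l then 0 else if k = l then 1 else 2) * (v k / X.card * conj (v l / X.card)))

lemma coeff_analyticSquare_of_neg (X : Finset ℤ) (v : ℤ → ℂ) {n : ℤ} (hn : n < 0) :
    (analyticSquare X v).coeff n = 0 := by
  simp only [analyticSquare, AddMonoidAlgebra.coeff_sum, Finsupp.finsetSum_apply,
    AddMonoidAlgebra.coeff_single]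
  refine Finset.sum_eq_zero fun k _ => Finset.sum_eq_zero fun l _ => ?_
  rw [Finsupp.single_apply]
  split_ifs <;> first | omega | simp

lemma norm_analyticSquare_term_le {X : Finset ℤ} {v : ℤ → ℂ} (hv : ∀ k ∈ X, ‖v k‖ = 1)
    {k l : ℤ} (hk : k ∈ X) (hl : l ∈ X) :
    ‖(if k < l then 0 else if k = l then 1 else 2 : ℂ) *
      (v k / X.card * conj (v l / X.card))‖ ≤ 2 / (X.card : ℝ) ^ 2 := by
  have h : ‖(if k < l then 0 else if k = l then 1 else 2 : ℂ)‖ ≤ 2 := by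
    split_ifs <;> simp
  rw [norm_mul, norm_mul, RCLike.norm_conj, norm_div, norm_div, hv k hk, hv l hl,
    Complex.norm_natCast]
  calc _ ≤ 2 * (1 / (X.card : ℝ) * (1 / X.card)) := by gcongr
    _ = _ := by ring

lemma wienerNorm_analyticSquare_le {X : Finset ℤ} {v : ℤ → ℂ} (hv : ∀ k ∈ X, ‖v k‖ = 1) :
    wienerNorm (analyticSquare X v) ≤ 2 := by
  refine (wienerNorm_sum_le _ _).trans ?_
  calc _ ≤ ∑ k ∈ X, ∑ l ∈ X, 2 / (X.card : ℝ) ^ 2 := by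
        refine Finset.sum_le_sum fun k hk => (wienerNorm_sum_le _ _).trans
          (Finset.sum_le_sum fun l hl => ?_)
        rw [wienerNorm_single]
        exact norm_analyticSquare_term_le hv hk hl
    _ ≤ 2 := by
        rcases X.eq_empty_or_nonempty with rfl | hX
        · simp
        · have : (X.card : ℝ) ≠ 0 := by simpa using hX.ne_empty
          simp only [Finset.sum_const, nsmul_eq_mul]
          apply le_of_eq
          field_simp

lemma norm_coeff_analyticSquare_le {X : Finset ℤ} {v : ℤ → ℂ} (hv : ∀ k ∈ X, ‖v k‖ = 1) (n : ℤ) :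
    ‖(analyticSquare X v).coeff n‖ ≤ 2 / X.card := by
  simp only [analyticSquare, AddMonoidAlgebra.coeff_sum, Finsupp.finsetSum_apply,
    AddMonoidAlgebra.coeff_single]
  refine (norm_sum_le _ _).trans ?_
  calc _ ≤ ∑ k ∈ X, 2 / (X.card : ℝ) ^ 2 := by
        refine Finset.sum_le_sum fun k hk => (norm_sum_le _ _).trans ?_
        calc _ ≤ ∑ l ∈ X, if k - n = l then 2 / (X.card : ℝ) ^ 2 else 0 := by
              refine Finset.sum_le_sum fun l hl => ?_
              rw [Finsupp.single_apply]
              by_cases h : k - l = n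
              · rw [if_pos h, if_pos (show k - n = l by omega)]
                exact norm_analyticSquare_term_le hv hk hl
              · rw [if_neg h, if_neg (show ¬ k - n = l by omega), norm_zero]
          _ ≤ 2 / (X.card : ℝ) ^ 2 := by
              rw [Finset.sum_ite_eq]
              split_ifs
              · exact le_rfl
              · positivity
    _ ≤ 2 / (X.card : ℝ) := by
        rcases X.eq_empty_or_nonempty with rfl | hX
        · simp
        · have : (X.card : ℝ) ≠ 0 := by simpa using hX.ne_empty
          simp only [Finset.sum_const, nsmul_eq_mul]
          apply le_of_eq
          field_simp

lemma evalCircle_analyticSquare_re (X : Finset ℤ) (v : ℤ → ℂ) (θ : ℝ) :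
    (evalCircle θ (analyticSquare X v)).re = ‖evalCircle θ (blockPoly X v)‖ ^ 2 := by
  set a : ℤ → ℂ := fun k => v k / X.card * Complex.exp (k * θ * Complex.I) with ha
  have hconj : ∀ l : ℤ, conj (a l) = conj (v l / X.card) * Complex.exp (-(l * θ * Complex.I)) := by
    intro l
    rw [ha, map_mul, ← Complex.exp_conj]
    simp
  have hA : evalCircle θ (analyticSquare X v) = ∑ k ∈ X, ∑ l ∈ X,
      ((if k < l then 0 else if k = l then 1 else 2 : ℝ) : ℂ) * (a k * conj (a l)) := by
    simp only [analyticSquare, map_sum, evalCircle_single]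
    refine Finset.sum_congr rfl fun k _ => Finset.sum_congr rfl fun l _ => ?_
    rw [hconj, ha]
    have : Complex.exp ((k - l : ℤ) * θ * Complex.I) =
        Complex.exp (k * θ * Complex.I) * Complex.exp (-(l * θ * Complex.I)) := by
      rw [← Complex.exp_add]; congr 1; push_cast; ring
    rw [this]
    split_ifs <;> push_cast <;> ring
  have hb : evalCircle θ (blockPoly X v) = ∑ k ∈ X, a k := by
    simp [blockPoly, evalCircle_single, ha, -single_eq_C_mul_T]
  have hsq : ‖evalCircle θ (blockPoly X v)‖ ^ 2 = ∑ k ∈ X, ∑ l ∈ X, (a k * conj (a l)).re := by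
    have : ((‖evalCircle θ (blockPoly X v)‖ ^ 2 : ℝ) : ℂ) = ∑ k ∈ X, ∑ l ∈ X, a k * conj (a l) := by
      rw [hb, ← Finset.sum_mul_sum, ← map_sum, Complex.mul_conj, Complex.normSq_eq_norm_sq]
    rw [← Complex.ofReal_re (‖_‖ ^ 2), this]
    simp only [Complex.re_sum]
  have hsymm : ∀ k l, (a k * conj (a l)).re = (a l * conj (a k)).re := by
    intro k l
    rw [← Complex.conj_re (a k * conj (a l)), map_mul, Complex.conj_conj, mul_comm]
  rw [hA, hsq]
  simp only [Complex.re_sum, Complex.re_ofReal_mul]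
  have h2 := Finset.sum_comm (s := X) (t := X) (f := fun k l : ℤ =>
    (if k < l then 0 else if k = l then 1 else 2 : ℝ) * (a k * conj (a l)).re)
  have h3 : (∑ k ∈ X, ∑ l ∈ X, (if k < l then 0 else if k = l then 1 else 2 : ℝ) *
      (a k * conj (a l)).re) + (∑ k ∈ X, ∑ l ∈ X, (if l < k then 0 else if l = k then 1 else 2 : ℝ) *
      (a l * conj (a k)).re) = 2 * ∑ k ∈ X, ∑ l ∈ X, (a k * conj (a l)).re := by
    rw [← Finset.sum_add_distrib, Finset.mul_sum]
    refine Finset.sum_congr rfl fun k _ => ?_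
    rw [← Finset.sum_add_distrib, Finset.mul_sum]
    refine Finset.sum_congr rfl fun l _ => ?_
    rw [hsymm l k, ← add_mul]
    congr 1
    rcases lt_trichotomy k l with h | h | h
    · simp [h, h.not_gt, h.ne']
    · simp [h]; norm_num
    · simp [h, h.not_gt, h.ne']
  linarith

end LaurentPolynomial

namespace LaurentPolynomial

lemma coeff_one_of_neg {n : ℤ} (hn : n < 0) : (1 : ℂ[T;T⁻¹]).coeff n = 0 := by
  rw [AddMonoidAlgebra.one_def, AddMonoidAlgebra.coeff_single,
    Finsupp.single_eq_of_ne hn.ne]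

lemma coeff_pow_of_neg {p : ℂ[T;T⁻¹]} (hp : ∀ n < 0, p.coeff n = 0) (i : ℕ) :
    ∀ n < 0, (p ^ i).coeff n = 0 := by
  induction i with
  | zero => intro n hn; rw [pow_zero, coeff_one_of_neg hn]
  | succ i ih =>
    intro n hn
    rw [pow_succ]
    exact coeff_mul_eq_zero (fun k hk => ih k (by omega)) hp

lemma norm_one_sub_div_pow_le {z : ℂ} {x : ℝ} {m : ℕ} (hm : 0 < m) (hz : ‖z‖ ≤ 2)
    (hre : z.re = x ^ 2) : ‖(1 - z / m) ^ m‖ ≤ Real.exp (-x ^ 2) * Real.exp (2 / m) := by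
  have hm' : (0 : ℝ) < m := by exact_mod_cast hm
  have h1 : ‖1 - z / m‖ ^ 2 ≤ Real.exp (-2 * x ^ 2 / m + 4 / m ^ 2) := by
    have h2 : ‖1 - z / m‖ ^ 2 = 1 - 2 * x ^ 2 / m + ‖z‖ ^ 2 / m ^ 2 := by
      rw [← Complex.normSq_eq_norm_sq, Complex.normSq_sub, ← hre]
      simp [Complex.normSq_eq_norm_sq]
      ring
    have h3 : ‖z‖ ^ 2 / (m : ℝ) ^ 2 ≤ 4 / m ^ 2 := by
      gcongr
      nlinarith [norm_nonneg z]
    have h4 := Real.add_one_le_exp (-2 * x ^ 2 / m + 4 / m ^ 2)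
    rw [h2]
    have h5 : -2 * x ^ 2 / (m : ℝ) = -(2 * x ^ 2 / m) := by ring
    linarith
  rw [norm_pow, ← Real.exp_add]
  refine (pow_le_pow_iff_left₀ (by positivity) (by positivity) two_ne_zero).1 ?_
  rw [← pow_mul, mul_comm, pow_mul, ← Real.exp_nat_mul]
  refine (pow_le_pow_left₀ (by positivity) h1 m).trans ?_
  rw [← Real.exp_nat_mul]
  apply Real.exp_le_exp.2
  apply le_of_eq
  push_cast
  field_simp
  ring

/-- The damping factor of the McGehee–Pigno–Smith construction. -/
lemma exists_damping {κ : ℝ} (hκ : 0 < κ) :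
    ∃ K₁ K₂ : ℝ, 0 ≤ K₁ ∧ 0 ≤ K₂ ∧ ∀ (X : Finset ℤ) (v : ℤ → ℂ), (∀ k ∈ X, ‖v k‖ = 1) →
      ∃ E : ℂ[T;T⁻¹], (∀ n < 0, (E - 1).coeff n = 0) ∧
        (∀ n, ‖(E - 1).coeff n‖ ≤ K₂ / X.card) ∧ wienerNorm E ≤ K₁ ∧
        ∀ θ, ‖evalCircle θ E‖ + κ * ‖evalCircle θ (blockPoly X v)‖ ≤ 1 + 2 * κ ^ 2 := by
  have hlog : 0 < Real.log (1 + κ ^ 2) := Real.log_pos (by nlinarith)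
  obtain ⟨m, hm⟩ := exists_nat_gt (2 / Real.log (1 + κ ^ 2))
  have hm' : (0 : ℝ) < m := lt_trans (by positivity) hm
  have hm0 : 0 < m := by exact_mod_cast hm'
  have hm1 : (1 : ℝ) ≤ m := by exact_mod_cast hm0
  have hexp : Real.exp (2 / m) ≤ 1 + κ ^ 2 := by
    rw [← Real.exp_log (show 0 < 1 + κ ^ 2 by positivity)]
    apply Real.exp_le_exp.2
    rw [div_lt_iff₀ hlog] at hm
    rw [div_le_iff₀ hm']
    linarith
  refine ⟨3 ^ m, m * 3 ^ m * 2, by positivity, by positivity, fun X v hv => ?_⟩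
  set a : ℂ[T;T⁻¹] := (1 / m : ℂ) • analyticSquare X v with ha
  have hacoeff : ∀ n, ‖a.coeff n‖ ≤ ‖(analyticSquare X v).coeff n‖ := by
    intro n
    rw [ha, AddMonoidAlgebra.coeff_smul_apply, norm_smul, norm_div, norm_one, Complex.norm_natCast]
    refine mul_le_of_le_one_left (norm_nonneg _) ?_
    rw [div_le_one hm']
    exact hm1
  have haneg : ∀ n < 0, a.coeff n = 0 := by
    intro n hn
    rw [ha, AddMonoidAlgebra.coeff_smul_apply, coeff_analyticSquare_of_neg X v hn, smul_zero]
  have haw : wienerNorm a ≤ 2 := by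
    refine (wienerNorm_smul_le _ _).trans ((mul_le_of_le_one_left (wienerNorm_nonneg _) ?_).trans
      (wienerNorm_analyticSquare_le hv))
    rw [norm_div, norm_one, Complex.norm_natCast, div_le_one hm']
    exact hm1
  have hw : wienerNorm (1 - a) ≤ 3 := by
    rw [sub_eq_add_neg]
    refine (wienerNorm_add_le _ _).trans ?_
    rw [wienerNorm_one, wienerNorm_neg]
    linarith
  have hpow : ∀ i : ℕ, wienerNorm ((1 - a) ^ i) ≤ 3 ^ i := fun i =>
    (wienerNorm_pow_le _ _).trans (pow_le_pow_left₀ (wienerNorm_nonneg _) hw i)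
  have hneg1 : ∀ n < 0, (1 - a).coeff n = 0 := by
    intro n hn
    rw [AddMonoidAlgebra.coeff_sub, Finsupp.sub_apply, coeff_one_of_neg hn, haneg n hn, sub_zero]
  have hfac : (1 - a) ^ m - 1 = (∑ i ∈ Finset.range m, (1 - a) ^ i) * (-a) := by
    rw [← geom_sum_mul]
    congr 1
    ring
  refine ⟨(1 - a) ^ m, ?_, ?_, hpow m, ?_⟩
  · intro n hn
    rw [AddMonoidAlgebra.coeff_sub, Finsupp.sub_apply, coeff_one_of_neg hn,
      coeff_pow_of_neg hneg1 m n hn, sub_zero]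
  · intro n
    rw [hfac]
    have hc : ∀ n, ‖(-a).coeff n‖ ≤ 2 / X.card := fun n => by
      rw [AddMonoidAlgebra.coeff_neg, Finsupp.neg_apply, norm_neg]
      exact (hacoeff n).trans (norm_coeff_analyticSquare_le hv n)
    refine (norm_coeff_mul_le _ _ hc n).trans ?_
    have hQ : wienerNorm (∑ i ∈ Finset.range m, (1 - a) ^ i) ≤ m * 3 ^ m := by
      refine (wienerNorm_sum_le _ _).trans ?_
      refine (Finset.sum_le_card_nsmul _ _ (3 ^ m) fun i hi => ?_).trans ?_
      · exact (hpow i).trans (pow_le_pow_right₀ (by norm_num) (Finset.mem_range.1 hi).le)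
      · simp
    calc _ ≤ (m * 3 ^ m : ℝ) * (2 / X.card) := by gcongr
      _ = _ := by ring
  · intro θ
    set x := ‖evalCircle θ (blockPoly X v)‖ with hx
    have hx1 : x ≤ 1 := (norm_evalCircle_le _ _).trans (wienerNorm_blockPoly_le hv)
    have hx0 : 0 ≤ x := norm_nonneg _
    have hev : evalCircle θ ((1 - a) ^ m) = (1 - evalCircle θ (analyticSquare X v) / m) ^ m := by
      rw [map_pow, map_sub, map_one, ha, map_smul, smul_eq_mul]
      congr 2
      ring
    have hb := norm_one_sub_div_pow_le hm0
      ((norm_evalCircle_le θ _).trans (wienerNorm_analyticSquare_le hv))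
      (evalCircle_analyticSquare_re X v θ)
    rw [← hev, ← hx] at hb
    have he : Real.exp (-x ^ 2) ≤ 1 - x ^ 2 / 2 := by
      have h1 := Real.add_one_le_exp (x ^ 2)
      rw [Real.exp_neg, inv_eq_one_div, div_le_iff₀ (Real.exp_pos _)]
      nlinarith [sq_nonneg x, mul_le_mul hx1 hx1 hx0 zero_le_one]
    have : ‖evalCircle θ ((1 - a) ^ m)‖ ≤ (1 - x ^ 2 / 2) * (1 + κ ^ 2) :=
      hb.trans (mul_le_mul he hexp (Real.exp_pos _).le (by nlinarith))
    nlinarith [sq_nonneg (x - κ), mul_nonneg (sq_nonneg x) (sq_nonneg κ)]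

end LaurentPolynomial

/-- A finite set of a linear order has an upper segment of any smaller cardinality. -/
lemma Finset.exists_upper_subset {α : Type*} [LinearOrder α] (E : Finset α) {s : ℕ}
    (hs : s ≤ E.card) : ∃ T ⊆ E, T.card = s ∧ ∀ x ∈ T, ∀ y ∈ E \ T, y < x := by
  induction s with
  | zero => exact ⟨∅, by simp⟩
  | succ s ih =>
    obtain ⟨T, hTE, hT, hlt⟩ := ih (by omega)
    have hne : (E \ T).Nonempty := by
      rw [← Finset.card_pos, Finset.card_sdiff_of_subset hTE]
      omega
    have hmem := (E \ T).max'_mem hne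
    rw [Finset.mem_sdiff] at hmem
    refine ⟨insert ((E \ T).max' hne) T, Finset.insert_subset hmem.1 hTE,
      by rw [Finset.card_insert_of_notMem hmem.2, hT], fun x hx y hy => ?_⟩
    rw [Finset.mem_sdiff, Finset.mem_insert, not_or] at hy
    have hy' : y ∈ E \ T := Finset.mem_sdiff.2 ⟨hy.1, hy.2.2⟩
    rcases Finset.mem_insert.1 hx with rfl | hx
    · exact lt_of_le_of_ne (Finset.le_max' _ _ hy') hy.2.1
    · exact hlt x hx y hy'

namespace LaurentPolynomial

/-- McGehee–Pigno–Smith test polynomials: bounded on the unit circle, of bounded Wiener norm, and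
correlated with a given function on any sufficiently large set of frequencies. -/
lemma exists_testPoly {κ δ M : ℝ} (hκ : 0 < κ) (hδ : 0 < δ) (hM : 0 ≤ M) (l : ℕ) :
    ∃ (s : ℕ) (K : ℝ), 0 ≤ K ∧ ∀ (E : Finset ℤ) (g : ℤ → ℂ), E.card = s →
      (∀ n ∈ E, δ ≤ ‖g n‖ ∧ ‖g n‖ ≤ M) →
      ∃ φ : ℂ[T;T⁻¹], (∀ n, (∀ e ∈ E, n < e) → φ.coeff n = 0) ∧ wienerNorm φ ≤ K ∧
        (∀ θ, ‖evalCircle θ φ‖ ≤ (1 + 2 * κ ^ 2) ^ l) ∧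
        κ * δ * l / 2 ≤ (∑ n ∈ E, g n * conj (φ.coeff n)).re := by
  obtain ⟨K₁, K₂, hK₁, hK₂, hdamp⟩ := exists_damping hκ
  induction l with
  | zero => exact ⟨0, 0, le_rfl, fun E g _ _ => ⟨0, by simp⟩⟩
  | succ l ih =>
    obtain ⟨s, K, hK, ih⟩ := ih
    obtain ⟨r, hr⟩ := exists_nat_gt (s * M * (K * K₂) / (κ * δ / 2))
    have hr' : (0 : ℝ) < r := lt_of_le_of_lt (by positivity) hr
    have hr0 : (r : ℝ) ≠ 0 := hr'.ne'
    refine ⟨s + r, K * K₁ + κ, by positivity, fun E g hE hg => ?_⟩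
    obtain ⟨T, hTE, hT, hlt⟩ := E.exists_upper_subset (s := s) (by omega)
    obtain ⟨φ, hφ0, hφw, hφb, hφg⟩ := ih T g hT fun n hn => hg n (hTE hn)
    set X := E \ T with hX
    have hXr : X.card = r := by
      rw [hX, Finset.card_sdiff_of_subset hTE]; omega
    have hXE : X ⊆ E := Finset.sdiff_subset
    have hg0 : ∀ n ∈ E, ‖g n‖ ≠ 0 := fun n hn => (hδ.trans_le (hg n hn).1).ne'
    set v : ℤ → ℂ := fun n => g n / ‖g n‖ with hv
    have hv1 : ∀ k ∈ X, ‖v k‖ = 1 := by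
      intro k hk
      rw [hv, norm_div, Complex.norm_real, norm_norm, div_self (hg0 k (hXE hk))]
    obtain ⟨Q, hQneg, hQc, hQw, hQb⟩ := hdamp X v hv1
    rw [hXr] at hQc
    set ψ := φ * (Q - 1) with hψ
    have hψ0 : ∀ n, (∀ e ∈ T, n < e) → ψ.coeff n = 0 := fun n hn =>
      coeff_mul_eq_zero (fun k hk => hφ0 k fun e he => hk.trans_lt (hn e he)) hQneg
    have hcoeff : ∀ n, (φ * Q + (κ : ℂ) • blockPoly X v).coeff n =
        φ.coeff n + ψ.coeff n + κ * (blockPoly X v).coeff n := by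
      intro n
      have : φ * Q = φ + ψ := by rw [hψ]; ring
      rw [this]
      simp
    refine ⟨φ * Q + (κ : ℂ) • blockPoly X v, ?_, ?_, ?_, ?_⟩
    · intro n hn
      have hnT : ∀ e ∈ T, n < e := fun e he => hn e (hTE he)
      have hnX : n ∉ X := fun h => lt_irrefl _ (hn n (hXE h))
      rw [hcoeff, hφ0 n hnT, hψ0 n hnT, coeff_blockPoly, if_neg hnX]
      simp
    · refine (wienerNorm_add_le _ _).trans (add_le_add ?_ ?_)
      · refine (wienerNorm_mul_le _ _).trans ?_
        exact mul_le_mul hφw hQw (wienerNorm_nonneg _) hK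
      · refine (wienerNorm_smul_le _ _).trans ?_
        rw [Complex.norm_real, Real.norm_of_nonneg hκ.le]
        exact mul_le_of_le_one_right hκ.le (wienerNorm_blockPoly_le hv1)
    · intro θ
      rw [map_add, map_mul, map_smul, smul_eq_mul]
      refine (norm_add_le _ _).trans ?_
      rw [norm_mul, norm_mul, Complex.norm_real, Real.norm_of_nonneg hκ.le, pow_succ]
      have h1 : (1 : ℝ) ≤ (1 + 2 * κ ^ 2) ^ l := one_le_pow₀ (by nlinarith [sq_nonneg κ])
      calc _ ≤ (1 + 2 * κ ^ 2) ^ l * ‖evalCircle θ Q‖ +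
            (1 + 2 * κ ^ 2) ^ l * (κ * ‖evalCircle θ (blockPoly X v)‖) := by
            refine add_le_add ?_ (le_mul_of_one_le_left (by positivity) h1)
            exact mul_le_mul_of_nonneg_right (hφb θ) (norm_nonneg _)
        _ = (1 + 2 * κ ^ 2) ^ l * (‖evalCircle θ Q‖ + κ * ‖evalCircle θ (blockPoly X v)‖) := by
            ring
        _ ≤ _ := mul_le_mul_of_nonneg_left (hQb θ) (by positivity)
    · have hXsum : ∑ n ∈ X, g n * conj ((φ * Q + (κ : ℂ) • blockPoly X v).coeff n) =
          ((κ * ∑ n ∈ X, ‖g n‖ / r : ℝ) : ℂ) := by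
        push_cast
        rw [Finset.mul_sum]
        refine Finset.sum_congr rfl fun n hn => ?_
        have hnT : ∀ e ∈ T, n < e := fun e he => hlt e he n hn
        rw [hcoeff, hφ0 n hnT, hψ0 n hnT, coeff_blockPoly, if_pos hn, hXr, hv]
        have h0 : (‖g n‖ : ℂ) ≠ 0 := by exact_mod_cast hg0 n (hXE hn)
        simp only [zero_add, map_mul, map_div₀, Complex.conj_ofReal, map_natCast]
        have := Complex.mul_conj (g n)
        rw [Complex.normSq_eq_norm_sq] at this
        push_cast at this
        field_simp
        linear_combination (κ / r : ℂ) * this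
      have hTsum : ∑ n ∈ T, g n * conj ((φ * Q + (κ : ℂ) • blockPoly X v).coeff n) =
          ∑ n ∈ T, g n * conj (φ.coeff n) + ∑ n ∈ T, g n * conj (ψ.coeff n) := by
        rw [← Finset.sum_add_distrib]
        refine Finset.sum_congr rfl fun n hn => ?_
        rw [hcoeff, coeff_blockPoly, if_neg (fun h => (Finset.mem_sdiff.1 h).2 hn)]
        simp [mul_add]
      have herr : ‖∑ n ∈ T, g n * conj (ψ.coeff n)‖ ≤ κ * δ / 2 := by
        refine (norm_sum_le_of_le T (f := fun n => g n * conj (ψ.coeff n))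
          (n := fun _ => M * (K * (K₂ / r))) fun n hn => ?_).trans ?_
        · rw [norm_mul, RCLike.norm_conj]
          refine mul_le_mul (hg n (hTE hn)).2 ?_ (norm_nonneg _) hM
          refine (norm_coeff_mul_le _ _ hQc n).trans ?_
          gcongr
        · rw [Finset.sum_const, hT, nsmul_eq_mul]
          rw [div_lt_iff₀ (by positivity)] at hr
          have : (s : ℝ) * (M * (K * (K₂ / r))) = s * M * (K * K₂) / r := by ring
          rw [this, div_le_iff₀ hr']
          linarith
      have hmain : κ * δ ≤ κ * ∑ n ∈ X, ‖g n‖ / r := by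
        refine mul_le_mul_of_nonneg_left ?_ hκ.le
        have : ∑ n ∈ X, δ / r = δ := by
          rw [Finset.sum_const, hXr, nsmul_eq_mul]; field_simp
        rw [← this]
        refine Finset.sum_le_sum fun n hn => ?_
        gcongr
        exact (hg n (hXE hn)).1
      rw [← Finset.sum_sdiff hTE, hXsum, hTsum, Complex.add_re, Complex.add_re, Complex.ofReal_re]
      have := (abs_le.1 ((Complex.abs_re_le_norm _).trans herr)).1
      push_cast
      linarith

/-- A robust qualitative form of the Littlewood `L¹` conjecture: if the coefficients of `G` are either
at most `ε` or at least `δ` in modulus, and `G` is bounded as a functional on polynomials with the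
sup norm on the circle, then `G` has boundedly many coefficients of modulus at least `δ`. -/
lemma exists_bound_card_large_coeff {δ M C : ℝ} (hδ : 0 < δ) (hM : 0 ≤ M) (hC : 0 ≤ C) :
    ∃ (s : ℕ) (ε : ℝ), 0 < ε ∧ ∀ G : ℂ[T;T⁻¹], (∀ n, ‖G.coeff n‖ ≤ M) →
      (∀ (φ : ℂ[T;T⁻¹]) (S : ℝ), (∀ θ, ‖evalCircle θ φ‖ ≤ S) →
        ‖∑ n ∈ G.coeff.support, G.coeff n * conj (φ.coeff n)‖ ≤ C * S) →
      (∀ n, ‖G.coeff n‖ ≤ ε ∨ δ ≤ ‖G.coeff n‖) →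
      (G.coeff.support.filter fun n => δ ≤ ‖G.coeff n‖).card ≤ s := by
  obtain ⟨J, hJ⟩ := exists_nat_gt (((C * Real.exp 2 + 1) * 2 / δ) ^ 2)
  have hJ' : (0 : ℝ) < J := lt_of_le_of_lt (by positivity) hJ
  have hsq : (C * Real.exp 2 + 1) * 2 / δ < √J := Real.lt_sqrt_of_sq_lt hJ
  have hs0 : 0 < √(J : ℝ) := Real.sqrt_pos.2 hJ'
  obtain ⟨s, K, hK, htest⟩ := exists_testPoly (κ := 1 / √J) (by positivity) hδ hM J
  refine ⟨s, 1 / (K + 1), by positivity, fun G hGM hdual hgap => ?_⟩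
  by_contra! hcard
  set E := G.coeff.support.filter fun n => δ ≤ ‖G.coeff n‖ with hE
  obtain ⟨T, hTE, hT, hlt⟩ := E.exists_upper_subset hcard.le
  have hTG : T ⊆ G.coeff.support := hTE.trans (Finset.filter_subset _ _)
  obtain ⟨φ, hφ0, hφw, hφb, hφg⟩ := htest T G.coeff hT fun n hn =>
    ⟨(Finset.mem_filter.1 (hTE hn)).2, hGM n⟩
  have hS : (1 + 2 * (1 / √J) ^ 2) ^ J ≤ Real.exp 2 := by
    have h1 : 1 + 2 * (1 / √J) ^ 2 ≤ Real.exp (2 / J) := by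
      rw [div_pow, Real.sq_sqrt hJ'.le]
      have := Real.add_one_le_exp (2 / (J : ℝ))
      have h2 : 2 * (1 ^ 2 / (J : ℝ)) = 2 / J := by ring
      linarith
    refine (pow_le_pow_left₀ (by positivity) h1 J).trans ?_
    rw [← Real.exp_nat_mul]
    apply le_of_eq
    congr 1
    field_simp
  have hd := hdual φ (Real.exp 2) fun θ => (hφb θ).trans hS
  have hrest : ‖∑ n ∈ G.coeff.support \ T, G.coeff n * conj (φ.coeff n)‖ ≤ 1 := by
    refine (norm_sum_le_of_le _ (n := fun n => 1 / (K + 1) * ‖φ.coeff n‖) fun n hn => ?_).trans ?_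
    · rw [norm_mul, RCLike.norm_conj]
      rw [Finset.mem_sdiff] at hn
      rcases hgap n with h | h
      · gcongr
      · have : n ∈ E \ T := Finset.mem_sdiff.2 ⟨Finset.mem_filter.2 ⟨hn.1, h⟩, hn.2⟩
        rw [hφ0 n fun e he => hlt e he n this]
        simp
    · rw [← Finset.mul_sum]
      have h1 := (sum_norm_coeff_le_wienerNorm φ (G.coeff.support \ T)).trans hφw
      calc _ ≤ 1 / (K + 1) * K := by gcongr
        _ ≤ 1 := by rw [one_div_mul_eq_div, div_le_one (by positivity)]; linarith
  rw [← Finset.sum_sdiff hTG] at hd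
  have hre := (Complex.abs_re_le_norm _).trans hd
  have hre2 := (Complex.abs_re_le_norm _).trans hrest
  rw [Complex.add_re] at hre
  have hb := (abs_le.1 hre).2
  have hb2 := (abs_le.1 hre2).1
  have hJs : 1 / √J * δ * J / 2 = √J * δ / 2 := by
    have : √(J : ℝ) * √J = J := Real.mul_self_sqrt hJ'.le
    field_simp
    nlinarith
  rw [hJs] at hφg
  rw [div_lt_iff₀ hδ] at hsq
  linarith

end LaurentPolynomial

namespace LaurentPolynomial

lemma evalCircle_eq_sum (θ : ℝ) (p : ℂ[T;T⁻¹]) :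
    evalCircle θ p = ∑ n ∈ p.coeff.support, p.coeff n * Complex.exp (n * θ * Complex.I) := by
  conv_lhs => rw [← AddMonoidAlgebra.sum_coeff_single p, Finsupp.sum, map_sum]
  exact Finset.sum_congr rfl fun n _ => evalCircle_single θ n _

lemma continuous_evalCircle (p : ℂ[T;T⁻¹]) : Continuous fun θ : ℝ => evalCircle θ p := by
  simp only [evalCircle_eq_sum]
  fun_prop

lemma integral_exp_int_mul (k : ℤ) :
    ∫ θ in (0 : ℝ)..2 * Real.pi, Complex.exp (k * θ * Complex.I) =
      if k = 0 then 2 * (Real.pi : ℂ) else 0 := by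
  split_ifs with hk
  · simp [hk]
  · have hc : (k * Complex.I : ℂ) ≠ 0 := by simp [hk]
    have h := integral_exp_mul_complex (a := 0) (b := 2 * Real.pi) hc
    have h2 : ∀ θ : ℝ, (k * θ * Complex.I : ℂ) = k * Complex.I * θ := fun θ => by ring
    simp only [h2]
    rw [h]
    have h3 : (k * Complex.I * ((2 * Real.pi : ℝ) : ℂ)) = k * (2 * Real.pi * Complex.I) := by
      push_cast; ring
    rw [h3, Complex.exp_int_mul_two_pi_mul_I]
    simp

lemma integral_evalCircle_mul_conj (G φ : ℂ[T;T⁻¹]) :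
    ∫ θ in (0 : ℝ)..2 * Real.pi, evalCircle θ G * conj (evalCircle θ φ) =
      2 * Real.pi * ∑ n ∈ G.coeff.support, G.coeff n * conj (φ.coeff n) := by
  have h : ∀ θ : ℝ, evalCircle θ G * conj (evalCircle θ φ) =
      ∑ n ∈ G.coeff.support, ∑ m ∈ φ.coeff.support,
        (G.coeff n * conj (φ.coeff m)) * Complex.exp ((n - m : ℤ) * θ * Complex.I) := by
    intro θ
    rw [evalCircle_eq_sum, evalCircle_eq_sum, map_sum, Finset.sum_mul_sum]
    refine Finset.sum_congr rfl fun n _ => Finset.sum_congr rfl fun m _ => ?_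
    have : Complex.exp ((n - m : ℤ) * θ * Complex.I) = Complex.exp (n * θ * Complex.I) *
        conj (Complex.exp (m * θ * Complex.I)) := by
      rw [← Complex.exp_conj, ← Complex.exp_add]
      congr 1
      simp
      ring
    rw [this, map_mul]
    ring
  simp only [h]
  rw [intervalIntegral.integral_finsetSum fun n _ =>
    (Continuous.intervalIntegrable (by fun_prop) _ _), Finset.mul_sum]
  refine Finset.sum_congr rfl fun n _ => ?_
  rw [intervalIntegral.integral_finsetSum fun n _ =>
    (Continuous.intervalIntegrable (by fun_prop) _ _)]
  simp only [intervalIntegral.integral_const_mul, integral_exp_int_mul, sub_eq_zero, mul_ite,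
    mul_zero, Finset.sum_ite_eq, Finsupp.mem_support_iff]
  split_ifs with h0
  · ring
  · simp [not_not.1 h0]

/-- If `G` has constant argument on the unit circle, its `L¹`-norm is its constant coefficient. -/
lemma norm_sum_coeff_mul_conj_le {G : ℂ[T;T⁻¹]} {σ : ℂ} (hσ : ‖σ‖ = 1)
    (hG : ∀ θ ∈ Set.Ico 0 (2 * Real.pi), evalCircle θ G = σ * ‖evalCircle θ G‖)
    (φ : ℂ[T;T⁻¹]) (S : ℝ) (hφ : ∀ θ, ‖evalCircle θ φ‖ ≤ S) :
    ‖∑ n ∈ G.coeff.support, G.coeff n * conj (φ.coeff n)‖ ≤ ‖G.coeff 0‖ * S := by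
  have hpi : 0 < 2 * Real.pi := Real.two_pi_pos
  have hcG := continuous_evalCircle G
  have hcφ := continuous_evalCircle φ
  have hG' : ∀ θ ∈ Set.uIcc 0 (2 * Real.pi), evalCircle θ G = σ * ‖evalCircle θ G‖ := by
    rw [Set.uIcc_of_le hpi.le, ← closure_Ico hpi.ne]
    exact closure_minimal hG (isClosed_eq hcG (by fun_prop))
  have hL1 : ∫ θ in (0 : ℝ)..2 * Real.pi, ‖evalCircle θ G‖ = 2 * Real.pi * ‖G.coeff 0‖ := by
    have h1 : ∫ θ in (0 : ℝ)..2 * Real.pi, evalCircle θ G = 2 * Real.pi * G.coeff 0 := by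
      have := integral_evalCircle_mul_conj G 1
      simp only [map_one, mul_one] at this
      rw [this]
      congr 1
      simp only [AddMonoidAlgebra.one_def, AddMonoidAlgebra.coeff_single, Finsupp.single_apply]
      simp [Finset.sum_ite_eq]
      tauto
    rw [intervalIntegral.integral_congr hG', intervalIntegral.integral_const_mul,
      intervalIntegral.integral_ofReal] at h1
    have h2 := congrArg norm h1
    rw [norm_mul, hσ, one_mul, Complex.norm_real, Real.norm_of_nonneg
      (intervalIntegral.integral_nonneg hpi.le fun _ _ => norm_nonneg _)] at h2
    rw [h2]
    simp [abs_of_pos Real.pi_pos]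
  have hle : ‖∫ θ in (0 : ℝ)..2 * Real.pi, evalCircle θ G * conj (evalCircle θ φ)‖ ≤
      ∫ θ in (0 : ℝ)..2 * Real.pi, ‖evalCircle θ G‖ * S := by
    refine intervalIntegral.norm_integral_le_of_norm_le hpi.le ?_
      (Continuous.intervalIntegrable (by fun_prop) _ _)
    filter_upwards with θ _
    rw [norm_mul, RCLike.norm_conj]
    exact mul_le_mul_of_nonneg_left (hφ θ) (norm_nonneg _)
  rw [integral_evalCircle_mul_conj, intervalIntegral.integral_mul_const, hL1, norm_mul] at hle
  have h2 : ‖(2 * Real.pi : ℂ)‖ = 2 * Real.pi := by simp [abs_of_pos Real.pi_pos]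
  rw [h2, mul_assoc (2 * Real.pi) ‖G.coeff 0‖ S] at hle
  exact le_of_mul_le_mul_left hle hpi

/-- A polynomial with prescribed zeros on the circle and its real form. -/
lemma exists_poly_eq_prod_sin (ts : Multiset ℝ) :
    ∃ (Q : ℂ[T;T⁻¹]) (γ : ℂ), γ ≠ 0 ∧ Q.coeff 0 = 1 ∧ (∀ n < 0, Q.coeff n = 0) ∧
      (∀ n : ℤ, ts.card < n → Q.coeff n = 0) ∧ wienerNorm Q ≤ 2 ^ ts.card ∧
      ∀ θ : ℝ, (((ts.map fun t => Real.sin ((θ - t) / 2)).prod : ℝ) : ℂ) =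
        γ * Complex.exp (-(ts.card * θ * Complex.I / 2)) * evalCircle θ Q := by
  induction ts using Multiset.induction with
  | empty =>
    refine ⟨1, 1, one_ne_zero, ?_, fun n hn => coeff_one_of_neg hn, fun n hn => ?_, by simp,
      by simp⟩
    · rw [AddMonoidAlgebra.one_def, AddMonoidAlgebra.coeff_single, Finsupp.single_eq_same]
    · rw [AddMonoidAlgebra.one_def, AddMonoidAlgebra.coeff_single, Finsupp.single_eq_of_ne]
      simp at hn
      omega
  | cons t ts ih =>
    obtain ⟨Q, γ, hγ, hQ0, hQneg, hQbig, hQw, hQ⟩ := ih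
    set w : ℂ := Complex.exp (-(t * Complex.I)) with hw
    have hw1 : ‖w‖ = 1 := by
      have := Complex.norm_exp_ofReal_mul_I (-t)
      push_cast at this
      rw [hw, ← neg_mul, this]
    have hcoeff : ∀ n, (Q * (1 - AddMonoidAlgebra.single 1 w)).coeff n =
        Q.coeff n - Q.coeff (n - 1) * w := by
      intro n
      rw [mul_sub, mul_one, AddMonoidAlgebra.coeff_sub, Finsupp.sub_apply,
        AddMonoidAlgebra.coeff_mul_single_apply, sub_eq_add_neg n 1]
    refine ⟨Q * (1 - AddMonoidAlgebra.single 1 w),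
      γ * (Complex.I / 2 * Complex.exp (t * Complex.I / 2)), ?_, ?_, ?_, ?_, ?_, ?_⟩
    · exact mul_ne_zero hγ (mul_ne_zero (by simp) (Complex.exp_ne_zero _))
    · rw [hcoeff, hQ0, hQneg (0 - 1) (by norm_num)]; simp
    · intro n hn
      rw [hcoeff, hQneg n hn, hQneg (n - 1) (by omega)]; simp
    · intro n hn
      rw [Multiset.card_cons] at hn
      push_cast at hn
      rw [hcoeff, hQbig n (by omega), hQbig (n - 1) (by omega)]; simp
    · rw [Multiset.card_cons, pow_succ]
      refine (wienerNorm_mul_le _ _).trans (mul_le_mul hQw ?_ (wienerNorm_nonneg _) (by positivity))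
      rw [sub_eq_add_neg]
      refine (wienerNorm_add_le _ _).trans ?_
      rw [wienerNorm_one, wienerNorm_neg, wienerNorm_single, hw1]
      norm_num
    · intro θ
      have hsin : Complex.sin ((θ - t) / 2) = Complex.I / 2 * Complex.exp (t * Complex.I / 2) *
          Complex.exp (-(θ * Complex.I / 2)) * (1 - w * Complex.exp (θ * Complex.I)) := by
        have h1 : Complex.exp (t * Complex.I / 2) * Complex.exp (-(θ * Complex.I / 2)) *
            (w * Complex.exp (θ * Complex.I)) = Complex.exp ((θ - t) / 2 * Complex.I) := by
          rw [hw, ← Complex.exp_add, ← Complex.exp_add, ← Complex.exp_add]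
          congr 1
          ring
        have h2 : Complex.exp (t * Complex.I / 2) * Complex.exp (-(θ * Complex.I / 2)) =
            Complex.exp (-((θ - t) / 2) * Complex.I) := by
          rw [← Complex.exp_add]
          congr 1
          ring
        rw [Complex.sin]
        linear_combination (Complex.I / 2) * h1 - (Complex.I / 2) * h2
      rw [Multiset.map_cons, Multiset.prod_cons, Complex.ofReal_mul, hQ θ, map_mul, map_sub,
        map_one, evalCircle_single, Multiset.card_cons]
      push_cast
      have h3 : Complex.exp (-((ts.card + 1) * θ * Complex.I / 2)) =
          Complex.exp (-(ts.card * θ * Complex.I / 2)) * Complex.exp (-(θ * Complex.I / 2)) := by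
        rw [← Complex.exp_add]
        congr 1
        ring
      rw [hsin, h3]
      simp only [one_mul]
      ring

end LaurentPolynomial

lemma IsPreconnected.forall_nonneg_or_forall_nonpos {α : Type*} [TopologicalSpace α] {s : Set α}
    (hs : IsPreconnected s) {h : α → ℝ} (hc : ContinuousOn h s) (h0 : ∀ x ∈ s, h x ≠ 0) :
    (∀ x ∈ s, 0 ≤ h x) ∨ ∀ x ∈ s, h x ≤ 0 := by
  by_contra! hcon
  obtain ⟨⟨x, hx, hx0⟩, y, hy, hy0⟩ := hcon
  obtain ⟨z, hz, hz0⟩ := hs.intermediate_value hx hy hc ⟨hx0.le, hy0.le⟩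
  exact h0 z hz hz0

/-- A continuous function with finitely many zeros has the sign pattern of a polynomial. -/
lemma exists_prod_sub_mul_nonneg {f : ℝ → ℝ} (hf : Continuous f) (a : ℝ) (Z : Finset ℝ)
    (hZ : ∀ z ∈ Z, f z = 0) (b : ℝ) (hb : ∀ x ∈ Set.Ico a b, f x = 0 → x ∈ Z) :
    ∃ T ⊆ Z, ∃ σ : ℝ, |σ| = 1 ∧ ∀ x ∈ Set.Ico a b, 0 ≤ σ * (f x * ∏ t ∈ T, (x - t)) := by
  induction Z using Finset.induction_on_max generalizing b with
  | empty =>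
    have hne : ∀ x ∈ Set.Ico a b, f x ≠ 0 := fun x hx h => by simpa using hb x hx h
    rcases isPreconnected_Ico.forall_nonneg_or_forall_nonpos hf.continuousOn hne with h | h
    · exact ⟨∅, by simp, 1, by simp, fun x hx => by simpa using h x hx⟩
    · exact ⟨∅, by simp, -1, by simp, fun x hx => by simpa using h x hx⟩
  | insert t Z hlt ih =>
    have hZ' : ∀ z ∈ Z, f z = 0 := fun z hz => hZ z (Finset.mem_insert_of_mem hz)
    by_cases ht : t ∈ Set.Ico a b
    · obtain ⟨T, hTZ, σ, hσ, hT⟩ := ih hZ' t fun x hx hx0 => by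
        have := hb x ⟨hx.1, hx.2.trans ht.2⟩ hx0
        exact (Finset.mem_insert.1 this).resolve_left hx.2.ne
      have htT : t ∉ T := fun h => lt_irrefl _ (hlt t (hTZ h))
      have hft : f t = 0 := hZ t (Finset.mem_insert_self _ _)
      have hσ0 : σ ≠ 0 := by
        rintro rfl
        simp at hσ
      have hne : ∀ x ∈ Set.Ioo t b, σ * (f x * ∏ t ∈ T, (x - t)) ≠ 0 := by
        intro x hx
        refine mul_ne_zero hσ0 (mul_ne_zero (fun h => ?_) (Finset.prod_ne_zero_iff.2 fun s hs => ?_))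
        · rcases Finset.mem_insert.1 (hb x ⟨ht.1.trans hx.1.le, hx.2⟩ h) with h | h
          · exact hx.1.ne' h
          · exact lt_asymm hx.1 (hlt x h)
        · exact sub_ne_zero.2 ((hlt s (hTZ hs)).trans hx.1).ne'
      rcases isPreconnected_Ioo.forall_nonneg_or_forall_nonpos
        (Continuous.continuousOn (by fun_prop)) hne with h | h
      · refine ⟨T, hTZ.trans (Finset.subset_insert _ _), σ, hσ, fun x hx => ?_⟩
        rcases lt_trichotomy x t with hxt | rfl | hxt
        · exact hT x ⟨hx.1, hxt⟩
        · simp [hft]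
        · exact h x ⟨hxt, hx.2⟩
      · refine ⟨insert t T, Finset.insert_subset_insert _ hTZ, -σ, by rwa [abs_neg],
          fun x hx => ?_⟩
        rw [Finset.prod_insert htT]
        have heq : -σ * (f x * ((x - t) * ∏ t ∈ T, (x - t))) =
          -(x - t) * (σ * (f x * ∏ t ∈ T, (x - t))) := by ring
        rw [heq]
        rcases lt_trichotomy x t with hxt | rfl | hxt
        · exact mul_nonneg (by linarith) (hT x ⟨hx.1, hxt⟩)
        · simp
        · exact mul_nonneg_of_nonpos_of_nonpos (by linarith) (h x ⟨hxt, hx.2⟩)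
    · obtain ⟨T, hTZ, hT⟩ := ih hZ' b fun x hx hx0 =>
        (Finset.mem_insert.1 (hb x hx hx0)).resolve_left fun h => ht (h ▸ hx)
      exact ⟨T, hTZ.trans (Finset.subset_insert _ _), hT⟩

lemma exists_sin_half_eq_mul {y : ℝ} (hy : |y| ≤ 2 * Real.pi) :
    ∃ c, 0 ≤ c ∧ Real.sin (y / 2) = c * y := by
  rw [abs_le] at hy
  rcases lt_trichotomy y 0 with h | rfl | h
  · refine ⟨Real.sin (y / 2) / y, div_nonneg_of_nonpos ?_ h.le, (div_mul_cancel₀ _ h.ne).symm⟩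
    exact Real.sin_nonpos_of_nonpos_of_neg_pi_le (by linarith) (by linarith)
  · exact ⟨0, le_rfl, by simp⟩
  · refine ⟨Real.sin (y / 2) / y, div_nonneg ?_ h.le, (div_mul_cancel₀ _ h.ne').symm⟩
    exact Real.sin_nonneg_of_nonneg_of_le_pi (by linarith) (by linarith)

namespace LaurentPolynomial

/-- If the coefficients of `G` take few small absolute values, then few of them are large, for
some notion of large. -/
lemma exists_bound_card_large_coeff_of_values {M C : ℝ} (hM : 0 ≤ M) (hC : 0 ≤ C) (P : ℕ)
    {δ₀ : ℝ} (hδ₀ : 0 < δ₀) :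
    ∃ s : ℕ, ∀ G : ℂ[T;T⁻¹], (∀ n, ‖G.coeff n‖ ≤ M) →
      (∀ (φ : ℂ[T;T⁻¹]) (S : ℝ), (∀ θ, ‖evalCircle θ φ‖ ≤ S) →
        ‖∑ n ∈ G.coeff.support, G.coeff n * conj (φ.coeff n)‖ ≤ C * S) →
      ∀ V : Finset ℝ, V.card ≤ P → (∀ n, ‖G.coeff n‖ < δ₀ → ‖G.coeff n‖ ∈ V) →
      ∃ δ, 0 < δ ∧ δ ≤ δ₀ ∧ (G.coeff.support.filter fun n => δ ≤ ‖G.coeff n‖).card ≤ s := by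
  induction P generalizing δ₀ with
  | zero =>
    obtain ⟨s, ε, hε, h⟩ := exists_bound_card_large_coeff hδ₀ hM hC
    refine ⟨s, fun G hG hdual V hV hGV => ⟨δ₀, hδ₀, le_rfl, h G hG hdual fun n => ?_⟩⟩
    rw [nonpos_iff_eq_zero, Finset.card_eq_zero] at hV
    refine Or.inr (not_lt.1 fun hn => ?_)
    simpa [hV] using hGV n hn
  | succ P ih =>
    obtain ⟨s₁, ε, hε, h⟩ := exists_bound_card_large_coeff hδ₀ hM hC
    obtain ⟨s₂, h₂⟩ := ih (δ₀ := min ε δ₀) (lt_min hε hδ₀)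
    refine ⟨max s₁ s₂, fun G hG hdual V hV hGV => ?_⟩
    by_cases hgap : ∀ n, ‖G.coeff n‖ ≤ ε ∨ δ₀ ≤ ‖G.coeff n‖
    · exact ⟨δ₀, hδ₀, le_rfl, (h G hG hdual hgap).trans (le_max_left _ _)⟩
    · push Not at hgap
      obtain ⟨m, hm1, hm2⟩ := hgap
      have hcard : (V.erase ‖G.coeff m‖).card ≤ P := by
        rw [Finset.card_erase_of_mem (hGV m hm2)]
        omega
      obtain ⟨δ, hδ, hδ', hs⟩ := h₂ G hG hdual _ hcard fun n hn => by
        rw [lt_min_iff] at hn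
        exact Finset.mem_erase.2 ⟨(hn.1.trans hm1).ne, hGV n hn.2⟩
      exact ⟨δ, hδ, hδ'.trans (min_le_right _ _), hs.trans (le_max_right _ _)⟩

end LaurentPolynomial

/-- A sequence over a finite alphabet, each of whose terms is determined by the preceding `m` ones,
is eventually periodic. -/
lemma eq_add_of_determined {α : Type*} {β : ℤ → α} {W : Finset α} (hW : ∀ k, β k ∈ W) {m : ℕ}
    {good : ℤ → Prop}
    (hdet : ∀ n n', good n → good n' → (∀ j : ℕ, 1 ≤ j → j ≤ m → β (n - j) = β (n' - j)) →
      β n = β n')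
    {D : ℕ} (hD : (W.card ^ m).factorial ∣ D) {n : ℤ}
    (hgood : ∀ k, n - (W.card ^ m : ℕ) ≤ k → k ≤ n + D → good k) : β n = β (n + D) := by
  classical
  obtain ⟨p, q, hq, hpq, hp, hwin⟩ : ∃ (p : ℤ) (q : ℕ), 1 ≤ q ∧ p + q ≤ n ∧
      n - (W.card ^ m : ℕ) ≤ p ∧ ∀ j : ℕ, 1 ≤ j → j ≤ m → β (p - j) = β (p + q - j) := by
    have hcard : Fintype.card (Fin m → W) < Fintype.card (Fin (W.card ^ m + 1)) := by simp
    obtain ⟨i, i', hne, hii⟩ := Fintype.exists_ne_map_eq_of_card_lt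
      (fun (i : Fin (W.card ^ m + 1)) (j : Fin m) =>
        (⟨β (n - (i : ℕ) - ((j : ℕ) + 1 : ℕ)), hW _⟩ : W)) hcard
    wlog hlt : i < i' generalizing i i'
    · exact this i' i hne.symm hii.symm (lt_of_le_of_ne (not_lt.1 hlt) hne.symm)
    have hlt' : (i : ℕ) < i' := hlt
    have := i'.isLt
    refine ⟨n - (i' : ℕ), i' - i, by omega, by omega, by omega, fun j hj hjm => ?_⟩
    have h := congrArg Subtype.val (congrFun hii ⟨j - 1, by omega⟩)
    simp only [Nat.sub_add_cancel hj] at h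
    rw [← h]
    congr 1
    omega
  have hper : ∀ t : ℕ, p + t + q ≤ n + D → β (p + t) = β (p + t + q) := by
    intro t
    induction t using Nat.strong_induction_on with
    | _ t ih =>
      intro ht
      refine hdet _ _ (hgood _ (by omega) (by omega)) (hgood _ (by omega) (by omega))
        fun j hj hjm => ?_
      rcases le_or_gt j t with hjt | hjt
      · have h := ih (t - j) (by omega) (by omega)
        push_cast [Nat.cast_sub hjt] at h
        convert h using 2 <;> ring
      · have h := hwin (j - t) (by omega) (by omega)
        push_cast [Nat.cast_sub hjt.le] at h
        convert h using 2 <;> ring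
  have hmul : ∀ r : ℕ, r * q ≤ D → β n = β (n + (r * q : ℕ)) := by
    intro r
    induction r with
    | zero => intro; simp
    | succ r ih =>
      intro hr
      rw [Nat.succ_mul] at hr ⊢
      rw [ih (by omega)]
      have h := hper ((n - p).toNat + r * q) (by omega)
      convert h using 2 <;> omega
  have hqT : q ≤ W.card ^ m := by omega
  obtain ⟨r, hr⟩ := (Nat.dvd_factorial hq hqT).trans hD
  rw [mul_comm] at hr
  have h := hmul r hr.ge
  rwa [← hr] at h

lemma Finset.exists_eq_Icc_of_ordConnected {S : Finset ℕ}
    (hS : ∀ a ∈ S, ∀ b ∈ S, ∀ n, a ≤ n → n ≤ b → n ∈ S) : ∃ a b, S = Finset.Icc a b := by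
  rcases S.eq_empty_or_nonempty with rfl | hne
  · exact ⟨1, 0, by simp⟩
  · refine ⟨S.min' hne, S.max' hne, Finset.ext fun n => ?_⟩
    rw [Finset.mem_Icc]
    exact ⟨fun hn => ⟨S.min'_le n hn, S.le_max' n hn⟩,
      fun hn => hS _ (S.min'_mem hne) _ (S.max'_mem hne) n hn.1 hn.2⟩

/-- Cutting `{1, …, N}` near the elements of a finite set yields intervals that avoid it. -/
lemma exists_partition_Icc_avoiding (bad : Finset ℤ) (N : ℕ) {w D : ℕ} (hwD : w < D) :
    ∃ L ≤ 2 * bad.card + 1, ∃ I : Fin L → Finset ℕ,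
      (∀ j, ∃ a b : ℕ, I j = Finset.Icc a b) ∧
      (∀ j k, j ≠ k → Disjoint (I j) (I k)) ∧
      (Finset.univ.biUnion I = Finset.Icc 1 N) ∧
      ∀ j, ∀ n ∈ I j, n + D ∈ I j → ∀ k : ℤ, (n : ℤ) - w ≤ k → k ≤ n + D → k ∉ bad := by
  classical
  set C : Finset ℤ := bad ∪ bad.image fun x => x + w + 1 with hC
  have hCcard : C.card ≤ 2 * bad.card := by
    have h1 := Finset.card_union_le bad (bad.image fun x : ℤ => x + w + 1)
    rw [← hC] at h1
    have h2 := Finset.card_image_le (s := bad) (f := fun x : ℤ => x + w + 1)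
    omega
  set g : ℕ → ℕ := fun n => (C.filter fun c => c ≤ (n : ℤ)).card with hg
  have hgmono : Monotone g := fun a b hab => Finset.card_le_card fun c hc => by
    rw [Finset.mem_filter] at hc ⊢
    exact ⟨hc.1, hc.2.trans (by exact_mod_cast hab)⟩
  have hglt : ∀ (a b : ℕ), ∀ c ∈ C, (a : ℤ) < c → c ≤ b → g a < g b := by
    intro a b c hc hac hcb
    refine Finset.card_lt_card (Finset.ssubset_iff_of_subset (fun x hx => ?_) |>.2 ⟨c, ?_, ?_⟩)
    · rw [Finset.mem_filter] at hx ⊢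
      exact ⟨hx.1, by omega⟩
    · exact Finset.mem_filter.2 ⟨hc, hcb⟩
    · rw [Finset.mem_filter]
      exact fun h => absurd h.2 (by omega)
  refine ⟨C.card + 1, by omega, fun j => (Finset.Icc 1 N).filter fun n => g n = j,
    fun j => ?_, fun j k hjk => ?_, ?_, fun j n hn hnD k hk1 hk2 hkbad => ?_⟩
  · refine Finset.exists_eq_Icc_of_ordConnected fun a ha b hb n han hnb => ?_
    simp only [Finset.mem_filter, Finset.mem_Icc] at ha hb ⊢
    have := hgmono han
    have := hgmono hnb
    omega
  · refine Finset.disjoint_left.2 fun n hn hn' => hjk (Fin.ext ?_)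
    rw [Finset.mem_filter] at hn hn'
    exact hn.2.symm.trans hn'.2
  · ext n
    simp only [Finset.mem_biUnion, Finset.mem_univ, true_and, Finset.mem_filter]
    exact ⟨fun ⟨_, h, _⟩ => h, fun h =>
      ⟨⟨g n, Nat.lt_succ_of_le (Finset.card_filter_le _ _)⟩, h, rfl⟩⟩
  · rw [Finset.mem_filter] at hn hnD
    have heq : g n = g (n + D) := hn.2.trans hnD.2.symm
    rcases lt_or_ge (n : ℤ) k with hnk | hnk
    · exact (hglt n (n + D) k (Finset.mem_union_left _ hkbad) hnk (by push_cast; omega)).ne heq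
    · refine (hglt n (n + D) (k + w + 1) (Finset.mem_union_right _
        (Finset.mem_image_of_mem _ hkbad)) (by omega) (by push_cast; omega)).ne heq

namespace LaurentPolynomial

lemma coeff_mul_eq_sum_range {F Q : ℂ[T;T⁻¹]} {m : ℕ} (hneg : ∀ n < 0, Q.coeff n = 0)
    (hbig : ∀ n : ℤ, m < n → Q.coeff n = 0) (n : ℤ) :
    (F * Q).coeff n = ∑ j ∈ Finset.range (m + 1), F.coeff (n - j) * Q.coeff j := by
  rw [AddMonoidAlgebra.coeff_mul_apply_right,
    ← Finset.sum_image (g := ((↑) : ℕ → ℤ)) (f := fun k : ℤ => F.coeff (n - k) * Q.coeff k)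
      Nat.cast_injective.injOn]
  refine Finsupp.sum_of_support_subset _ (fun k hk => ?_) _ fun k _ => mul_zero _
  rw [Finsupp.mem_support_iff] at hk
  have h0 : 0 ≤ k := not_lt.1 fun h => hk (hneg k h)
  have h1 : k ≤ m := not_lt.1 fun h => hk (hbig k h)
  exact Finset.mem_image.2 ⟨k.toNat, Finset.mem_range.2 (by omega), by omega⟩

lemma evalCircle_toLaurent (θ : ℝ) (p : Polynomial ℂ) :
    evalCircle θ (Polynomial.toLaurent p) = p.eval (Complex.exp (θ * Complex.I)) := by
  have hT : ∀ n : ℕ, evalCircle θ (T n) = Complex.exp (θ * Complex.I) ^ n := fun n => by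
    rw [T, evalCircle_single, one_mul, ← Complex.exp_nat_mul]
    congr 1
    push_cast
    ring
  induction p using Polynomial.induction_on' with
  | add p q hp hq => rw [map_add, map_add, hp, hq, Polynomial.eval_add]
  | monomial n a =>
    rw [Polynomial.toLaurent_C_mul_T, map_mul, hT, Polynomial.eval_monomial,
      show (C a : ℂ[T;T⁻¹]) = AddMonoidAlgebra.single 0 a from rfl, evalCircle_single]
    simp

lemma finite_zeros_of_ne_zero {F : ℂ[T;T⁻¹]} (hF : F ≠ 0) :
    {θ ∈ Set.Icc 0 (2 * Real.pi) | evalCircle θ F = 0}.Finite := by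
  obtain ⟨n, p, hp⟩ := exists_T_pow F
  have hp0 : p ≠ 0 := by
    rintro rfl
    rw [map_zero] at hp
    exact hF ((isUnit_T (R := ℂ) n).mul_left_eq_zero.1 hp.symm)
  have hinj : Set.InjOn (fun θ : ℝ => Complex.exp (θ * Complex.I)) (Set.Ico 0 (2 * Real.pi)) :=
    fun a ha b hb hab => Circle.exp_injOn_Ico (by simp) ha hb (Subtype.ext (by simpa using hab))
  have hroots : (p.roots.toFinset : Set ℂ).Finite := Finset.finite_toSet _
  have hfin : {θ ∈ Set.Ico 0 (2 * Real.pi) | evalCircle θ F = 0}.Finite := by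
    refine Set.Finite.of_injOn (f := fun θ : ℝ => Complex.exp (θ * Complex.I)) (fun θ hθ => ?_)
      (hinj.mono fun θ hθ => hθ.1) hroots
    rw [Finset.mem_coe, Multiset.mem_toFinset, Polynomial.mem_roots hp0, Polynomial.IsRoot,
      ← evalCircle_toLaurent, hp, map_mul, hθ.2, zero_mul]
  refine (hfin.union (Set.finite_singleton (2 * Real.pi))).subset fun θ hθ => ?_
  rcases hθ.1.2.lt_or_eq with h | h
  · exact Or.inl ⟨⟨hθ.1.1, h⟩, hθ.2⟩
  · exact Or.inr h

/-- A Laurent polynomial that is real on the circle with few zeros becomes, after multiplication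
by a polynomial of small degree, a constant times a Laurent polynomial of constant sign. -/
lemma exists_mul_constant_sign {F : ℂ[T;T⁻¹]} {f : ℝ → ℝ} (hf : ∀ θ : ℝ, evalCircle θ F = f θ)
    {d : ℕ} (hfin : {θ ∈ Set.Icc 0 (2 * Real.pi) | f θ = 0}.Finite)
    (hcard : {θ ∈ Set.Icc 0 (2 * Real.pi) | f θ = 0}.ncard ≤ d) :
    ∃ (Q : ℂ[T;T⁻¹]) (κ σ : ℂ), Q.coeff 0 = 1 ∧ (∀ n < 0, Q.coeff n = 0) ∧
      (∀ n : ℤ, (2 * d : ℕ) < n → Q.coeff n = 0) ∧ wienerNorm Q ≤ 2 ^ (2 * d) ∧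
      ‖κ‖ = 1 ∧ ‖σ‖ = 1 ∧ ∀ θ ∈ Set.Ico 0 (2 * Real.pi),
        evalCircle θ (AddMonoidAlgebra.single (-(d : ℤ)) κ * (F * Q)) =
          σ * ‖evalCircle θ (AddMonoidAlgebra.single (-(d : ℤ)) κ * (F * Q))‖ := by
  have hfc : Continuous f := by
    have : f = fun θ => (evalCircle θ F).re := by
      funext θ
      rw [hf, Complex.ofReal_re]
    rw [this]
    exact Complex.continuous_re.comp (continuous_evalCircle F)
  obtain ⟨T, hTZ, σ, hσ, hT⟩ := exists_prod_sub_mul_nonneg hfc 0 hfin.toFinset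
    (fun z hz => ((Set.Finite.mem_toFinset _).1 hz).2) (2 * Real.pi)
    (fun x hx hx0 => (Set.Finite.mem_toFinset _).2 ⟨Set.Ico_subset_Icc_self hx, hx0⟩)
  have hTd : T.card ≤ d := by
    rw [Set.ncard_eq_toFinset_card _ hfin] at hcard
    exact (Finset.card_le_card hTZ).trans hcard
  set ts : Multiset ℝ := T.val + Multiset.replicate (2 * d - T.card) 0 with hts
  have htscard : ts.card = 2 * d := by
    rw [hts, Multiset.card_add, Multiset.card_replicate, Finset.card_val]
    omega
  obtain ⟨Q, γ, hγ, hQ0, hQneg, hQbig, hQw, hQ⟩ := exists_poly_eq_prod_sin ts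
  rw [htscard] at hQbig hQw
  have hγ' : (‖γ‖ : ℂ) ≠ 0 := by simpa using hγ
  have hsq : σ * σ = 1 := by
    rw [← abs_mul_abs_self, hσ, one_mul]
  refine ⟨Q, γ / ‖γ‖, σ, hQ0, hQneg, hQbig, hQw, ?_, ?_, fun θ hθ => ?_⟩
  · simp [hγ]
  · rwa [Complex.norm_real]
  · set r : ℝ := ‖γ‖⁻¹ * (f θ * (ts.map fun t => Real.sin ((θ - t) / 2)).prod) with hr
    have heval : evalCircle θ (AddMonoidAlgebra.single (-(d : ℤ)) (γ / ‖γ‖) * (F * Q)) = r := by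
      rw [map_mul, map_mul, evalCircle_single, hf, hr]
      push_cast [hQ θ, htscard]
      have : Complex.exp (-(2 * d * θ * Complex.I / 2)) = Complex.exp (-d * θ * Complex.I) := by
        congr 1
        ring
      rw [this]
      field_simp
    have hsub : ∀ t ∈ T, ∃ c, 0 ≤ c ∧ Real.sin ((θ - t) / 2) = c * (θ - t) := fun t ht => by
      have h := ((Set.Finite.mem_toFinset _).1 (hTZ ht)).1
      exact exists_sin_half_eq_mul (abs_le.2 ⟨by linarith [h.2, hθ.1], by linarith [h.1, hθ.2]⟩)
    choose! c hc0 hc using hsub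
    have hsin : 0 ≤ Real.sin (θ / 2) :=
      Real.sin_nonneg_of_nonneg_of_le_pi (by linarith [hθ.1]) (by linarith [hθ.2])
    have hprod : (ts.map fun t => Real.sin ((θ - t) / 2)).prod =
        (∏ t ∈ T, c t) * (∏ t ∈ T, (θ - t)) * Real.sin (θ / 2) ^ (2 * d - T.card) := by
      rw [hts, Multiset.map_add, Multiset.prod_add, Multiset.map_replicate,
        Multiset.prod_replicate, sub_zero, ← Finset.prod_mul_distrib, ← Finset.prod_congr rfl hc]
      rfl
    have hnonneg : 0 ≤ σ * r := by
      have h : σ * r = ‖γ‖⁻¹ * (∏ t ∈ T, c t) * Real.sin (θ / 2) ^ (2 * d - T.card) *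
          (σ * (f θ * ∏ t ∈ T, (θ - t))) := by
        rw [hr, hprod]
        ring
      rw [h]
      exact mul_nonneg (mul_nonneg (mul_nonneg (by positivity) (Finset.prod_nonneg hc0))
        (pow_nonneg hsin _)) (hT θ hθ)
    rw [heval, Complex.norm_real, Real.norm_eq_abs, ← Complex.ofReal_mul]
    congr 1
    have h : |r| = σ * r := by
      rw [← abs_of_nonneg hnonneg, abs_mul σ, hσ, one_mul]
    rw [h, ← mul_assoc, hsq, one_mul]

/-- If a Laurent polynomial with coefficients in a finite `1`-separated set is real on the circle
with few zeros there, then all but a bounded number of its coefficients are determined by the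
preceding ones. -/
lemma exists_bound_card_undetermined (U : Finset ℂ)
    (hU : ∀ u ∈ U, ∀ v ∈ U, ‖u - v‖ < 1 → u = v) (d : ℕ) :
    ∃ s : ℕ, ∀ F : ℂ[T;T⁻¹], (∀ k, F.coeff k ∈ U) → ∀ f : ℝ → ℝ,
      (∀ θ : ℝ, evalCircle θ F = f θ) →
      {θ ∈ Set.Icc 0 (2 * Real.pi) | f θ = 0}.Finite →
      {θ ∈ Set.Icc 0 (2 * Real.pi) | f θ = 0}.ncard ≤ d →
      ∃ bad : Finset ℤ, bad.card ≤ s ∧ ∀ n n', n ∉ bad → n' ∉ bad →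
        (∀ j : ℕ, 1 ≤ j → j ≤ 2 * d → F.coeff (n - j) = F.coeff (n' - j)) →
        F.coeff n = F.coeff n' := by
  classical
  set M : ℝ := 2 ^ (2 * d) * ∑ u ∈ U, ‖u‖ with hM
  have hM0 : 0 ≤ M := by positivity
  obtain ⟨s, hs⟩ := exists_bound_card_large_coeff_of_values hM0 hM0 (U.card ^ (2 * d + 1))
    (δ₀ := 1 / 4) (by norm_num)
  refine ⟨s, fun F hFU f hf hfin hcard => ?_⟩
  obtain ⟨Q, κ, σ, hQ0, hQneg, hQbig, hQw, hκ, hσ, hG⟩ := exists_mul_constant_sign hf hfin hcard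
  set G := AddMonoidAlgebra.single (-(d : ℤ)) κ * (F * Q) with hGdef
  have hGcoeff : ∀ n, ‖G.coeff n‖ = ‖(F * Q).coeff (n + d)‖ := fun n => by
    rw [hGdef, AddMonoidAlgebra.coeff_single_mul_apply, norm_mul, hκ, one_mul, neg_neg, add_comm]
  have hGM : ∀ n, ‖G.coeff n‖ ≤ M := fun n => by
    rw [hGcoeff, mul_comm F Q]
    refine (norm_coeff_mul_le Q F (fun k => Finset.single_le_sum (f := fun u : ℂ => ‖u‖)
      (fun _ _ => norm_nonneg _) (hFU k)) _).trans ?_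
    exact mul_le_mul_of_nonneg_right hQw (by positivity)
  have hFQ := coeff_mul_eq_sum_range (F := F) hQneg hQbig
  obtain ⟨δ, hδ, hδ', hcardG⟩ := hs G hGM
    (fun φ S hφ => (norm_sum_coeff_mul_conj_le hσ hG φ S hφ).trans
      (mul_le_mul_of_nonneg_right (hGM 0) ((norm_nonneg _).trans (hφ 0))))
    ((Fintype.piFinset fun _ : Fin (2 * d + 1) => U).image fun v =>
      ‖∑ j : Fin (2 * d + 1), v j * Q.coeff (j : ℕ)‖)
    (Finset.card_image_le.trans (by simp))
    (fun n _ => by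
      refine Finset.mem_image.2 ⟨fun j => F.coeff (n + d - (j : ℕ)),
        Fintype.mem_piFinset.2 fun j => hFU _, ?_⟩
      rw [hGcoeff, hFQ, Finset.sum_range])
  refine ⟨(G.coeff.support.filter fun n => δ ≤ ‖G.coeff n‖).image (· + (d : ℤ)),
    Finset.card_image_le.trans hcardG, fun n n' hn hn' hnn' => hU _ (hFU n) _ (hFU n') ?_⟩
  have hsmall : ∀ n, n ∉ (G.coeff.support.filter fun n => δ ≤ ‖G.coeff n‖).image (· + (d : ℤ)) →
      ‖(F * Q).coeff n‖ < 1 / 4 := by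
    intro n hn
    by_contra! hcon
    have h := hGcoeff (n - d)
    rw [sub_add_cancel] at h
    rw [← h] at hcon
    refine hn (Finset.mem_image.2 ⟨n - d, Finset.mem_filter.2 ⟨?_, hδ'.trans hcon⟩, by ring⟩)
    rw [Finsupp.mem_support_iff, ← norm_pos_iff]
    linarith
  have hdiff : F.coeff n - F.coeff n' = (F * Q).coeff n - (F * Q).coeff n' := by
    rw [hFQ, hFQ, Finset.sum_range_succ', Finset.sum_range_succ', Finset.sum_congr rfl
      fun j hj => by rw [hnn' (j + 1) (by omega) (by rw [Finset.mem_range] at hj; omega)]]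
    simp [hQ0]
  rw [hdiff]
  have := hsmall n hn
  have := hsmall n' hn'
  have := norm_sub_le ((F * Q).coeff n) ((F * Q).coeff n')
  linarith

end LaurentPolynomial

namespace LaurentPolynomial

/-- The coefficient of `exp (i k θ)` in `2 * (∑ A n cos (n θ) + ∑ B n sin (n θ))`. -/
noncomputable def trigCoeff (A B : ℕ → ℤ) (k : ℤ) : ℂ :=
  (((if k = 0 then 2 else 1) * A k.natAbs : ℤ) : ℂ) +
    ((-k.sign * B k.natAbs : ℤ) : ℂ) * Complex.I

/-- The Laurent polynomial of `2 * (∑ A n cos (n θ) + ∑ B n sin (n θ))`. -/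
noncomputable def trigPoly (N : ℕ) (A B : ℕ → ℤ) : ℂ[T;T⁻¹] :=
  ∑ k ∈ Finset.Icc (-(N : ℤ)) N, AddMonoidAlgebra.single k (trigCoeff A B k)

lemma coeff_trigPoly (N : ℕ) (A B : ℕ → ℤ) (k : ℤ) :
    (trigPoly N A B).coeff k =
      if k ∈ Finset.Icc (-(N : ℤ)) N then trigCoeff A B k else 0 := by
  rw [trigPoly, AddMonoidAlgebra.coeff_sum, Finsupp.finsetSum_apply]
  simp only [AddMonoidAlgebra.coeff_single, Finsupp.single_apply, Finset.sum_ite_eq']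

lemma sum_Icc_neg_eq {M : Type*} [AddCommMonoid M] (h : ℤ → M) (N : ℕ) :
    ∑ k ∈ Finset.Icc (-(N : ℤ)) N, h k = h 0 + ∑ n ∈ Finset.Icc 1 N, (h n + h (-(n : ℤ))) := by
  induction N with
  | zero => simp
  | succ N ih =>
    have hIcc : Finset.Icc (-((N + 1 : ℕ) : ℤ)) (N + 1 : ℕ) =
        insert ((N + 1 : ℕ) : ℤ) (insert (-((N + 1 : ℕ) : ℤ)) (Finset.Icc (-(N : ℤ)) N)) := by
      ext k
      simp only [Finset.mem_insert, Finset.mem_Icc]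
      omega
    rw [hIcc, Finset.sum_insert, Finset.sum_insert, ih, Finset.sum_Icc_succ_top (by omega)]
    · abel
    · simp only [Finset.mem_Icc]
      omega
    · simp only [Finset.mem_insert, Finset.mem_Icc]
      omega

lemma evalCircle_trigPoly (N : ℕ) (A B : ℕ → ℤ) (θ : ℝ) :
    evalCircle θ (trigPoly N A B) =
      ((2 * ((∑ n ∈ Finset.range (N + 1), (A n : ℝ) * Real.cos (n * θ)) +
        ∑ n ∈ Finset.Icc 1 N, (B n : ℝ) * Real.sin (n * θ)) : ℝ) : ℂ) := by
  have hrange : ∑ n ∈ Finset.range (N + 1), (A n : ℝ) * Real.cos (n * θ) =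
      A 0 + ∑ n ∈ Finset.Icc 1 N, (A n : ℝ) * Real.cos (n * θ) := by
    have h : Finset.range (N + 1) = insert 0 (Finset.Icc 1 N) := by
      ext n
      simp only [Finset.mem_range, Finset.mem_insert, Finset.mem_Icc]
      omega
    rw [h, Finset.sum_insert (by simp)]
    simp
  rw [hrange, add_assoc, ← Finset.sum_add_distrib, mul_add, Finset.mul_sum, trigPoly, map_sum]
  simp only [evalCircle_single]
  rw [sum_Icc_neg_eq, Complex.ofReal_add, Complex.ofReal_sum]
  congr 1
  · simp [trigCoeff]
  · refine Finset.sum_congr rfl fun n hn => ?_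
    have hn1 : 1 ≤ n := (Finset.mem_Icc.1 hn).1
    have h0 : (n : ℤ) ≠ 0 := by omega
    have hs : (n : ℤ).sign = 1 := Int.sign_eq_one_of_pos (by omega)
    simp only [trigCoeff, h0, neg_eq_zero, if_false, Int.sign_neg, hs, Int.natAbs_neg,
      Int.natAbs_natCast]
    push_cast
    rw [Complex.cos, Complex.sin]
    ring_nf

/-- The Gaussian integers with coordinates bounded by `K`. -/
noncomputable def gaussianBox (K : ℤ) : Finset ℂ :=
  (Finset.Icc (-K) K ×ˢ Finset.Icc (-K) K).image fun p => (p.1 : ℂ) + (p.2 : ℂ) * Complex.I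

lemma eq_of_mem_gaussianBox {K : ℤ} {u v : ℂ} (hu : u ∈ gaussianBox K) (hv : v ∈ gaussianBox K)
    (huv : ‖u - v‖ < 1) : u = v := by
  obtain ⟨⟨a, b⟩, -, rfl⟩ := Finset.mem_image.1 hu
  obtain ⟨⟨a', b'⟩, -, rfl⟩ := Finset.mem_image.1 hv
  have hre := (Complex.abs_re_le_norm _).trans_lt huv
  have him := (Complex.abs_im_le_norm _).trans_lt huv
  simp at hre him
  have ha : |a - a'| < 1 := by exact_mod_cast hre
  have hb : |b - b'| < 1 := by exact_mod_cast him
  rw [Int.abs_lt_one_iff, sub_eq_zero] at ha hb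
  simp [ha, hb]

lemma coeff_trigPoly_mem_gaussianBox {N : ℕ} {A B : ℕ → ℤ} {K : ℤ} (hA : ∀ n ≤ N, |A n| ≤ K)
    (hB : ∀ n, 1 ≤ n → n ≤ N → |B n| ≤ K) (k : ℤ) :
    (trigPoly N A B).coeff k ∈ gaussianBox (2 * K) := by
  have hK : 0 ≤ K := (abs_nonneg _).trans (hA 0 (Nat.zero_le _))
  rw [coeff_trigPoly]
  split_ifs with hk
  · rw [Finset.mem_Icc] at hk
    refine Finset.mem_image.2 ⟨(_, _), Finset.mem_product.2 ⟨?_, ?_⟩, rfl⟩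
    · have h := abs_le.1 (hA k.natAbs (by omega))
      simp only [Finset.mem_Icc]
      split_ifs <;> constructor <;> linarith
    · simp only [Finset.mem_Icc]
      rcases eq_or_ne k 0 with rfl | h0
      · simp [hK]
      · have h := abs_le.1 (hB k.natAbs (by omega) (by omega))
        rcases h0.lt_or_gt with h0 | h0
        · rw [Int.sign_eq_neg_one_of_neg h0]
          constructor <;> linarith
        · rw [Int.sign_eq_one_of_pos h0]
          constructor <;> linarith
  · exact Finset.mem_image.2 ⟨(0, 0), by simp [hK], by simp⟩

lemma eq_of_coeff_trigPoly_eq {N : ℕ} {A B : ℕ → ℤ} {n m : ℕ} (hn : n ∈ Finset.Icc 1 N)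
    (hm : m ∈ Finset.Icc 1 N) (h : (trigPoly N A B).coeff n = (trigPoly N A B).coeff m) :
    A n = A m ∧ B n = B m := by
  have key : ∀ l ∈ Finset.Icc 1 N, (trigPoly N A B).coeff (l : ℤ) = (A l : ℂ) - B l * Complex.I := by
    intro l hl
    rw [Finset.mem_Icc] at hl
    rw [coeff_trigPoly, if_pos (Finset.mem_Icc.2 ⟨by omega, by omega⟩), trigCoeff,
      if_neg (by omega), Int.sign_eq_one_of_pos (by omega), Int.natAbs_natCast]
    push_cast
    ring
  rw [key n hn, key m hm] at h
  have hre := congrArg Complex.re h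
  have him := congrArg Complex.im h
  simp at hre him
  exact ⟨hre, him⟩

end LaurentPolynomial

/-- Sahasrabudhe; structure of trigonometric polynomials with few zeros.
For finite `R ⊂ ℤ` and `d ∈ ℕ` there is `D = D(R, d)` such that: if the trigonometric
polynomial `f(θ) = Σ_{n=0}^N A_n cos(nθ) + Σ_{n=1}^N B_n sin(nθ)` with coefficients in `R`
has at most `d` distinct zeros in `[0, 2π]`, then there exist `L < D` and pairwise
disjoint integer intervals `I_1, …, I_L` with union `{1, …, N}` on each of which the
coefficient sequences `(A_n)` and `(B_n)` are periodic with period `D`. -/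
theorem stmt3 (R : Finset ℤ) (d : ℕ) :
    ∃ D : ℕ, 0 < D ∧
      ∀ (N : ℕ) (A B : ℕ → ℤ),
        (∀ n ≤ N, A n ∈ R) →
        (∀ n, 1 ≤ n → n ≤ N → B n ∈ R) →
        Set.ncard {θ : ℝ | θ ∈ Set.Icc 0 (2 * Real.pi) ∧
            (∑ n ∈ Finset.range (N + 1), (A n : ℝ) * Real.cos (n * θ)) +
              (∑ n ∈ Finset.Icc 1 N, (B n : ℝ) * Real.sin (n * θ)) = 0} ≤ d →
        ∃ L : ℕ, L < D ∧
          ∃ I : Fin L → Finset ℕ,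
            (∀ j, ∃ a b : ℕ, I j = Finset.Icc a b) ∧
            (∀ j k, j ≠ k → Disjoint (I j) (I k)) ∧
            (Finset.univ.biUnion I = Finset.Icc 1 N) ∧
            (∀ j, ∀ n ∈ I j, n + D ∈ I j → A n = A (n + D) ∧ B n = B (n + D)) := by
  set K : ℤ := ∑ r ∈ R, |r| with hK
  have hRK : ∀ r ∈ R, |r| ≤ K := fun r hr =>
    Finset.single_le_sum (f := fun r : ℤ => |r|) (fun _ _ => abs_nonneg _) hr
  set U := LaurentPolynomial.gaussianBox (2 * K) with hU
  obtain ⟨s, hs⟩ := LaurentPolynomial.exists_bound_card_undetermined U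
    (fun u hu v hv => LaurentPolynomial.eq_of_mem_gaussianBox hu hv) d
  set w := U.card ^ (2 * d) with hw
  have hwpos : 0 < w.factorial := Nat.factorial_pos w
  have hwle : w ≤ w.factorial := Nat.self_le_factorial w
  set D := (2 * s + 2) * w.factorial with hD
  have hwD : w < D := by nlinarith
  have hsD : 2 * s + 1 < D := by nlinarith
  refine ⟨D, by omega, fun N A B hA hB hzero => ?_⟩
  set F := LaurentPolynomial.trigPoly N A B with hF
  have hFU : ∀ k, F.coeff k ∈ U := LaurentPolynomial.coeff_trigPoly_mem_gaussianBox
    (fun n hn => hRK _ (hA n hn)) fun n h1 hn => hRK _ (hB n h1 hn)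
  obtain ⟨bad, hbad, hdet⟩ : ∃ bad : Finset ℤ, bad.card ≤ s ∧ ∀ n n', n ∉ bad → n' ∉ bad →
      (∀ j : ℕ, 1 ≤ j → j ≤ 2 * d → F.coeff (n - j) = F.coeff (n' - j)) →
      F.coeff n = F.coeff n' := by
    by_cases hF0 : F = 0
    · exact ⟨∅, by simp, fun n n' _ _ _ => by simp [hF0]⟩
    · have heval := LaurentPolynomial.evalCircle_trigPoly N A B
      refine hs F hFU _ heval ?_ ?_
      · refine (LaurentPolynomial.finite_zeros_of_ne_zero hF0).subset fun θ hθ => ⟨hθ.1, ?_⟩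
        rw [heval, hθ.2, Complex.ofReal_zero]
      · simpa only [mul_eq_zero, two_ne_zero, false_or] using hzero
  obtain ⟨L, hL, I, hIcc, hdisj, hunion, havoid⟩ := exists_partition_Icc_avoiding bad N hwD
  have hIN : ∀ j, ∀ n ∈ I j, n ∈ Finset.Icc 1 N := fun j n hn => by
    rw [← hunion]
    exact Finset.mem_biUnion.2 ⟨j, Finset.mem_univ j, hn⟩
  refine ⟨L, by omega, I, hIcc, hdisj, hunion, fun j n hn hnD => ?_⟩
  refine LaurentPolynomial.eq_of_coeff_trigPoly_eq (hIN j n hn) (hIN j _ hnD) ?_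
  push_cast
  exact eq_add_of_determined hFU hdet (Dvd.intro_left _ rfl) (havoid j n hn hnD)
end

section
/- Let d ∈ ℕ and let R ⊂ ℤ be finite. Then there exists a constant D depending only on R and d such that the following holds. Let 𝒩 ⊂ ℕ be an infinite set and suppose {Q_N : N ∈ 𝒩} is a collection of polynomials with coefficients in R, with deg Q_N = N, such that θ ↦ Re(Q_N(e^{iθ})) has at most d distinct zeros in [0, 2π] for each N ∈ 𝒩. Then there exist an infinite subset 𝒩' ⊂ 𝒩, constants l ≤ D and real numbers 0 = ρ_0 < ρ_1 < ⋯ < ρ_l = 1, and for each j ∈ {1, …, l} a sequence (ε^{(j)}_m)_{m=1}^D ∈ R^D, such that for every N ∈ 𝒩' one can write Q_N(z) = Σ_{j=1}^l ( Σ_{n ∈ (ρ_{j−1}N, ρ_j N)} ε^{(j)}_{n mod D} z^n ) + E_N(z), where each E_N is a polynomial whose coefficients have absolute value at most 2·max_{r∈R}|r| and whose number of nonzero coefficients, as a function of N ∈ 𝒩', is o(N) as N → ∞ along 𝒩'. -/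
theorem exists_separated_subset (R r : ℕ) (m : ℕ) :
    ∃ M : ℕ, ∀ A Q : Finset ℤ, Q.card ≤ r →
      (∀ q ∈ Q, (A.filter (q < ·)).card ≤ R) → M ≤ A.card →
      ∃ S ⊆ A, S.card = m ∧ (∀ a ∈ S, (A.filter (a < ·)).card ≤ M) ∧
        ∀ a ∈ S, ∀ b ∈ S, b < a → ∀ q ∈ Q, q + (a - b) ∉ A := by
  induction m with
  | zero => exact ⟨0, fun A Q _ _ _ => ⟨∅, by simp, by simp, by simp, by simp⟩⟩
  | succ m ih =>
    obtain ⟨M, hM⟩ := ih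
    refine ⟨m * (M + 1) + m * (r * R) + M + 1, fun A Q hQ hR hA => ?_⟩
    obtain ⟨S, hSA, hSm, hSM, hSep⟩ := hM A Q hQ hR (by omega)
    set G : Finset ℤ :=
      A.filter fun b => (∀ a ∈ S, b < a) ∧ ∀ a ∈ S, ∀ q ∈ Q, q + (a - b) ∉ A with hG
    have hsub : A \ G ⊆ (S.biUnion fun a => insert a (A.filter (a < ·))) ∪
        S.biUnion fun a => Q.biUnion fun q =>
          (A.filter (q < ·)).image fun x => q + a - x := by
      intro b hb
      simp only [hG, Finset.mem_sdiff, Finset.mem_filter, not_and, not_forall] at hb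
      obtain ⟨hbA, hb⟩ := hb
      by_cases h : ∀ a ∈ S, b < a
      · obtain ⟨a, ha, q, hq, hmem⟩ := hb hbA h
        rw [not_not] at hmem
        have := h a ha
        simp only [Finset.mem_union, Finset.mem_biUnion, Finset.mem_image, Finset.mem_filter]
        exact Or.inr ⟨a, ha, q, hq, q + (a - b), ⟨hmem, by omega⟩, by ring⟩
      · push Not at h
        obtain ⟨a, ha, hab⟩ := h
        simp only [Finset.mem_union, Finset.mem_biUnion, Finset.mem_insert, Finset.mem_filter]
        refine Or.inl ⟨a, ha, ?_⟩
        rcases hab.eq_or_lt with h | h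
        · exact Or.inl h.symm
        · exact Or.inr ⟨hbA, h⟩
    have hcard : (A \ G).card ≤ m * (M + 1) + m * (r * R) := by
      refine (Finset.card_le_card hsub).trans ((Finset.card_union_le _ _).trans ?_)
      refine add_le_add ?_ ?_
      · rw [← hSm]
        refine Finset.card_biUnion_le_card_mul _ _ _ fun a ha => ?_
        exact (Finset.card_insert_le _ _).trans (Nat.succ_le_succ (hSM a ha))
      · rw [← hSm]
        refine Finset.card_biUnion_le_card_mul _ _ _ fun a ha => ?_
        refine (Finset.card_biUnion_le_card_mul _ _ R fun q hq => ?_).trans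
          (Nat.mul_le_mul_right _ hQ)
        exact Finset.card_image_le.trans (hR q hq)
    have hGA : G ⊆ A := Finset.filter_subset _ _
    have hne : G.Nonempty := by
      rw [← Finset.card_pos]
      have := Finset.card_sdiff_add_card_eq_card hGA
      omega
    obtain ⟨b, hbG, hbmax⟩ : ∃ b ∈ G, ∀ x ∈ G, x ≤ b :=
      ⟨G.max' hne, G.max'_mem hne, fun x hx => G.le_max' x hx⟩
    have hb := (Finset.mem_filter.1 hbG).2
    have hbS : b ∉ S := fun h => lt_irrefl _ (hb.1 b h)
    refine ⟨insert b S, Finset.insert_subset (hGA hbG) hSA, ?_, ?_, ?_⟩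
    · rw [Finset.card_insert_of_notMem hbS, hSm]
    · intro a ha
      rcases Finset.mem_insert.1 ha with rfl | ha
      · have : A.filter (a < ·) ⊆ A \ G := by
          intro x hx
          rw [Finset.mem_filter] at hx
          exact Finset.mem_sdiff.2 ⟨hx.1, fun h => absurd (hbmax x h) (not_le.2 hx.2)⟩
        have := Finset.card_le_card this
        omega
      · have := hSM a ha
        omega
    · intro a ha a' ha' hlt q hq
      rcases Finset.mem_insert.1 ha with h | h <;> rcases Finset.mem_insert.1 ha' with h' | h'
      · omega
      · exact absurd (hb.1 a' h') (by omega)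
      · exact h' ▸ hb.2 a h q hq
      · exact hSep a h a' h' hlt q hq
open ComplexConjugate

/-- The pairs of elements of `S` in decreasing order. -/
def descPairs (S : Finset ℤ) : Finset (ℤ × ℤ) := (S ×ˢ S).filter fun p => p.2 < p.1

theorem sum_descPairs_re (S : Finset ℤ) (e : ℤ → ℂ) (he : ∀ a, ‖e a‖ = 1) :
    ‖∑ a ∈ S, e a‖ ^ 2 = S.card + 2 * (∑ p ∈ descPairs S, e p.1 * conj (e p.2)).re := by
  induction S using Finset.induction_on_max with
  | empty => simp [descPairs]
  | insert a S ha ih =>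
    have haS : a ∉ S := fun h => lt_irrefl _ (ha a h)
    have hpairs : descPairs (insert a S) =
        descPairs S ∪ S.image (fun b => (a, b)) := by
      ext ⟨x, y⟩
      simp only [descPairs, Finset.mem_filter, Finset.mem_product, Finset.mem_insert,
        Finset.mem_union, Finset.mem_image, Prod.mk.injEq]
      constructor
      · rintro ⟨⟨rfl | hx, rfl | hy⟩, h⟩
        · exact absurd h (lt_irrefl _)
        · exact Or.inr ⟨y, hy, rfl, rfl⟩
        · exact absurd (ha x hx) (not_lt.2 h.le)
        · exact Or.inl ⟨⟨hx, hy⟩, h⟩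
      · rintro (⟨⟨hx, hy⟩, h⟩ | ⟨b, hb, rfl, rfl⟩)
        · exact ⟨⟨Or.inr hx, Or.inr hy⟩, h⟩
        · exact ⟨⟨Or.inl rfl, Or.inr hb⟩, ha _ hb⟩
    have hdisj : Disjoint (descPairs S) (S.image (fun b => (a, b))) := by
      rw [Finset.disjoint_left]
      rintro ⟨x, y⟩ hx hy
      simp only [descPairs, Finset.mem_filter, Finset.mem_product, Finset.mem_image,
        Prod.mk.injEq] at hx hy
      obtain ⟨b, _, rfl, rfl⟩ := hy
      exact haS hx.1.1
    rw [hpairs, Finset.sum_union hdisj, Finset.sum_image (by simp), Finset.sum_insert haS,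
      Finset.card_insert_of_notMem haS, Complex.add_re]
    have h1 := Complex.normSq_add (e a) (∑ x ∈ S, e x)
    simp only [Complex.normSq_eq_norm_sq, map_sum, Finset.mul_sum] at h1 ⊢
    rw [h1, he, ih]
    push_cast
    ring

theorem card_descPairs (S : Finset ℤ) : 2 * (descPairs S).card + S.card = S.card ^ 2 := by
  have h := sum_descPairs_re S (fun _ => 1) (by simp)
  simp only [Finset.sum_const, nsmul_eq_mul, mul_one, map_one, Complex.norm_natCast,
    Complex.natCast_re] at h
  have : ((S.card ^ 2 : ℕ) : ℝ) = ((2 * (descPairs S).card + S.card : ℕ) : ℝ) := by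
    push_cast
    linarith
  exact_mod_cast this.symm

theorem norm_damped_add_le {S : Finset ℤ} {m : ℕ} (hm : 0 < m) (hS : S.card = m) (e : ℤ → ℂ)
    (he : ∀ a, ‖e a‖ = 1) {ε t B : ℝ} (hε : 0 < ε) (hε1 : ε ≤ 1) (ht : 0 ≤ t) (hB : 1 ≤ B)
    {z : ℂ} (hz : ‖z‖ ≤ B) :
    ‖z - ε * (1 / m * z + 2 / m ^ 2 * ∑ p ∈ descPairs S, z * (e p.1 * conj (e p.2)))
      + t * (1 / m * ∑ a ∈ S, e a)‖ ≤ B * (1 + ε ^ 2 / 2 + t ^ 2 / (4 * ε)) := by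
  have hm' : (0 : ℝ) < m := by exact_mod_cast hm
  set P := ∑ p ∈ descPairs S, e p.1 * conj (e p.2) with hP
  set w : ℂ := 1 / m + 2 / m ^ 2 * P with hw
  set s : ℂ := 1 / m * ∑ a ∈ S, e a with hs
  have hwc : w = ((1 / m : ℝ) : ℂ) + ((2 / m ^ 2 : ℝ) : ℂ) * P := by rw [hw]; push_cast; ring
  have hre : w.re = ‖s‖ ^ 2 := by
    have h := sum_descPairs_re S e he
    rw [hS] at h
    rw [hwc, Complex.add_re, Complex.re_ofReal_mul, Complex.ofReal_re, hs, norm_mul, mul_pow, h]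
    simp only [norm_div, norm_one, Complex.norm_natCast]
    field_simp
    rw [hP]
  have hPn : ‖P‖ ≤ (descPairs S).card := by
    refine (norm_sum_le _ _).trans (le_of_eq ?_)
    simp [he]
  have hcard : 2 * ((descPairs S).card : ℝ) + m = m ^ 2 := by
    have := card_descPairs S
    rw [hS] at this
    exact_mod_cast this
  have hwn : ‖w‖ ≤ 1 := by
    have h1 : ‖w‖ ≤ 1 / m + 2 / m ^ 2 * ‖P‖ := by
      rw [hwc]
      refine (norm_add_le _ _).trans (le_of_eq ?_)
      rw [norm_mul, Complex.norm_real, Complex.norm_real, Real.norm_of_nonneg (by positivity),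
        Real.norm_of_nonneg (by positivity)]
    have h2 : 2 / (m : ℝ) ^ 2 * ‖P‖ ≤ 2 / m ^ 2 * (descPairs S).card := by gcongr
    have h3 : 1 / (m : ℝ) + 2 / m ^ 2 * (descPairs S).card = 1 := by
      field_simp
      linarith
    linarith
  have hs1 : ‖s‖ ^ 2 ≤ 1 := by
    rw [← hre]
    exact (Complex.re_le_norm w).trans hwn
  have hdamp : ‖1 - (ε : ℂ) * w‖ ≤ 1 - ε * ‖s‖ ^ 2 + ε ^ 2 / 2 := by
    refine abs_le_of_sq_le_sq' ?_ (by nlinarith [sq_nonneg ‖s‖]) |>.2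
    have h := Complex.normSq_sub 1 ((ε : ℂ) * w)
    simp only [Complex.normSq_eq_norm_sq] at h
    rw [h, norm_one, norm_mul, Complex.norm_real, Real.norm_of_nonneg hε.le]
    simp only [one_mul, map_mul, Complex.conj_ofReal, Complex.re_ofReal_mul, Complex.conj_re, hre]
    have : ‖w‖ ^ 2 ≤ 1 := by nlinarith [norm_nonneg w]
    nlinarith [sq_nonneg (ε * ‖s‖ ^ 2 - ε ^ 2 / 2), sq_nonneg ε,
      mul_le_mul_of_nonneg_left this (sq_nonneg ε)]
  have hzw : z - ε * (1 / m * z + 2 / m ^ 2 * ∑ p ∈ descPairs S, z * (e p.1 * conj (e p.2)))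
      + t * s = z * (1 - ε * w) + t * s := by
    rw [← Finset.mul_sum, ← hP, hw]
    ring
  rw [hzw]
  have hts : t * ‖s‖ ≤ ε * ‖s‖ ^ 2 + t ^ 2 / (4 * ε) := by
    have : ε * ‖s‖ ^ 2 + t ^ 2 / (4 * ε) - t * ‖s‖ = (2 * ε * ‖s‖ - t) ^ 2 / (4 * ε) := by
      field_simp
      ring
    have h0 : 0 ≤ (2 * ε * ‖s‖ - t) ^ 2 / (4 * ε) := by positivity
    linarith
  have hεs : 0 ≤ ε * ‖s‖ ^ 2 := by positivity
  have hq : 0 ≤ t ^ 2 / (4 * ε) := by positivity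
  calc ‖z * (1 - ε * w) + t * s‖ ≤ ‖z‖ * ‖1 - ε * w‖ + t * ‖s‖ := by
        refine (norm_add_le _ _).trans (le_of_eq ?_)
        rw [norm_mul, norm_mul, Complex.norm_real, Real.norm_of_nonneg ht]
    _ ≤ B * (1 - ε * ‖s‖ ^ 2 + ε ^ 2 / 2) + (ε * ‖s‖ ^ 2 + t ^ 2 / (4 * ε)) := by gcongr
    _ ≤ B * (1 + ε ^ 2 / 2 + t ^ 2 / (4 * ε)) := by nlinarith

section Damping

variable {T : ℝ}

theorem norm_fourier_apply (n : ℤ) (x : AddCircle T) : ‖fourier n x‖ = 1 := by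
  rw [fourier_apply, Circle.norm_coe]

/-- `φ` behaves under `ℓ` like a trigonometric polynomial with frequencies in `Q` and coefficients
of total mass at most `L`. -/
def FrequencyControlled (ℓ : C(AddCircle T, ℂ) →ₗ[ℂ] ℂ) (φ : C(AddCircle T, ℂ)) (L : ℝ)
    (Q : Finset ℤ) : Prop :=
  ∀ (k : ℤ) (B : ℝ), 0 ≤ B → (∀ q ∈ Q, ‖ℓ (fourier (q + k))‖ ≤ B) → ‖ℓ (φ * fourier k)‖ ≤ L * B

/-- The product of `φ` with a damping factor built from the frequency differences of `S`, plus a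
multiple of the average of the rotated exponentials with frequencies in `S`. -/
noncomputable def damp (φ : C(AddCircle T, ℂ)) (S : Finset ℤ) (σ : ℤ → ℂ) (m : ℕ) (ε t : ℝ) :
    C(AddCircle T, ℂ) :=
  φ - (ε : ℂ) • ((1 / m : ℂ) • φ + (2 / m ^ 2 : ℂ) •
      ∑ p ∈ descPairs S, (σ p.1 * conj (σ p.2)) • (φ * fourier (p.1 - p.2)))
    + (t : ℂ) • ((1 / m : ℂ) • ∑ a ∈ S, σ a • fourier a)

theorem norm_damp_apply_le {φ : C(AddCircle T, ℂ)} {S : Finset ℤ} {σ : ℤ → ℂ} {m : ℕ}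
    (hm : 0 < m) (hS : S.card = m) (hσ : ∀ a, ‖σ a‖ = 1) {ε t B : ℝ} (hε : 0 < ε) (hε1 : ε ≤ 1)
    (ht : 0 ≤ t) (hB : 1 ≤ B) (hφ : ∀ x, ‖φ x‖ ≤ B) (x : AddCircle T) :
    ‖damp φ S σ m ε t x‖ ≤ B * (1 + ε ^ 2 / 2 + t ^ 2 / (4 * ε)) := by
  have h := norm_damped_add_le hm hS (fun a => σ a * fourier a x)
    (fun a => by rw [norm_mul, hσ, norm_fourier_apply, one_mul]) hε hε1 ht hB (hφ x)
  convert h using 2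
  have hf : ∀ i j : ℤ, fourier (i - j) x = fourier i x * conj (fourier j x) := fun i j => by
    rw [sub_eq_add_neg, fourier_add, fourier_neg]
  simp only [damp, ContinuousMap.add_apply, ContinuousMap.sub_apply, ContinuousMap.smul_apply,
    ContinuousMap.sum_apply, ContinuousMap.mul_apply, smul_eq_mul, map_mul, hf]
  congr 5
  refine Finset.sum_congr rfl fun p _ => ?_
  ring

theorem map_damp_mul (ℓ : C(AddCircle T, ℂ) →ₗ[ℂ] ℂ) (φ : C(AddCircle T, ℂ)) (S : Finset ℤ)
    (σ : ℤ → ℂ) (m : ℕ) (ε t : ℝ) (k : ℤ) :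
    ℓ (damp φ S σ m ε t * fourier k) = ℓ (φ * fourier k) - ε * (1 / m * ℓ (φ * fourier k) +
      2 / m ^ 2 * ∑ p ∈ descPairs S, σ p.1 * conj (σ p.2) * ℓ (φ * fourier (p.1 - p.2 + k)))
      + t * (1 / m * ∑ a ∈ S, σ a * ℓ (fourier (a + k))) := by
  have hf : ∀ i j : ℤ, (fourier (i + j) : C(AddCircle T, ℂ)) = fourier i * fourier j := by
    intro i j
    ext x
    exact fourier_add
  simp only [damp, add_mul, sub_mul, smul_mul_assoc, Finset.sum_mul, map_add, map_sub, map_smul,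
    map_sum, smul_eq_mul, hf, mul_assoc]

theorem FrequencyControlled.damp {ℓ : C(AddCircle T, ℂ) →ₗ[ℂ] ℂ} {φ : C(AddCircle T, ℂ)}
    {S Q : Finset ℤ} {σ : ℤ → ℂ} {m : ℕ} (hm : 0 < m) (hS : S.card = m) (hσ : ∀ a, ‖σ a‖ = 1)
    {ε t L : ℝ} (hε : 0 ≤ ε) (hε1 : ε ≤ 1) (ht : 0 ≤ t) (ht1 : t ≤ 1) (hL : 0 ≤ L)
    (hφ : FrequencyControlled ℓ φ L Q) :
    FrequencyControlled ℓ (damp φ S σ m ε t) (2 * L + 1)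
      (Q ∪ Finset.image₂ (fun q p => q + (p.1 - p.2)) Q (descPairs S) ∪ S) := by
  intro k B hB h
  have hm' : (0 : ℝ) < m := by exact_mod_cast hm
  have h0 : ‖ℓ (φ * fourier k)‖ ≤ L * B := hφ k B hB fun q hq => h q (by simp [hq])
  have hp : ∀ p ∈ descPairs S, ‖σ p.1 * conj (σ p.2) * ℓ (φ * fourier (p.1 - p.2 + k))‖
      ≤ L * B := by
    intro p hp
    rw [norm_mul, norm_mul, RCLike.norm_conj, hσ, hσ, one_mul, one_mul]
    refine hφ _ B hB fun q hq => ?_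
    rw [← add_assoc]
    refine h _ ?_
    rw [Finset.mem_union, Finset.mem_union]
    exact Or.inl (Or.inr (Finset.mem_image₂_of_mem hq hp))
  have hs : ∀ a ∈ S, ‖σ a * ℓ (fourier (a + k))‖ ≤ B := by
    intro a ha
    rw [norm_mul, hσ, one_mul]
    exact h a (by simp [ha])
  have hcard : 2 * ((descPairs S).card : ℝ) + m = m ^ 2 := by
    have := card_descPairs S
    rw [hS] at this
    exact_mod_cast this
  have hpairs := norm_sum_le_of_le _ hp
  have hsum := norm_sum_le_of_le _ hs
  rw [Finset.sum_const, nsmul_eq_mul] at hpairs hsum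
  rw [hS] at hsum
  rw [map_damp_mul]
  set X := ℓ (φ * fourier k)
  set Y := ∑ p ∈ descPairs S, σ p.1 * conj (σ p.2) * ℓ (φ * fourier (p.1 - p.2 + k))
  set Z := ∑ a ∈ S, σ a * ℓ (fourier (a + k))
  have hLB : 0 ≤ L * B := mul_nonneg hL hB
  have h1 : ‖(1 / m * X + 2 / m ^ 2 * Y : ℂ)‖ ≤ L * B := by
    calc ‖(1 / m * X + 2 / m ^ 2 * Y : ℂ)‖ ≤ 1 / m * ‖X‖ + 2 / m ^ 2 * ‖Y‖ := by
          refine (norm_add_le _ _).trans (le_of_eq ?_)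
          simp
      _ ≤ 1 / m * (L * B) + 2 / m ^ 2 * ((descPairs S).card * (L * B)) := by gcongr
      _ = (m + 2 * (descPairs S).card) / m ^ 2 * (L * B) := by field_simp
      _ = L * B := by rw [add_comm, hcard, div_self (by positivity), one_mul]
  have h2 : ‖(1 / m * Z : ℂ)‖ ≤ B := by
    calc ‖(1 / m * Z : ℂ)‖ = 1 / m * ‖Z‖ := by simp
      _ ≤ 1 / m * (m * B) := by gcongr
      _ = B := by field_simp
  calc _ ≤ ‖X‖ + ‖(ε * (1 / m * X + 2 / m ^ 2 * Y) : ℂ)‖ + ‖(t * (1 / m * Z) : ℂ)‖ :=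
        (norm_add_le _ _).trans (by gcongr; exact norm_sub_le _ _)
    _ = ‖X‖ + ε * ‖(1 / m * X + 2 / m ^ 2 * Y : ℂ)‖ + t * ‖(1 / m * Z : ℂ)‖ := by
        rw [norm_mul, norm_mul (t : ℂ), Complex.norm_real, Complex.norm_real,
          Real.norm_of_nonneg hε, Real.norm_of_nonneg ht]
    _ ≤ L * B + 1 * (L * B) + 1 * B := by gcongr
    _ = (2 * L + 1) * B := by ring

theorem le_re_map_damp {ℓ : C(AddCircle T, ℂ) →ₗ[ℂ] ℂ} {φ : C(AddCircle T, ℂ)}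
    {S Q : Finset ℤ} {σ : ℤ → ℂ} {m : ℕ} (hm : 0 < m) (hS : S.card = m) (hσ : ∀ a, ‖σ a‖ = 1)
    {ε t L c δ : ℝ} (hε : 0 ≤ ε) (ht : 0 ≤ t) (hL : 0 ≤ L) (hδ : 0 ≤ δ)
    (hφ : FrequencyControlled ℓ φ L Q)
    (hsmall : ∀ p ∈ descPairs S, ∀ q ∈ Q, ‖ℓ (fourier (q + (p.1 - p.2)))‖ ≤ δ)
    (hbig : ∀ a ∈ S, c ≤ (σ a * ℓ (fourier a)).re) :
    (ℓ φ).re * (1 - ε / m) - ε * (L * δ) + t * c ≤ (ℓ (damp φ S σ m ε t)).re := by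
  have hm' : (0 : ℝ) < m := by exact_mod_cast hm
  have hf0 : (fourier 0 : C(AddCircle T, ℂ)) = 1 := by
    ext x
    exact fourier_zero
  have key := map_damp_mul ℓ φ S σ m ε t 0
  simp only [add_zero, hf0, mul_one] at key
  have hp : ∀ p ∈ descPairs S, ‖σ p.1 * conj (σ p.2) * ℓ (φ * fourier (p.1 - p.2))‖
      ≤ L * δ := by
    intro p hp
    rw [norm_mul, norm_mul, RCLike.norm_conj, hσ, hσ, one_mul, one_mul]
    exact hφ _ δ hδ (hsmall p hp)
  have hpairs := norm_sum_le_of_le _ hp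
  rw [Finset.sum_const, nsmul_eq_mul] at hpairs
  have hcard : 2 * ((descPairs S).card : ℝ) + m = m ^ 2 := by
    have := card_descPairs S
    rw [hS] at this
    exact_mod_cast this
  have hZ : m * c ≤ (∑ a ∈ S, σ a * ℓ (fourier a)).re := by
    rw [Complex.re_sum, ← hS, ← nsmul_eq_mul]
    exact Finset.card_nsmul_le_sum _ _ _ hbig
  set X := ℓ φ
  set Y := ∑ p ∈ descPairs S, σ p.1 * conj (σ p.2) * ℓ (φ * fourier (p.1 - p.2))
  set Z := ∑ a ∈ S, σ a * ℓ (fourier a)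
  have hY : Y.re ≤ (descPairs S).card * (L * δ) := (Complex.re_le_norm Y).trans hpairs
  have hLδ : 0 ≤ L * δ := mul_nonneg hL hδ
  have hre : (ℓ (damp φ S σ m ε t)).re
      = X.re - ε * (1 / m * X.re + 2 / m ^ 2 * Y.re) + t * (1 / m * Z.re) := by
    have : ℓ (damp φ S σ m ε t) = X - (ε : ℝ) * (((1 / m : ℝ) : ℂ) * X + ((2 / m ^ 2 : ℝ) : ℂ) * Y)
        + (t : ℝ) * (((1 / m : ℝ) : ℂ) * Z) := by
      rw [key]
      push_cast
      ring
    rw [this]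
    simp only [Complex.add_re, Complex.sub_re, Complex.re_ofReal_mul]
  rw [hre]
  have h1 : 2 / (m : ℝ) ^ 2 * Y.re ≤ L * δ := by
    calc 2 / (m : ℝ) ^ 2 * Y.re ≤ 2 / m ^ 2 * ((descPairs S).card * (L * δ)) := by gcongr
      _ = (2 * (descPairs S).card) / m ^ 2 * (L * δ) := by ring
      _ ≤ 1 * (L * δ) := by
          gcongr
          rw [div_le_one (by positivity)]
          linarith
      _ = L * δ := one_mul _
  have h2 : c ≤ 1 / m * Z.re := by
    calc c = 1 / m * (m * c) := by field_simp
      _ ≤ 1 / m * Z.re := by gcongr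
  have h3 := mul_le_mul_of_nonneg_left h1 hε
  have h4 := mul_le_mul_of_nonneg_left h2 ht
  have h5 : X.re * (1 - ε / m) = X.re - ε * (1 / m * X.re) := by ring
  rw [h5]
  linarith

theorem exists_norm_le_re_ge {m : ℕ} (hm : 0 < m) {ε t : ℝ} (hε : 0 < ε) (hε2 : ε ≤ 1 / 2)
    (ht : 0 ≤ t) (ht1 : t ≤ 1) (s : ℕ) (hs : s ≤ m) :
    ∃ M R r : ℕ, ∀ (ℓ : C(AddCircle T, ℂ) →ₗ[ℂ] ℂ) (A : Finset ℤ) (c δ : ℝ), 0 ≤ c → 0 ≤ δ →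
      2 ^ m * δ ≤ t * c / 2 → (∀ a ∈ A, c ≤ ‖ℓ (fourier a)‖) →
      (∀ n ∉ A, ‖ℓ (fourier n)‖ ≤ δ) → M ≤ A.card →
      ∃ (φ : C(AddCircle T, ℂ)) (Q : Finset ℤ), Q.card ≤ r ∧
        (∀ q ∈ Q, (A.filter (q < ·)).card ≤ R) ∧
        (∀ x, ‖φ x‖ ≤ (1 + ε ^ 2 / 2 + t ^ 2 / (4 * ε)) ^ s) ∧
        FrequencyControlled ℓ φ (2 ^ s - 1) Q ∧ s * (t * c / 2) ≤ (ℓ φ).re := by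
  induction s with
  | zero =>
    refine ⟨0, 0, 0, fun ℓ A c δ _ _ _ _ _ _ => ⟨0, ∅, by simp, by simp, by simp, ?_, by simp⟩⟩
    intro k B _ _
    simp
  | succ s ih =>
    obtain ⟨M, R, r, hM⟩ := ih (by omega)
    obtain ⟨M', hM'⟩ := exists_separated_subset R r m
    refine ⟨max M M', max R M', r + r * m ^ 2 + m, fun ℓ A c δ hc hδ hcδ hbig hsmall hA => ?_⟩
    obtain ⟨φ, Q, hQ, hR, hφ, hctrl, hre⟩ :=
      hM ℓ A c δ hc hδ hcδ hbig hsmall (le_trans (le_max_left _ _) hA)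
    obtain ⟨S, hSA, hSm, hSM, hSep⟩ := hM' A Q hQ hR (le_trans (le_max_right _ _) hA)
    set σ : ℤ → ℂ := fun a => if ℓ (fourier a) = 0 then 1 else
      conj (ℓ (fourier a)) / ‖ℓ (fourier a)‖ with hσdef
    have hσ : ∀ a, ‖σ a‖ = 1 := by
      intro a
      by_cases h : ℓ (fourier a) = 0
      · simp [hσdef, h]
      · simp [hσdef, h]
    have hσre : ∀ a, (σ a * ℓ (fourier a)).re = ‖ℓ (fourier a)‖ := by
      intro a
      by_cases h : ℓ (fourier a) = 0
      · simp [hσdef, h]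
      · have h' : (‖ℓ (fourier a)‖ : ℂ) ≠ 0 := by simpa using h
        have : σ a * ℓ (fourier a) = ‖ℓ (fourier a)‖ := by
          simp only [hσdef, h, if_false]
          rw [div_mul_eq_mul_div, Complex.conj_mul', sq, mul_div_assoc, div_self h', mul_one]
        rw [this, Complex.ofReal_re]
    have hL : (0 : ℝ) ≤ 2 ^ s - 1 := sub_nonneg.2 (one_le_pow₀ (by norm_num))
    have hB : 1 ≤ (1 + ε ^ 2 / 2 + t ^ 2 / (4 * ε)) := by
      have : 0 ≤ ε ^ 2 / 2 + t ^ 2 / (4 * ε) := by positivity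
      linarith
    refine ⟨damp φ S σ m ε t,
      Q ∪ Finset.image₂ (fun q p => q + (p.1 - p.2)) Q (descPairs S) ∪ S, ?_, ?_, ?_, ?_, ?_⟩
    · refine (Finset.card_union_le _ _).trans (add_le_add ((Finset.card_union_le _ _).trans
        (add_le_add hQ ((Finset.card_image₂_le _ _ _).trans (Nat.mul_le_mul hQ ?_)))) hSm.le)
      have := card_descPairs S
      rw [hSm] at this
      omega
    · intro q hq
      rw [Finset.mem_union, Finset.mem_union, Finset.mem_image₂] at hq
      rcases hq with (hq | ⟨q, hq, p, hp, rfl⟩) | hq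
      · exact (hR q hq).trans (le_max_left _ _)
      · refine (Finset.card_le_card ?_).trans ((hR q hq).trans (le_max_left _ _))
        have := (Finset.mem_filter.1 hp).2
        intro x hx
        rw [Finset.mem_filter] at hx ⊢
        exact ⟨hx.1, by omega⟩
      · exact (hSM q hq).trans (le_max_right _ _)
    · intro x
      rw [pow_succ]
      exact norm_damp_apply_le hm hSm hσ hε (by linarith) ht (one_le_pow₀ hB) hφ x
    · have := hctrl.damp hm hSm hσ hε.le (by linarith) ht ht1 hL
      convert this using 1
      ring
    · have hgain := le_re_map_damp (c := c) hm hSm hσ hε.le ht hL hδ hctrl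
        (fun p hp q hq => hsmall _ ?_) (fun a ha => (hbig a (hSA ha)).trans (hσre a).ge)
      · refine le_trans ?_ hgain
        have hm' : (0 : ℝ) < m := by exact_mod_cast hm
        have hs' : (s : ℝ) ≤ m := by exact_mod_cast (by omega : s ≤ m)
        have htc : 0 ≤ t * c := mul_nonneg ht hc
        have hεm : ε / m ≤ 1 := by
          rw [div_le_one hm']
          have : (1 : ℝ) ≤ m := by exact_mod_cast hm
          linarith
        have h1 : (s * (t * c / 2)) * (1 - ε / m) ≤ (ℓ φ).re * (1 - ε / m) :=
          mul_le_mul_of_nonneg_right hre (by linarith)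
        have h2 : s * (t * c / 2) * (ε / m) ≤ t * c / 4 := by
          calc s * (t * c / 2) * (ε / m) ≤ m * (t * c / 2) * (ε / m) := by gcongr
            _ = t * c / 2 * ε := by field_simp
            _ ≤ t * c / 2 * (1 / 2) := by gcongr
            _ = t * c / 4 := by ring
        have h3 : ε * ((2 ^ s - 1) * δ) ≤ t * c / 4 := by
          calc ε * ((2 ^ s - 1) * δ) ≤ 1 / 2 * (2 ^ m * δ) := by
                gcongr
                have : (2 : ℝ) ^ s ≤ 2 ^ m := pow_le_pow_right₀ (by norm_num) (by omega)
                linarith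
            _ ≤ 1 / 2 * (t * c / 2) := by gcongr
            _ = t * c / 4 := by ring
        push_cast
        linarith
      · have hp' := Finset.mem_filter.1 hp
        have hp2 := Finset.mem_product.1 hp'.1
        exact hSep _ hp2.1 _ hp2.2 hp'.2 q hq

/-- A bounded functional with many large Fourier coefficients must have Fourier coefficients of
intermediate size. -/
theorem exists_card_lt_of_gap (C : ℝ) {c : ℝ} (hc : 0 < c) :
    ∃ (K : ℕ) (δ : ℝ), 0 < δ ∧ ∀ (ℓ : C(AddCircle T, ℂ) →ₗ[ℂ] ℂ),
      (∀ φ B, (∀ x, ‖φ x‖ ≤ B) → ‖ℓ φ‖ ≤ C * B) → ∀ A : Finset ℤ,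
      (∀ a ∈ A, c ≤ ‖ℓ (fourier a)‖) → (∀ n ∉ A, ‖ℓ (fourier n)‖ ≤ δ) → A.card < K := by
  obtain ⟨τ, hτ⟩ := exists_nat_gt (max 2 (6 * |C| / c))
  have hτ2 : (2 : ℝ) < τ := (le_max_left _ _).trans_lt hτ
  have hτC : 6 * |C| / c < τ := (le_max_right _ _).trans_lt hτ
  have hτ0 : (0 : ℝ) < τ := by linarith
  have hτn : 0 < τ := by exact_mod_cast hτ0
  set ε : ℝ := 1 / τ ^ 2 with hε
  set t : ℝ := 1 / τ ^ 3 with ht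
  have hε0 : 0 < ε := by positivity
  have ht0 : 0 < t := by positivity
  have hε2 : ε ≤ 1 / 2 := by
    rw [hε]
    exact one_div_le_one_div_of_le (by norm_num) (by nlinarith)
  have ht1 : t ≤ 1 := by
    rw [ht, div_le_one (by positivity)]
    exact one_le_pow₀ (by linarith)
  obtain ⟨M, R, r, hM⟩ :=
    exists_norm_le_re_ge (T := T) (pow_pos hτn 4) hε0 hε2 ht0.le ht1 (τ ^ 4) le_rfl
  refine ⟨M, t * c / 2 / 2 ^ (τ ^ 4), by positivity, fun ℓ hℓ A hbig hsmall => ?_⟩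
  by_contra! hA
  obtain ⟨φ, Q, -, -, hφ, -, hre⟩ := hM ℓ A c (t * c / 2 / 2 ^ (τ ^ 4)) hc.le (by positivity)
    (by field_simp; exact le_rfl) hbig hsmall hA
  have hpow : (1 + ε ^ 2 / 2 + t ^ 2 / (4 * ε)) ^ (τ ^ 4) ≤ 3 := by
    have h1 : 1 + ε ^ 2 / 2 + t ^ 2 / (4 * ε) ≤ Real.exp (1 / τ ^ 4) := by
      have h2 : ε ^ 2 / 2 + t ^ 2 / (4 * ε) = 3 / 4 * (1 / τ ^ 4) := by
        rw [hε, ht]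
        field_simp
        norm_num
      have h3 := Real.add_one_le_exp (1 / (τ : ℝ) ^ 4)
      have h4 : 0 ≤ 1 / (τ : ℝ) ^ 4 := by positivity
      linarith
    calc _ ≤ Real.exp (1 / τ ^ 4) ^ (τ ^ 4) := by gcongr
      _ = Real.exp 1 := by
        rw [← Real.exp_nat_mul]
        congr 1
        push_cast
        field_simp
      _ ≤ 3 := Real.exp_one_lt_d9.le.trans (by norm_num)
  have hup : (ℓ φ).re ≤ |C| * 3 := by
    refine (Complex.re_le_norm _).trans ((hℓ φ _ fun x => (hφ x).trans hpow).trans ?_)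
    gcongr
    exact le_abs_self C
  have hlow : ((τ ^ 4 : ℕ) : ℝ) * (t * c / 2) = τ * c / 2 := by
    rw [ht]
    push_cast
    field_simp
  rw [hlow] at hre
  rw [div_lt_iff₀ hc] at hτC
  linarith

theorem exists_card_lt_of_finite_values (C : ℝ) (v : ℕ) {c : ℝ} (hc : 0 < c) :
    ∃ K : ℕ, ∀ (ℓ : C(AddCircle T, ℂ) →ₗ[ℂ] ℂ),
      (∀ φ B, (∀ x, ‖φ x‖ ≤ B) → ‖ℓ φ‖ ≤ C * B) → {n : ℤ | ℓ (fourier n) ≠ 0}.Finite →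
      ∀ V : Finset ℝ, V.card ≤ v → (∀ n, ‖ℓ (fourier n)‖ < c → ‖ℓ (fourier n)‖ ∈ V) →
      ∃ A : Finset ℤ, A.card < K ∧ ∀ n ∉ A, ‖ℓ (fourier n)‖ < c := by
  induction v generalizing c with
  | zero =>
    obtain ⟨K, δ, hδ, hK⟩ := exists_card_lt_of_gap (T := T) C hc
    refine ⟨K, fun ℓ hℓ hfin V hV hval => ?_⟩
    have hV0 : V = ∅ := Finset.card_eq_zero.1 (Nat.le_zero.1 hV)
    have hall : ∀ n, c ≤ ‖ℓ (fourier n)‖ := fun n => by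
      by_contra! h
      simpa [hV0] using hval n h
    refine absurd hfin ?_
    have : {n : ℤ | ℓ (fourier n) ≠ 0} = Set.univ :=
      Set.eq_univ_of_forall fun n => norm_pos_iff.1 (hc.trans_le (hall n))
    rw [this]
    exact Set.infinite_univ
  | succ v ih =>
    obtain ⟨K, δ, hδ, hK⟩ := exists_card_lt_of_gap (T := T) C hc
    obtain ⟨K', hK'⟩ := ih (c := min δ c) (lt_min hδ hc)
    refine ⟨max K K', fun ℓ hℓ hfin V hV hval => ?_⟩
    by_cases hgap : ∃ n, min δ c ≤ ‖ℓ (fourier n)‖ ∧ ‖ℓ (fourier n)‖ < c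
    · obtain ⟨n₀, h1, h2⟩ := hgap
      obtain ⟨A, hA, hAs⟩ := hK' ℓ hℓ hfin (V.erase ‖ℓ (fourier n₀)‖) (by
          rw [Finset.card_erase_of_mem (hval n₀ h2)]
          omega) fun n hn =>
        Finset.mem_erase.2 ⟨(hn.trans_le h1).ne, hval n (hn.trans_le (min_le_right _ _))⟩
      exact ⟨A, hA.trans_le (le_max_right _ _), fun n hn =>
        (hAs n hn).trans_le (min_le_right _ _)⟩
    · push Not at hgap
      have hfin' : {n : ℤ | c ≤ ‖ℓ (fourier n)‖}.Finite :=
        hfin.subset fun n hn => norm_pos_iff.1 (hc.trans_le hn)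
      refine ⟨hfin'.toFinset, lt_of_lt_of_le (hK ℓ hℓ _ (by simp) fun n hn => ?_)
        (le_max_left _ _), fun n hn => by simpa using hn⟩
      have hn' : ‖ℓ (fourier n)‖ < c := by simpa using hn
      by_contra! h
      exact absurd (hgap n ((min_le_left _ _).trans h.le)) (not_le.2 hn')

end Damping

/-- On Fourier coefficients, the effect of multiplying by `cos θ - x`. -/
noncomputable def cosSubShift (x : ℝ) (u : ℤ → ℝ) : ℤ → ℝ :=
  fun n => (u (n + 1) + u (n - 1)) / 2 - x * u n

/-- The composition of the operators `cosSubShift x` over `x` in a list. -/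
noncomputable def cosSubShifts (L : List ℝ) (u : ℤ → ℝ) : ℤ → ℝ := L.foldr cosSubShift u

theorem cosSubShifts_cons (x : ℝ) (L : List ℝ) (u : ℤ → ℝ) (n : ℤ) :
    cosSubShifts (x :: L) u n =
      (cosSubShifts L u (n + 1) + cosSubShifts L u (n - 1)) / 2 - x * cosSubShifts L u n := rfl

theorem abs_cosSubShifts_le {L : List ℝ} (hL : ∀ x ∈ L, |x| ≤ 1) {u : ℤ → ℝ} {M : ℝ}
    (hu : ∀ n, |u n| ≤ M) (n : ℤ) : |cosSubShifts L u n| ≤ 2 ^ L.length * M := by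
  induction L generalizing n with
  | nil => simpa [cosSubShifts] using hu n
  | cons x L ih =>
    have ih' := ih fun y hy => hL y (List.mem_cons_of_mem _ hy)
    have hx := hL x List.mem_cons_self
    rw [cosSubShifts_cons, List.length_cons, pow_succ]
    have h1 := abs_le.1 (ih' (n + 1))
    have h2 := abs_le.1 (ih' (n - 1))
    have h3 : |x * cosSubShifts L u n| ≤ 1 * (2 ^ L.length * M) := by
      rw [abs_mul]
      exact mul_le_mul hx (ih' n) (abs_nonneg _) zero_le_one
    have h3 := abs_le.1 h3
    rw [abs_le]
    constructor <;> linarith [h1.1, h1.2, h2.1, h2.2, h3.1, h3.2]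

theorem cosSubShifts_of_eq_zero_left (L : List ℝ) (u : ℤ → ℝ) (n : ℤ)
    (hu : ∀ i, n - L.length ≤ i → i < n + L.length → u i = 0) :
    cosSubShifts L u n = (1 / 2) ^ L.length * u (n + L.length) := by
  induction L generalizing n with
  | nil => simp [cosSubShifts]
  | cons x L ih =>
    simp only [List.length_cons, Nat.cast_add, Nat.cast_one] at hu ⊢
    rw [cosSubShifts_cons, ih n fun i h1 h2 => hu i (by omega) (by omega),
      ih (n + 1) fun i h1 h2 => hu i (by omega) (by omega),
      ih (n - 1) fun i h1 h2 => hu i (by omega) (by omega),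
      hu (n + L.length) (by omega) (by omega), hu (n - 1 + L.length) (by omega) (by omega),
      show n + 1 + (L.length : ℤ) = n + (L.length + 1) by ring]
    ring

theorem cosSubShifts_of_eq_zero_right (L : List ℝ) (u : ℤ → ℝ) (n : ℤ)
    (hu : ∀ i, n - L.length < i → i ≤ n + L.length → u i = 0) :
    cosSubShifts L u n = (1 / 2) ^ L.length * u (n - L.length) := by
  induction L generalizing n with
  | nil => simp [cosSubShifts]
  | cons x L ih =>
    simp only [List.length_cons, Nat.cast_add, Nat.cast_one] at hu ⊢
    rw [cosSubShifts_cons, ih n fun i h1 h2 => hu i (by omega) (by omega),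
      ih (n + 1) fun i h1 h2 => hu i (by omega) (by omega),
      ih (n - 1) fun i h1 h2 => hu i (by omega) (by omega),
      hu (n - L.length) (by omega) (by omega), hu (n + 1 - L.length) (by omega) (by omega),
      show n - 1 - (L.length : ℤ) = n - (L.length + 1) by ring]
    ring

theorem cosSubShifts_translate_sub (L : List ℝ) (u : ℤ → ℝ) (p n : ℤ) :
    cosSubShifts L (fun i => u (i + p) - u i) n =
      cosSubShifts L u (n + p) - cosSubShifts L u n := by
  induction L generalizing n with
  | nil => simp [cosSubShifts]
  | cons x L ih =>
    simp only [cosSubShifts_cons, ih, show n + 1 + p = n + p + 1 by ring,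
      show n - 1 + p = n + p - 1 by ring]
    ring

theorem exists_finset_cosSubShifts_mem (L : List ℝ) {u : ℤ → ℝ} {W : Finset ℝ}
    (hu : ∀ n, u n ∈ W) :
    ∃ V : Finset ℝ, V.card ≤ W.card ^ 3 ^ L.length ∧ ∀ n, cosSubShifts L u n ∈ V := by
  induction L with
  | nil => exact ⟨W, by simp, hu⟩
  | cons x L ih =>
    obtain ⟨V, hV, hmem⟩ := ih
    refine ⟨(V ×ˢ V ×ˢ V).image fun p => (p.1 + p.2.1) / 2 - x * p.2.2, ?_, fun n => ?_⟩
    · refine Finset.card_image_le.trans ?_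
      rw [Finset.card_product, Finset.card_product, List.length_cons, pow_succ, pow_mul, pow_three]
      gcongr
    · exact Finset.mem_image.2 ⟨(_, _, _), Finset.mk_mem_product (hmem (n + 1))
        (Finset.mk_mem_product (hmem (n - 1)) (hmem n)), rfl⟩

theorem finite_cosSubShifts_ne_zero (L : List ℝ) {u : ℤ → ℝ} (hu : {n | u n ≠ 0}.Finite) :
    {n | cosSubShifts L u n ≠ 0}.Finite := by
  induction L with
  | nil => exact hu
  | cons x L ih =>
    refine ((ih.preimage (f := fun n => n + 1) (fun a _ b _ h => by simpa using h)).union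
      ((ih.preimage (f := fun n => n - 1) (fun a _ b _ h => by simpa using h)).union ih)).subset ?_
    intro n hn
    by_contra! h
    simp only [Set.mem_union, Set.mem_preimage, Set.mem_ofPred_eq, not_or, not_not] at h
    exact hn (by rw [cosSubShifts_cons, h.1, h.2.1, h.2.2]; simp)

open Polynomial in
/-- A nonzero real polynomial becomes nonnegative on `[-1, 1]` after multiplication by linear
factors at some of its distinct roots there and by a sign. -/
theorem Polynomial.exists_sign_mul_prod_nonneg (P : ℝ[X]) (hP : P ≠ 0) :
    ∃ A : Finset ℝ, (∀ a ∈ A, a ∈ Set.Icc (-1 : ℝ) 1 ∧ P.IsRoot a) ∧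
      ∃ s : ℝ, (s = 1 ∨ s = -1) ∧
        ∀ x ∈ Set.Icc (-1 : ℝ) 1, 0 ≤ s * P.eval x * ∏ a ∈ A, (x - a) := by
  induction h : P.natDegree using Nat.strong_induction_on generalizing P with
  | _ n ih =>
  subst h
  by_cases hroot : ∃ a ∈ Set.Icc (-1 : ℝ) 1, P.IsRoot a
  · obtain ⟨a, ha, hPa⟩ := hroot
    obtain ⟨P', rfl⟩ := dvd_iff_isRoot.2 hPa
    have hP' : P' ≠ 0 := right_ne_zero_of_mul hP
    obtain ⟨A, hA, s, hs, hpos⟩ := ih P'.natDegree (by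
      rw [natDegree_mul (X_sub_C_ne_zero a) hP', natDegree_X_sub_C]; omega) P' hP' rfl
    have hA' : ∀ b ∈ A, b ∈ Set.Icc (-1 : ℝ) 1 ∧ ((X - C a) * P').IsRoot b := fun b hb =>
      ⟨(hA b hb).1, by simp [(hA b hb).2.eq_zero]⟩
    by_cases haA : a ∈ A
    · refine ⟨A.erase a, fun b hb => hA' b (Finset.mem_of_mem_erase hb), s, hs, fun x hx => ?_⟩
      have := hpos x hx
      rw [← Finset.mul_prod_erase A _ haA] at this
      simp only [eval_mul, eval_sub, eval_X, eval_C]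
      linarith
    · refine ⟨insert a A, fun b hb => ?_, s, hs, fun x hx => ?_⟩
      · rcases Finset.mem_insert.1 hb with rfl | hb
        · exact ⟨ha, hPa⟩
        · exact hA' b hb
      · rw [Finset.prod_insert haA]
        simp only [eval_mul, eval_sub, eval_X, eval_C]
        have := mul_nonneg (sq_nonneg (x - a)) (hpos x hx)
        linarith
  · push Not at hroot
    have hne : ∀ x ∈ Set.Icc (-1 : ℝ) 1, P.eval x ≠ 0 := hroot
    have hivt := isPreconnected_Icc (a := (-1 : ℝ)) (b := 1)
    have h1 : (1 : ℝ) ∈ Set.Icc (-1 : ℝ) 1 := by norm_num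
    have hcont : ContinuousOn (fun x => P.eval x) (Set.Icc (-1 : ℝ) 1) := P.continuous.continuousOn
    rcases lt_or_gt_of_ne (hne 1 h1) with hlt | hgt
    · refine ⟨∅, by simp, -1, Or.inr rfl, fun x hx => ?_⟩
      by_contra! hx0
      simp only [Finset.prod_empty, mul_one, neg_one_mul, neg_lt_zero] at hx0
      obtain ⟨y, hy, hy0⟩ := hivt.intermediate_value h1 hx hcont ⟨hlt.le, hx0.le⟩
      exact hne y hy hy0
    · refine ⟨∅, by simp, 1, Or.inl rfl, fun x hx => ?_⟩
      by_contra! hx0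
      simp only [Finset.prod_empty, mul_one, one_mul] at hx0
      obtain ⟨y, hy, hy0⟩ := hivt.intermediate_value hx h1 hcont ⟨hx0.le, hgt.le⟩
      exact hne y hy hy0

theorem eq_of_shift_determined {R : Finset ℤ} {w a D : ℕ} {q : ℕ → ℤ}
    (hR : ∀ n, a ≤ n → n ≤ a + D → q n ∈ R) (hD : R.card ^ w + w ≤ D)
    (hdvd : ∀ p, 0 < p → p ≤ R.card ^ w → p ∣ D)
    (hfwd : ∀ i p, a ≤ i → i + w + p ≤ a + D → (∀ j < w, q (i + j + p) = q (i + j)) →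
      q (i + w + p) = q (i + w))
    (hbwd : ∀ i p, a ≤ i → i + w + p ≤ a + D → (∀ j < w, q (i + 1 + j + p) = q (i + 1 + j)) →
      q (i + p) = q i) : q (a + D) = q a := by
  obtain ⟨x, hx, y, hy, hne, hxy⟩ := Finset.exists_ne_map_eq_of_card_lt_of_maps_to
    (s := Finset.range (R.card ^ w + 1)) (t := Fintype.piFinset fun _ : Fin w => R)
    (f := fun x j => q (a + x + j)) (by simp) (fun x hx => by
      rw [Finset.mem_coe, Finset.mem_range] at hx
      rw [Finset.mem_coe, Fintype.mem_piFinset]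
      intro j
      have := j.2
      exact hR _ (by omega) (by omega))
  obtain ⟨i, p, hp, hia, hip, hword⟩ : ∃ i p, 0 < p ∧ a ≤ i ∧ i + p ≤ a + R.card ^ w ∧
      ∀ j < w, q (i + j + p) = q (i + j) := by
    rw [Finset.mem_range] at hx hy
    have hxy' : ∀ j < w, q (a + x + j) = q (a + y + j) := fun j hj => congrFun hxy ⟨j, hj⟩
    rcases lt_or_gt_of_ne hne with h | h
    · refine ⟨a + x, y - x, by omega, by omega, by omega, fun j hj => ?_⟩
      rw [hxy' j hj]
      congr 1
      omega
    · refine ⟨a + y, x - y, by omega, by omega, by omega, fun j hj => ?_⟩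
      rw [← hxy' j hj]
      congr 1
      omega
  have hup : ∀ m, i + m + p ≤ a + D → q (i + m + p) = q (i + m) := by
    intro m
    induction m using Nat.strong_induction_on with
    | _ m ih =>
    intro hm
    rcases lt_or_ge m w with h | h
    · exact hword m h
    · obtain ⟨m, rfl⟩ := Nat.exists_eq_add_of_le' h
      have := hfwd (i + m) p (by omega) (by omega) fun j hj => by
        have := ih (m + j) (by omega) (by omega)
        rwa [show i + m + j = i + (m + j) by omega]
      rwa [show i + (m + w) = i + m + w by omega]
  have hdown : ∀ m, a + m ≤ i → ∀ n, a + m ≤ n → n + p ≤ a + D → q (n + p) = q n := by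
    intro m hm
    induction h : i - (a + m) generalizing m with
    | zero =>
      intro n hn hnD
      obtain ⟨n, rfl⟩ := Nat.exists_eq_add_of_le (show i ≤ n by omega)
      exact hup n hnD
    | succ k ih =>
      have ih' := ih (m + 1) (by omega) (by omega)
      intro n hn hnD
      rcases hn.eq_or_lt with rfl | hn
      · refine hbwd _ p (by omega) (by omega) fun j hj => ih' _ (by omega) (by omega)
      · exact ih' n (by omega) hnD
  have hper := hdown 0 (by omega)
  obtain ⟨e, rfl⟩ := hdvd p hp (by omega)
  have : ∀ f ≤ e, q (a + p * f) = q a := by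
    intro f
    induction f with
    | zero => simp
    | succ f ih =>
      intro hf
      have hle : p * (f + 1) ≤ p * e := Nat.mul_le_mul_left _ hf
      rw [mul_add, mul_one] at hle
      rw [mul_add, mul_one, ← add_assoc, hper _ (by omega) (by omega), ih (by omega)]
  exact this e le_rfl

section CosineFunctional

variable {T : ℝ}

open Polynomial AddCircle MeasureTheory

/-- The cosine on a circle, as a real part of a Fourier mode, lies in `[-1, 1]`. -/
theorem re_fourier_one_mem (x : AddCircle T) : (fourier 1 x).re ∈ Set.Icc (-1 : ℝ) 1 := by
  have h := Complex.abs_re_le_norm (fourier 1 x)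
  rw [norm_fourier_apply] at h
  exact abs_le.1 h

theorem re_fourier_mul_fourier (m n : ℤ) (x : AddCircle T) :
    (((fourier m x : ℂ).re : ℝ) : ℂ) * fourier n x =
      (fourier (n + m) x + fourier (n - m) x) / 2 := by
  rw [sub_eq_add_neg, fourier_add, fourier_add, fourier_neg, Complex.re_eq_add_conj]
  ring

theorem chebyshev_T_eval_re_fourier (m : ℤ) (x : AddCircle T) :
    (Chebyshev.T ℝ m).eval (fourier 1 x : ℂ).re = (fourier m x : ℂ).re := by
  obtain ⟨θ, hθ⟩ : ∃ θ : ℝ, (x.toCircle : ℂ) = Complex.exp (θ * Complex.I) :=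
    ⟨Complex.arg x.toCircle, by
      simpa only [Circle.norm_coe, Complex.ofReal_one, one_mul] using
        (Complex.norm_mul_exp_arg_mul_I (x.toCircle : ℂ)).symm⟩
  have h (k : ℤ) : (fourier k x : ℂ).re = Real.cos (k * θ) := by
    rw [fourier_apply, toCircle_zsmul, Circle.coe_zpow, hθ, ← Complex.exp_int_mul,
      ← mul_assoc, ← Complex.ofReal_intCast, ← Complex.ofReal_mul, Complex.exp_ofReal_mul_I_re]
  rw [h, h, ← Chebyshev.T_real_cos]
  simp

variable [hT : Fact (0 < T)]

theorem integrable_of_continuous_addCircle {f : AddCircle T → ℂ} (hf : Continuous f) :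
    Integrable f haarAddCircle :=
  hf.integrable_of_hasCompactSupport (HasCompactSupport.of_compactSpace f)

/-- Integration against the even density `P (cos θ)`. -/
noncomputable def cosFunctional (P : ℝ[X]) : C(AddCircle T, ℂ) →ₗ[ℂ] ℂ where
  toFun φ := ∫ x, ((P.eval (fourier 1 x).re : ℝ) : ℂ) * φ x ∂haarAddCircle
  map_add' φ ψ := by
    simp only [ContinuousMap.add_apply, mul_add]
    exact integral_add (integrable_of_continuous_addCircle (by fun_prop))
      (integrable_of_continuous_addCircle (by fun_prop))
  map_smul' c φ := by
    simp only [ContinuousMap.smul_apply, smul_eq_mul, RingHom.id_apply, ← integral_const_mul]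
    congr 1
    ext x
    ring

theorem cosFunctional_apply (P : ℝ[X]) (φ : C(AddCircle T, ℂ)) :
    cosFunctional P φ = ∫ x, ((P.eval (fourier 1 x).re : ℝ) : ℂ) * φ x ∂haarAddCircle := rfl

theorem cosFunctional_add (P Q : ℝ[X]) (φ : C(AddCircle T, ℂ)) :
    cosFunctional (P + Q) φ = cosFunctional P φ + cosFunctional Q φ := by
  simp only [cosFunctional_apply, eval_add, Complex.ofReal_add, add_mul]
  exact integral_add (integrable_of_continuous_addCircle (by fun_prop))
    (integrable_of_continuous_addCircle (by fun_prop))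

theorem cosFunctional_C_mul (c : ℝ) (P : ℝ[X]) (φ : C(AddCircle T, ℂ)) :
    cosFunctional (C c * P) φ = c * cosFunctional P φ := by
  simp only [cosFunctional_apply, eval_mul, eval_C, Complex.ofReal_mul, ← integral_const_mul,
    mul_assoc]

theorem cosFunctional_sum {ι : Type*} (s : Finset ι) (P : ι → ℝ[X]) (φ : C(AddCircle T, ℂ)) :
    cosFunctional (∑ i ∈ s, P i) φ = ∑ i ∈ s, cosFunctional (P i) φ := by
  classical
  induction s using Finset.induction_on with
  | empty => simp [cosFunctional_apply]
  | insert a s ha ih => rw [Finset.sum_insert ha, Finset.sum_insert ha, cosFunctional_add, ih]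

theorem norm_cosFunctional_le {P : ℝ[X]} (hP : ∀ x ∈ Set.Icc (-1 : ℝ) 1, 0 ≤ P.eval x)
    (φ : C(AddCircle T, ℂ)) {B : ℝ} (hφ : ∀ x, ‖φ x‖ ≤ B) :
    ‖cosFunctional P φ‖ ≤ (cosFunctional P (fourier 0 : C(AddCircle T, ℂ))).re * B := by
  have h0 : (cosFunctional P (fourier 0 : C(AddCircle T, ℂ))).re =
      ∫ x, P.eval (fourier 1 x : ℂ).re ∂(haarAddCircle (T := T)) := by
    rw [cosFunctional_apply]
    simp only [fourier_zero, mul_one]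
    rw [integral_complex_ofReal, Complex.ofReal_re]
  rw [h0, cosFunctional_apply, ← integral_mul_const]
  refine norm_integral_le_of_norm_le ?_ (Filter.Eventually.of_forall fun x => ?_)
  · exact Continuous.integrable_of_hasCompactSupport (by fun_prop)
      (HasCompactSupport.of_compactSpace _)
  · have h := hP _ (re_fourier_one_mem x)
    rw [norm_mul, Complex.norm_real, Real.norm_of_nonneg h]
    exact mul_le_mul_of_nonneg_left (hφ x) h

theorem integral_fourier (n : ℤ) :
    ∫ x, (fourier n x : ℂ) ∂(haarAddCircle (T := T)) = if n = 0 then 1 else 0 := by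
  have h := congrFun (fourierCoeff_fourier (T := T) n) 0
  simpa only [fourierCoeff, neg_zero, fourier_zero, one_smul, Pi.single_apply,
    @eq_comm ℤ 0 n] using h

theorem cosFunctional_chebyshev_T (m n : ℤ) :
    cosFunctional (Chebyshev.T ℝ m) (fourier n : C(AddCircle T, ℂ)) =
      ((((if n + m = 0 then 1 else 0) + (if n - m = 0 then 1 else 0)) / 2 : ℝ) : ℂ) := by
  simp only [cosFunctional_apply, chebyshev_T_eval_re_fourier, re_fourier_mul_fourier]
  rw [integral_div, integral_add (integrable_of_continuous_addCircle (by fun_prop))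
    (integrable_of_continuous_addCircle (by fun_prop)), integral_fourier, integral_fourier]
  push_cast
  split_ifs <;> simp

theorem cosFunctional_X_sub_C_mul {P : ℝ[X]} {u : ℤ → ℝ}
    (hu : ∀ n, cosFunctional P (fourier n : C(AddCircle T, ℂ)) = u n) (a : ℝ) (n : ℤ) :
    cosFunctional ((X - C a) * P) (fourier n : C(AddCircle T, ℂ)) = cosSubShift a u n := by
  have h (x : AddCircle T) : ((((X - C a) * P).eval (fourier 1 x : ℂ).re : ℝ) : ℂ) * fourier n x =
      (((P.eval (fourier 1 x : ℂ).re : ℝ) : ℂ) * fourier (n + 1) x +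
        ((P.eval (fourier 1 x : ℂ).re : ℝ) : ℂ) * fourier (n - 1) x) / 2 -
        a * (((P.eval (fourier 1 x : ℂ).re : ℝ) : ℂ) * fourier n x) := by
    have h := re_fourier_mul_fourier 1 n x
    simp only [eval_mul, eval_sub, eval_X, eval_C, Complex.ofReal_mul, Complex.ofReal_sub]
    linear_combination ((P.eval (fourier 1 x : ℂ).re : ℝ) : ℂ) * h
  rw [cosFunctional_apply]
  simp only [h]
  rw [integral_sub (integrable_of_continuous_addCircle (by fun_prop))
    (integrable_of_continuous_addCircle (by fun_prop)), integral_div,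
    integral_add (integrable_of_continuous_addCircle (by fun_prop))
    (integrable_of_continuous_addCircle (by fun_prop)), integral_const_mul,
    ← cosFunctional_apply, ← cosFunctional_apply, ← cosFunctional_apply, hu, hu, hu, cosSubShift]
  push_cast
  rfl

theorem cosFunctional_prod_X_sub_C_mul {P : ℝ[X]} {u : ℤ → ℝ}
    (hu : ∀ n, cosFunctional P (fourier n : C(AddCircle T, ℂ)) = u n) (L : List ℝ) (n : ℤ) :
    cosFunctional ((L.map fun a => X - C a).prod * P) (fourier n : C(AddCircle T, ℂ)) =
      cosSubShifts L u n := by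
  induction L generalizing n with
  | nil => simpa [cosSubShifts] using hu n
  | cons a L ih =>
    rw [List.map_cons, List.prod_cons, mul_assoc]
    exact cosFunctional_X_sub_C_mul ih a n

end CosineFunctional

/-- The coefficients of `∑ m ≤ N, q m * cos (m θ)` as an exponential sum. -/
noncomputable def cosCoeff (N : ℕ) (q : ℕ → ℤ) (n : ℤ) : ℝ :=
  if n.natAbs ≤ N then if n = 0 then (q 0 : ℝ) else q n.natAbs / 2 else 0

theorem cosCoeff_natCast {N n : ℕ} (q : ℕ → ℤ) (h0 : 0 < n) (hn : n ≤ N) :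
    cosCoeff N q n = q n / 2 := by
  simp [cosCoeff, hn, h0.ne']

theorem finite_cosCoeff_ne_zero (N : ℕ) (q : ℕ → ℤ) : {n | cosCoeff N q n ≠ 0}.Finite := by
  refine (Set.finite_Icc (-(N : ℤ)) N).subset fun n hn => ?_
  have : n.natAbs ≤ N := by
    by_contra h
    exact hn (by simp [cosCoeff, h])
  rw [Set.mem_Icc]
  omega

theorem abs_cosCoeff_le {N : ℕ} {q : ℕ → ℤ} {R : Finset ℤ} (hq : ∀ n ≤ N, q n ∈ R) (n : ℤ) :
    |cosCoeff N q n| ≤ (R.sup fun r => r.natAbs : ℕ) := by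
  have h (m : ℕ) (hm : m ≤ N) : |(q m : ℝ)| ≤ (R.sup fun r => r.natAbs : ℕ) := by
    rw [← Int.cast_abs, Int.abs_eq_natAbs, Int.cast_natCast]
    exact_mod_cast Finset.le_sup (f := fun r : ℤ => r.natAbs) (hq m hm)
  rw [cosCoeff]
  split_ifs with h1 h2
  · exact h 0 (Nat.zero_le _)
  · rw [abs_div, abs_two]
    have := h _ h1
    have := abs_nonneg (q n.natAbs : ℝ)
    linarith
  · simp

theorem exists_finset_cosCoeff_mem (R : Finset ℤ) :
    ∃ W : Finset ℝ, W.card ≤ 2 * R.card + 1 ∧ ∀ N (q : ℕ → ℤ), (∀ n ≤ N, q n ∈ R) →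
      ∀ n, cosCoeff N q n ∈ W := by
  classical
  refine ⟨insert 0 (R.image (fun r : ℤ => (r : ℝ)) ∪ R.image fun r : ℤ => (r / 2 : ℝ)), ?_, ?_⟩
  · refine (Finset.card_insert_le _ _).trans ?_
    have h1 := Finset.card_union_le (R.image (fun r : ℤ => (r : ℝ))) (R.image fun r : ℤ => (r / 2 : ℝ))
    have h2 := Finset.card_image_le (s := R) (f := fun r : ℤ => (r : ℝ))
    have h3 := Finset.card_image_le (s := R) (f := fun r : ℤ => (r / 2 : ℝ))
    omega
  · intro N q hq n
    rw [cosCoeff]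
    split_ifs with h1 h2
    · exact Finset.mem_insert_of_mem (Finset.mem_union_left _
        (Finset.mem_image_of_mem _ (hq 0 (Nat.zero_le _))))
    · exact Finset.mem_insert_of_mem (Finset.mem_union_right _
        (Finset.mem_image_of_mem (fun r : ℤ => (r / 2 : ℝ)) (hq _ h1)))
    · exact Finset.mem_insert_self _ _

section CosinePolynomial

open Polynomial

/-- The polynomial in `cos θ` representing `∑ m ≤ N, q m * cos (m θ)`. -/
noncomputable def cosPolynomial (N : ℕ) (q : ℕ → ℤ) : ℝ[X] :=
  ∑ m ∈ Finset.range (N + 1), C (q m : ℝ) * Chebyshev.T ℝ m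

theorem cosFunctional_cosPolynomial {T : ℝ} [Fact (0 < T)] (N : ℕ) (q : ℕ → ℤ) (n : ℤ) :
    cosFunctional (cosPolynomial N q) (fourier n : C(AddCircle T, ℂ)) = cosCoeff N q n := by
  simp only [cosPolynomial, cosFunctional_sum, cosFunctional_C_mul, cosFunctional_chebyshev_T]
  have key (m : ℕ) : (q m : ℝ) * (((if n + m = 0 then 1 else 0) +
      (if n - m = 0 then 1 else 0)) / 2) =
      if m = n.natAbs then if n = 0 then (q 0 : ℝ) else q n.natAbs / 2 else 0 := by
    by_cases hm : m = n.natAbs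
    · subst hm
      by_cases hn : n = 0
      · subst hn; simp
      · rcases lt_or_gt_of_ne hn with h | h
        · rw [if_pos (by omega), if_neg (by omega)]; simp [hn]; ring
        · rw [if_neg (by omega), if_pos (by omega)]; simp [hn]; ring
    · rw [if_neg (by omega), if_neg (by omega), if_neg hm]; simp
  simp only [← Complex.ofReal_mul, key, ← Complex.ofReal_sum, Finset.sum_ite_eq', Finset.mem_range,
    Nat.lt_succ_iff, cosCoeff]

theorem cosPolynomial_ne_zero {N : ℕ} {q : ℕ → ℤ} (h : q N ≠ 0) : cosPolynomial N q ≠ 0 := by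
  intro h0
  have h1 := cosFunctional_cosPolynomial (T := 1) N q N
  rw [h0] at h1
  have h2 : cosCoeff N q N = 0 := by
    simpa [cosFunctional_apply] using h1.symm
  rcases Nat.eq_zero_or_pos N with rfl | hN
  · simp [cosCoeff] at h2
    exact h h2
  · rw [cosCoeff_natCast q hN le_rfl] at h2
    simp at h2
    exact h h2

theorem cosPolynomial_eval_cos (N : ℕ) (q : ℕ → ℤ) (θ : ℝ) :
    (cosPolynomial N q).eval (Real.cos θ) = (∑ n ∈ Finset.range (N + 1),
      (q n : ℂ) * Complex.exp (θ * Complex.I) ^ n).re := by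
  rw [cosPolynomial, eval_finsetSum, Complex.re_sum]
  refine Finset.sum_congr rfl fun n _ => ?_
  rw [eval_mul, eval_C, Chebyshev.T_real_cos, ← Complex.exp_nat_mul, ← mul_assoc,
    ← Complex.ofReal_natCast, ← Complex.ofReal_mul, ← Complex.ofReal_intCast,
    Complex.re_ofReal_mul, Complex.exp_ofReal_mul_I_re]
  simp

theorem finite_zeros_cos {P : ℝ[X]} (hP : P ≠ 0) :
    {θ : ℝ | θ ∈ Set.Icc 0 (2 * Real.pi) ∧ P.eval (Real.cos θ) = 0}.Finite := by
  have hfin : {x | P.IsRoot x}.Finite := Polynomial.finite_setOfPred_isRoot hP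
  refine ((hfin.image Real.arccos).union
    (hfin.image fun x => 2 * Real.pi - Real.arccos x)).subset ?_
  rintro θ ⟨⟨h0, h1⟩, hθ⟩
  rcases le_total θ Real.pi with h | h
  · exact Or.inl ⟨Real.cos θ, hθ, Real.arccos_cos h0 h⟩
  · refine Or.inr ⟨Real.cos θ, hθ, ?_⟩
    have : Real.cos θ = Real.cos (2 * Real.pi - θ) := by rw [Real.cos_two_pi_sub]
    simp only [this]
    rw [Real.arccos_cos (by linarith) (by linarith)]
    ring

theorem card_le_ncard_zeros_cos {P : ℝ[X]} (hP : P ≠ 0) {A : Finset ℝ}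
    (hA : ∀ a ∈ A, a ∈ Set.Icc (-1 : ℝ) 1 ∧ P.IsRoot a) :
    A.card ≤ {θ : ℝ | θ ∈ Set.Icc 0 (2 * Real.pi) ∧ P.eval (Real.cos θ) = 0}.ncard := by
  rw [← Set.ncard_coe_finset]
  refine Set.ncard_le_ncard_of_injOn Real.arccos (fun a ha => ?_) (fun a ha b hb hab => ?_)
    (finite_zeros_cos hP)
  · obtain ⟨⟨h1, h2⟩, h3⟩ := hA a ha
    have := Real.arccos_le_pi a
    have := Real.pi_pos
    refine ⟨⟨Real.arccos_nonneg a, by linarith⟩, ?_⟩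
    rw [Real.cos_arccos h1 h2]
    exact h3
  · exact Real.arccos_injOn (hA a ha).1 (hA b hb).1 hab

theorem exists_list_card_le_abs_cosSubShifts_lt (d : ℕ) (R : Finset ℤ) {c : ℝ} (hc : 0 < c) :
    ∃ K : ℕ, ∀ N (q : ℕ → ℤ), (∀ n ≤ N, q n ∈ R) → q N ≠ 0 →
      Set.ncard {θ : ℝ | θ ∈ Set.Icc 0 (2 * Real.pi) ∧ (∑ n ∈ Finset.range (N + 1),
        (q n : ℂ) * Complex.exp (θ * Complex.I) ^ n).re = 0} ≤ d →
      ∃ L : List ℝ, L.length ≤ d ∧ ∃ A : Finset ℤ, A.card ≤ K ∧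
        ∀ n ∉ A, |cosSubShifts L (cosCoeff N q) n| < c := by
  classical
  obtain ⟨W, hWcard, hW⟩ := exists_finset_cosCoeff_mem R
  set M : ℕ := R.sup fun r => r.natAbs
  obtain ⟨K, hK⟩ := exists_card_lt_of_finite_values (T := 1) (2 ^ d * M)
    ((2 * R.card + 1) ^ 3 ^ d) hc
  refine ⟨K, fun N q hq hN hd => ?_⟩
  set P := cosPolynomial N q with hPdef
  have hP : P ≠ 0 := cosPolynomial_ne_zero hN
  obtain ⟨Z, hZ, s, hs, hnonneg⟩ := P.exists_sign_mul_prod_nonneg hP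
  have hZd : Z.card ≤ d := by
    refine (card_le_ncard_zeros_cos hP hZ).trans ?_
    simpa only [hPdef, cosPolynomial_eval_cos] using hd
  have hlen : Z.toList.length ≤ d := by simpa using hZd
  set Φ := cosSubShifts Z.toList (cosCoeff N q) with hΦ
  let G : ℝ[X] := C s * ((Z.toList.map fun a => X - C a).prod * P)
  have hs1 : |s| = 1 := by rcases hs with rfl | rfl <;> simp
  have hG (n : ℤ) : cosFunctional G (fourier n : C(AddCircle (1 : ℝ), ℂ)) = s * Φ n := by
    rw [cosFunctional_C_mul, cosFunctional_prod_X_sub_C_mul (cosFunctional_cosPolynomial N q)]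
  have hnorm (n : ℤ) : ‖cosFunctional G (fourier n : C(AddCircle (1 : ℝ), ℂ))‖ = |Φ n| := by
    rw [hG, norm_mul, Complex.norm_real, Complex.norm_real, Real.norm_eq_abs, hs1, one_mul,
      Real.norm_eq_abs]
  have hGpos : ∀ x ∈ Set.Icc (-1 : ℝ) 1, 0 ≤ G.eval x := by
    intro x hx
    have h := hnonneg x hx
    have h2 : (Z.toList.map fun a => X - C a).prod.eval x = ∏ a ∈ Z, (x - a) := by
      rw [Finset.prod_map_toList, eval_prod]
      simp
    simp only [G, eval_mul, eval_C, h2]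
    linarith
  have hΦ0 (n : ℤ) : |Φ n| ≤ 2 ^ d * M := by
    refine (abs_cosSubShifts_le (fun x hx => abs_le.2 ?_) (abs_cosCoeff_le hq) n).trans ?_
    · exact (hZ x (by simpa using hx)).1
    · gcongr
      norm_num
  obtain ⟨V, hVcard, hV⟩ := exists_finset_cosSubShifts_mem Z.toList (hW N q hq)
  have hbound (φ : C(AddCircle (1 : ℝ), ℂ)) (B : ℝ) (hφ : ∀ x, ‖φ x‖ ≤ B) :
      ‖cosFunctional G φ‖ ≤ 2 ^ d * M * B := by
    have hB : 0 ≤ B := (norm_nonneg _).trans (hφ 0)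
    refine (norm_cosFunctional_le hGpos φ hφ).trans (mul_le_mul_of_nonneg_right ?_ hB)
    refine (Complex.re_le_norm _).trans ?_
    rw [hnorm]
    exact hΦ0 0
  have hfin : {n : ℤ | cosFunctional G (fourier n : C(AddCircle (1 : ℝ), ℂ)) ≠ 0}.Finite := by
    refine (finite_cosSubShifts_ne_zero Z.toList (finite_cosCoeff_ne_zero N q)).subset ?_
    intro n hn h
    exact hn (by rw [hG, hΦ, h]; simp)
  have hVcard' : (V.image fun x => |x|).card ≤ (2 * R.card + 1) ^ 3 ^ d := by
    refine Finset.card_image_le.trans (hVcard.trans ?_)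
    calc W.card ^ 3 ^ Z.toList.length ≤ (2 * R.card + 1) ^ 3 ^ Z.toList.length := by gcongr
      _ ≤ (2 * R.card + 1) ^ 3 ^ d := by
        refine Nat.pow_le_pow_right (by omega) (Nat.pow_le_pow_right (by norm_num) hlen)
  obtain ⟨A, hA, hAc⟩ := hK (cosFunctional G) hbound hfin _ hVcard' fun n _ => by
    rw [hnorm]
    exact Finset.mem_image_of_mem _ (hV n)
  exact ⟨Z.toList, hlen, A, hA.le, fun n hn => by rw [← hΦ, ← hnorm]; exact hAc n hn⟩

end CosinePolynomial

theorem exists_bad_set_shift_eq (d : ℕ) (R : Finset ℤ) :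
    ∃ D K : ℕ, 0 < D ∧ ∀ N (q : ℕ → ℤ), (∀ n ≤ N, q n ∈ R) → q N ≠ 0 →
      Set.ncard {θ : ℝ | θ ∈ Set.Icc 0 (2 * Real.pi) ∧ (∑ n ∈ Finset.range (N + 1),
        (q n : ℂ) * Complex.exp (θ * Complex.I) ^ n).re = 0} ≤ d →
      ∃ B : Finset ℕ, B.card ≤ K ∧ ∀ n ∉ B, n + D ≤ N → q (n + D) = q n := by
  classical
  obtain ⟨K, hK⟩ := exists_list_card_le_abs_cosSubShifts_lt d R
    (show (0 : ℝ) < (1 / 2) ^ (d + 2) by positivity)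
  set D := (R.card ^ (2 * d) + 2 * d).factorial with hD
  refine ⟨D, K * (D + 1) + 1, Nat.factorial_pos _, fun N q hq hN hd => ?_⟩
  obtain ⟨L, hL, A, hA, hAc⟩ := hK N q hq hN hd
  refine ⟨insert 0 (A.biUnion fun a => Finset.Icc (a.toNat - D) a.toNat), ?_, ?_⟩
  · refine (Finset.card_insert_le _ _).trans (Nat.succ_le_succ ?_)
    refine (Finset.card_biUnion_le_card_mul _ _ (D + 1) fun a _ => ?_).trans
      (Nat.mul_le_mul_right _ hA)
    rw [Nat.card_Icc]
    omega
  intro n hn hnD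
  rw [Finset.mem_insert, not_or, Finset.mem_biUnion] at hn
  obtain ⟨hn0, hnA⟩ := hn
  have hgood (m : ℕ) (h1 : n ≤ m) (h2 : m ≤ n + D) :
      |cosSubShifts L (cosCoeff N q) m| < (1 / 2) ^ (d + 2) := by
    refine hAc m fun hm => hnA ⟨m, hm, ?_⟩
    rw [Finset.mem_Icc, Int.toNat_natCast]
    omega
  have hRpos : 0 < R.card := Finset.card_pos.2 ⟨_, hq N le_rfl⟩
  have hpow : R.card ^ (2 * L.length) ≤ R.card ^ (2 * d) :=
    Nat.pow_le_pow_right hRpos (by omega)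
  have hhalf {k p : ℕ} (h1 : n ≤ k) (h2 : k + p ≤ n + D) :
      cosCoeff N q ((k : ℤ) + p) - cosCoeff N q k = ((q (k + p) - q k : ℤ) : ℝ) / 2 := by
    rw [← Nat.cast_add, cosCoeff_natCast q (by omega) (by omega),
      cosCoeff_natCast q (by omega) (by omega)]
    push_cast
    ring
  have hsmall {i p k : ℕ} (h1 : n ≤ i) (h2 : i + 2 * L.length + p ≤ n + D) (hk1 : n ≤ k)
      (hk2 : k + p ≤ n + D)
      (h : cosSubShifts L (fun j => cosCoeff N q (j + p) - cosCoeff N q j) (i + L.length : ℕ) =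
        (1 / 2) ^ L.length * (cosCoeff N q ((k : ℤ) + p) - cosCoeff N q k)) :
      q (k + p) = q k := by
    rw [cosSubShifts_translate_sub, hhalf hk1 hk2] at h
    have h3 := hgood (i + L.length) (by omega) (by omega)
    have h4 := hgood (i + L.length + p) (by omega) (by omega)
    rw [Nat.cast_add _ p] at h4
    have h5 : |(1 / 2 : ℝ) ^ L.length * (((q (k + p) - q k : ℤ) : ℝ) / 2)| <
        (1 / 2) ^ (L.length + 1) := by
      rw [← h]
      refine (abs_sub _ _).trans_lt ((add_lt_add h4 h3).trans_le ?_)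
      have : (1 / 2 : ℝ) ^ (d + 1) ≤ (1 / 2) ^ (L.length + 1) :=
        pow_le_pow_of_le_one (by norm_num) (by norm_num) (by omega)
      calc (1 / 2 : ℝ) ^ (d + 2) + (1 / 2) ^ (d + 2) = (1 / 2) ^ (d + 1) := by ring
        _ ≤ _ := this
    rw [abs_mul, abs_of_pos (by positivity), pow_succ, mul_lt_mul_iff_right₀ (by positivity),
      abs_div, abs_two, div_lt_div_iff_of_pos_right two_pos, ← Int.cast_abs] at h5
    have h6 : |q (k + p) - q k| < 1 := by exact_mod_cast h5
    rw [Int.abs_lt_one_iff] at h6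
    omega
  refine eq_of_shift_determined (R := R) (w := 2 * L.length) (fun m _ hm => hq m (by omega)) ?_ ?_
    ?_ ?_
  · have := Nat.self_le_factorial (R.card ^ (2 * d) + 2 * d)
    omega
  · intro p hp hp2
    exact Nat.dvd_factorial hp (by omega)
  · intro i p h1 h2 h
    refine hsmall h1 h2 (by omega) h2 ?_
    rw [cosSubShifts_of_eq_zero_left]
    · push_cast
      ring_nf
    · intro j hj1 hj2
      obtain ⟨m, rfl⟩ : ∃ m : ℕ, j = ((i + m : ℕ) : ℤ) := ⟨(j - i).toNat, by push_cast at *; omega⟩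
      have hm : m < 2 * L.length := by push_cast at *; omega
      rw [hhalf (by omega) (by omega), h m hm]
      simp
  · intro i p h1 h2 h
    refine hsmall h1 h2 h1 (by omega) ?_
    rw [cosSubShifts_of_eq_zero_right]
    · push_cast
      ring_nf
    · intro j hj1 hj2
      obtain ⟨m, rfl⟩ : ∃ m : ℕ, j = ((i + 1 + m : ℕ) : ℤ) :=
        ⟨(j - i - 1).toNat, by push_cast at *; omega⟩
      have hm : m < 2 * L.length := by push_cast at *; omega
      rw [hhalf (by omega) (by omega), h m hm]
      simp

theorem exists_infinite_subset_limit_points {𝒩 : Set ℕ} (h𝒩 : 𝒩.Infinite) {K : ℕ}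
    (B : ℕ → Finset ℕ) (hB : ∀ N ∈ 𝒩, (B N).card ≤ K) :
    ∃ 𝒩' ⊆ 𝒩, 𝒩'.Infinite ∧ ∃ Λ : Finset ℝ, Λ.card ≤ K ∧ (∀ x ∈ Λ, x ∈ Set.Icc (0 : ℝ) 1) ∧
      ∀ η > 0, ∃ N₀, ∀ N ∈ 𝒩', N₀ ≤ N → ∀ b ∈ B N, b ≤ N → ∃ x ∈ Λ, |(b : ℝ) - x * N| ≤ η * N := by
  classical
  let X (N : ℕ) (i : Fin K) : ℝ := min ((((B N).toList.getD i 0 : ℕ) : ℝ) / N) 1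
  have hX (N : ℕ) (hN : N ∈ 𝒩) (b : ℕ) (hb : b ∈ B N) (hbN : b ≤ N) :
      ∃ i, X N i = (b : ℝ) / N := by
    obtain ⟨i, hi, hib⟩ := List.mem_iff_getElem.1 (Finset.mem_toList.2 hb)
    have hi' := hi
    rw [Finset.length_toList] at hi'
    refine ⟨⟨i, hi'.trans_le (hB N hN)⟩, ?_⟩
    simp only [X, List.getD_eq_getElem _ _ hi, hib]
    exact min_eq_left (div_le_one_of_le₀ (by exact_mod_cast hbN) (Nat.cast_nonneg _))
  have hXmem (N : ℕ) : X N ∈ Set.Icc (0 : Fin K → ℝ) 1 :=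
    ⟨fun i => le_min (by positivity) zero_le_one, fun i => min_le_right _ _⟩
  obtain ⟨x, hx, ψ, hψ, hlim⟩ := isCompact_Icc.tendsto_subseq fun k => hXmem (Nat.nth (· ∈ 𝒩) k)
  have hφ : StrictMono fun k => Nat.nth (· ∈ 𝒩) (ψ k) := (Nat.nth_strictMono h𝒩).comp hψ
  have hφmem (k : ℕ) : Nat.nth (· ∈ 𝒩) (ψ k) ∈ 𝒩 := Nat.nth_mem_of_infinite h𝒩 _
  refine ⟨Set.range fun k => Nat.nth (· ∈ 𝒩) (ψ k), Set.range_subset_iff.2 hφmem,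
    Set.infinite_range_of_injective hφ.injective, Finset.univ.image x, ?_, ?_, ?_⟩
  · exact Finset.card_image_le.trans (by simp)
  · intro y hy
    obtain ⟨i, -, rfl⟩ := Finset.mem_image.1 hy
    exact ⟨hx.1 i, hx.2 i⟩
  · intro η hη
    obtain ⟨k₀, hk₀⟩ := Metric.tendsto_atTop.1 hlim η hη
    refine ⟨Nat.nth (· ∈ 𝒩) (ψ k₀) + 1, ?_⟩
    rintro _ ⟨k, rfl⟩ hk b hb hbN
    dsimp only at hk hb hbN ⊢
    have hdist := hk₀ k (hφ.le_iff_le.1 ((Nat.le_succ _).trans hk))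
    set N := Nat.nth (· ∈ 𝒩) (ψ k) with hN
    have hNpos : (0 : ℝ) < N := by exact_mod_cast (Nat.succ_pos _).trans_le hk
    obtain ⟨i, hi⟩ := hX N (hφmem k) b hb hbN
    refine ⟨x i, Finset.mem_image_of_mem x (Finset.mem_univ i), ?_⟩
    have h1 := (dist_le_pi_dist _ _ i).trans hdist.le
    simp only [Function.comp_apply] at h1
    rw [← hN, hi, Real.dist_eq] at h1
    have h2 : (b : ℝ) - x i * N = (b / N - x i) * N := by field_simp
    rw [h2, abs_mul, abs_of_pos hNpos]
    exact mul_le_mul_of_nonneg_right h1 hNpos.le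

theorem exists_sorted_enumeration (Λ : Finset ℝ) (hΛ : ∀ x ∈ Λ, x ∈ Set.Icc (0 : ℝ) 1) :
    ∃ l ≤ Λ.card + 1, ∃ ρ : ℕ → ℝ, ρ 0 = 0 ∧ ρ l = 1 ∧ (∀ i j, i < j → j ≤ l → ρ i < ρ j) ∧
      ∀ x ∈ Λ, ∃ j ≤ l, ρ j = x := by
  classical
  set S := insert 0 (insert 1 Λ) with hS
  have hS01 : ∀ x ∈ S, x ∈ Set.Icc (0 : ℝ) 1 := by
    simpa [hS] using hΛ
  have h0 : (0 : ℝ) ∈ S := by simp [hS]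
  have h1 : (1 : ℝ) ∈ S := by simp [hS]
  have hpos : 0 < S.card := Finset.card_pos.2 ⟨0, h0⟩
  have hcard : S.card ≤ Λ.card + 2 :=
    (Finset.card_insert_le _ _).trans (Nat.succ_le_succ (Finset.card_insert_le _ _))
  obtain ⟨l, hl⟩ : ∃ l, S.card = l + 1 := ⟨S.card - 1, by omega⟩
  let f := S.orderEmbOfFin hl
  have hf (x : ℝ) (hx : x ∈ S) : ∃ i, f i = x := by
    have : x ∈ Set.range f := by rw [Finset.range_orderEmbOfFin]; exact hx
    exact this
  have hfS (i) : f i ∈ S := Finset.orderEmbOfFin_mem S hl i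
  refine ⟨l, by omega, fun j => if h : j < l + 1 then f ⟨j, h⟩ else 1, ?_, ?_, ?_, ?_⟩
  · obtain ⟨i, hi⟩ := hf 0 h0
    simp only [Nat.zero_lt_succ, dif_pos]
    refine le_antisymm ?_ (hS01 _ (hfS _)).1
    rw [← hi]
    exact f.monotone (Fin.zero_le i)
  · obtain ⟨i, hi⟩ := hf 1 h1
    simp only [Nat.lt_succ_self, dif_pos]
    refine le_antisymm (hS01 _ (hfS _)).2 ?_
    rw [← hi]
    exact f.monotone (Fin.le_last i)
  · intro i j hij hj
    dsimp only
    rw [dif_pos (by omega), dif_pos (by omega)]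
    exact f.strictMono hij
  · intro x hx
    obtain ⟨i, hi⟩ := hf x (by simp [hS, hx])
    exact ⟨i, Nat.lt_succ_iff.1 i.2, by rw [← hi]; exact dif_pos i.2⟩

theorem Set.Infinite.exists_infinite_fiber_of_finite {α β : Type*} [Finite β] {s : Set α}
    (hs : s.Infinite) (f : α → β) : ∃ b, {a ∈ s | f a = b}.Infinite := by
  by_contra! h
  refine hs ((Set.finite_iUnion h).subset fun a ha => ?_)
  exact Set.mem_iUnion.2 ⟨f a, ha, rfl⟩

theorem eq_of_modEq_of_forall_notMem {D N a b : ℕ} {q : ℕ → ℤ} {B : Finset ℕ}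
    (hB : ∀ n ∉ B, n + D ≤ N → q (n + D) = q n) (hab : a ≤ b) (hbN : b ≤ N) (h : a ≡ b [MOD D])
    (hgood : ∀ n, a ≤ n → n ≤ b → n ∉ B) : q a = q b := by
  obtain ⟨k, hk⟩ := (Nat.modEq_iff_dvd' hab).1 h
  obtain rfl : b = a + D * k := by omega
  clear hk h hab
  induction k with
  | zero => simp
  | succ k ih =>
    have h1 : a + D * (k + 1) = a + D * k + D := by ring
    rw [h1] at hbN hgood ⊢
    rw [hB _ (hgood _ (by omega) (by omega)) hbN]
    exact ih (by omega) fun n h1 h2 => hgood n h1 (by omega)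

theorem sum_ite_Icc_eq {l : ℕ} {ρ : ℕ → ℝ} (hρ : ∀ i j, i < j → j ≤ l → ρ i < ρ j) {N n : ℕ}
    (f : ℕ → ℤ) {j : ℕ} (hj1 : 1 ≤ j) (hjl : j ≤ l) (h1 : ρ (j - 1) * N < n) (h2 : n < ρ j * N) :
    ∑ i ∈ Finset.Icc 1 l, (if ρ (i - 1) * N < n ∧ (n : ℝ) < ρ i * N then f i else 0) = f j := by
  have hmono (i k : ℕ) (hik : i ≤ k) (hk : k ≤ l) : ρ i * N ≤ ρ k * N := by
    rcases hik.eq_or_lt with rfl | h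
    · rfl
    · exact mul_le_mul_of_nonneg_right (hρ i k h hk).le (Nat.cast_nonneg _)
  rw [Finset.sum_eq_single_of_mem j (Finset.mem_Icc.2 ⟨hj1, hjl⟩), if_pos ⟨h1, h2⟩]
  intro i hi hij
  rw [Finset.mem_Icc] at hi
  refine if_neg fun ⟨h3, h4⟩ => ?_
  rcases lt_or_gt_of_ne hij with h | h
  · linarith [hmono i (j - 1) (by omega) (by omega)]
  · linarith [hmono j (i - 1) (by omega) (by omega)]

theorem ncard_abs_sub_le (x : ℝ) {r : ℝ} (hr : 0 ≤ r) :
    {n : ℕ | |(n : ℝ) - x| ≤ r}.Finite ∧ ({n : ℕ | |(n : ℝ) - x| ≤ r}.ncard : ℝ) ≤ 2 * r + 1 := by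
  have hsub : ((fun n : ℕ => (n : ℤ)) '' {n : ℕ | |(n : ℝ) - x| ≤ r}) ⊆
      (Finset.Icc ⌈x - r⌉ ⌊x + r⌋ : Finset ℤ) := by
    rintro _ ⟨n, hn, rfl⟩
    have hn : |(n : ℝ) - x| ≤ r := hn
    rw [abs_le] at hn
    rw [Finset.coe_Icc, Set.mem_Icc, Int.ceil_le, Int.le_floor]
    push_cast
    constructor <;> linarith [hn.1, hn.2]
  have hinj : Function.Injective fun n : ℕ => (n : ℤ) := Nat.cast_injective
  have hfin := (Finset.finite_toSet _).subset hsub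
  refine ⟨hfin.of_finite_image hinj.injOn, ?_⟩
  have h1 := Set.ncard_le_ncard hsub (Finset.finite_toSet _)
  rw [Set.ncard_image_of_injective _ hinj, Set.ncard_coe_finset, Int.card_Icc] at h1
  have h2 : (⌊x + r⌋ + 1 - ⌈x - r⌉ : ℤ) ≤ (2 * r + 1 : ℝ) := by
    have := Int.floor_le (x + r)
    have := Int.le_ceil (x - r)
    push_cast
    linarith
  have h3 : (({n : ℕ | |(n : ℝ) - x| ≤ r}.ncard : ℤ) : ℝ) ≤
      ((max (⌊x + r⌋ + 1 - ⌈x - r⌉) 0 : ℤ) : ℝ) := by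
    rw [← Int.toNat_eq_max]
    exact_mod_cast h1
  rw [Int.cast_natCast] at h3
  refine h3.trans ?_
  push_cast
  exact max_le (by simpa using h2) (by positivity)

/-- A number congruent to `m` modulo `D` which is slightly larger than `t`. -/
def residueRepresentative (D t m : ℕ) : ℕ := D * (t / D + 1) + m

theorem lt_residueRepresentative {D : ℕ} (hD : 0 < D) (t m : ℕ) :
    t < residueRepresentative D t m := by
  have := Nat.lt_mul_div_succ t hD
  rw [residueRepresentative]
  omega

theorem residueRepresentative_le {D m : ℕ} (t : ℕ) (hm : m ≤ D) :
    residueRepresentative D t m ≤ t + 2 * D := by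
  have := Nat.mul_div_le t D
  rw [residueRepresentative, Nat.mul_add]
  omega

theorem modEq_ite_mod (D n : ℕ) : n ≡ (if n % D = 0 then D else n % D) [MOD D] := by
  split_ifs with h
  · simpa [Nat.ModEq] using h
  · exact (Nat.mod_modEq n D).symm

theorem ite_mod_le {D : ℕ} (hD : 0 < D) (n : ℕ) : (if n % D = 0 then D else n % D) ≤ D := by
  split_ifs
  · rfl
  · exact (Nat.mod_lt n hD).le

theorem eq_residueRepresentative {D₀ D N l j n : ℕ} {q : ℕ → ℤ} {B : Finset ℕ} {ρ : ℕ → ℝ} {η : ℝ}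
    (hD : 0 < D) (hdvd : D₀ ∣ D) (hB : ∀ n ∉ B, n + D₀ ≤ N → q (n + D₀) = q n)
    (hρ0 : ρ 0 = 0) (hρl : ρ l = 1) (hρ : ∀ i j, i < j → j ≤ l → ρ i < ρ j)
    (hN : 2 * (2 * D + 1) ≤ η * N)
    (hBρ : ∀ b ∈ B, b ≤ N → ∃ i ≤ l, |(b : ℝ) - ρ i * N| ≤ η / 3 * N)
    (hj1 : 1 ≤ j) (hjl : j ≤ l) (h1 : ρ (j - 1) * N + η * N < n) (h2 : n < ρ j * N - η * N) :
    residueRepresentative D ⌊(ρ (j - 1) + ρ j) / 2 * N⌋₊ (if n % D = 0 then D else n % D) ≤ N ∧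
    q n = q (residueRepresentative D ⌊(ρ (j - 1) + ρ j) / 2 * N⌋₊
      (if n % D = 0 then D else n % D)) := by
  set m := if n % D = 0 then D else n % D with hm
  set t := ⌊(ρ (j - 1) + ρ j) / 2 * N⌋₊ with ht
  set r := residueRepresentative D t m with hr
  have hmono (i k : ℕ) (hik : i ≤ k) (hk : k ≤ l) : ρ i * N ≤ ρ k * N := by
    rcases hik.eq_or_lt with rfl | h
    · rfl
    · exact mul_le_mul_of_nonneg_right (hρ i k h hk).le (Nat.cast_nonneg _)
  have hNpos : (0 : ℝ) < η * N := by
    have : (0 : ℝ) ≤ D := Nat.cast_nonneg _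
    linarith
  have hlow : 0 ≤ ρ (j - 1) * N := by simpa [hρ0] using hmono 0 (j - 1) (Nat.zero_le _) (by omega)
  have hhigh : ρ j * N ≤ N := by simpa [hρl] using hmono j l hjl le_rfl
  have hr1 : (ρ (j - 1) + ρ j) / 2 * N < r := by
    refine (Nat.lt_floor_add_one _).trans_le ?_
    have := lt_residueRepresentative hD t m
    exact_mod_cast this
  have hr2 : (r : ℝ) ≤ (ρ (j - 1) + ρ j) / 2 * N + 2 * D := by
    have h3 : (t : ℝ) ≤ (ρ (j - 1) + ρ j) / 2 * N :=
      Nat.floor_le (by nlinarith)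
    have h4 : (r : ℝ) ≤ t + 2 * D := by
      exact_mod_cast residueRepresentative_le t (ite_mod_le hD n)
    linarith
  have hr3 : ρ (j - 1) * N + η * N < r := by nlinarith
  have hr4 : (r : ℝ) < ρ j * N - η / 2 * N := by nlinarith
  have hrN : r ≤ N := by
    have : (r : ℝ) ≤ N := by nlinarith
    exact_mod_cast this
  have hnN : n ≤ N := by
    have : (n : ℝ) ≤ N := by nlinarith
    exact_mod_cast this
  have hgood (k : ℕ) (hk1 : ρ (j - 1) * N + η * N < k) (hk2 : k < ρ j * N - η / 2 * N) : k ∉ B := by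
    intro hk
    have hkN : (k : ℝ) ≤ N := by nlinarith
    obtain ⟨i, hi, hki⟩ := hBρ k hk (by exact_mod_cast hkN)
    rw [abs_le] at hki
    rcases Nat.lt_or_ge i j with h | h
    · have := hmono i (j - 1) (by omega) (by omega)
      linarith [hki.2]
    · have := hmono j i h hi
      linarith [hki.1]
  have hmod : n ≡ r [MOD D₀] := by
    refine Nat.ModEq.of_dvd hdvd ((modEq_ite_mod D n).trans ?_)
    simp [hr, hm, residueRepresentative, Nat.ModEq]
  refine ⟨hrN, ?_⟩
  rcases le_total n r with h | h
  · refine eq_of_modEq_of_forall_notMem hB h hrN hmod fun k hk1 hk2 => hgood k ?_ ?_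
    · have : (n : ℝ) ≤ k := by exact_mod_cast hk1
      linarith
    · have : (k : ℝ) ≤ r := by exact_mod_cast hk2
      linarith
  · refine (eq_of_modEq_of_forall_notMem hB h hnN hmod.symm fun k hk1 hk2 => hgood k ?_ ?_).symm
    · have : (r : ℝ) ≤ k := by exact_mod_cast hk1
      linarith
    · have : (k : ℝ) ≤ n := by exact_mod_cast hk2
      linarith

theorem exists_mem_gap_of_far {l : ℕ} {ρ : ℕ → ℝ} (hρ0 : ρ 0 = 0) (hρl : ρ l = 1) {N n : ℕ}
    {δ : ℝ} (hδ : 0 ≤ δ) (hnN : n ≤ N) (hfar : ∀ i ≤ l, δ < |(n : ℝ) - ρ i * N|) :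
    ∃ j, 1 ≤ j ∧ j ≤ l ∧ ρ (j - 1) * N + δ < n ∧ n < ρ j * N - δ := by
  classical
  have hex : ∃ j, j ≤ l ∧ (n : ℝ) < ρ j * N := by
    refine ⟨l, le_rfl, ?_⟩
    have h1 : (n : ℝ) ≤ N := by exact_mod_cast hnN
    have h2 := hfar l le_rfl
    rw [hρl, one_mul, abs_of_nonpos (by linarith)] at h2
    rw [hρl]
    linarith
  obtain ⟨hjl, hj⟩ := Nat.find_spec hex
  have hmin (m : ℕ) (hm : m < Nat.find hex) := Nat.find_min hex hm
  set j := Nat.find hex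
  have hj1 : 1 ≤ j := by
    by_contra! h
    obtain h : j = 0 := by omega
    rw [h, hρ0, zero_mul] at hj
    exact absurd hj (not_lt.2 (Nat.cast_nonneg n))
  have hprev : ρ (j - 1) * N ≤ n := by
    by_contra! h
    exact hmin (j - 1) (by omega) ⟨by omega, h⟩
  refine ⟨j, hj1, hjl, ?_, ?_⟩
  · have h := hfar (j - 1) (by omega)
    rw [abs_of_nonneg (by linarith)] at h
    linarith
  · have h := hfar j hjl
    rw [abs_of_neg (by linarith)] at h
    linarith

theorem ncard_near_le {l N : ℕ} (ρ : ℕ → ℝ) {S : Set ℕ} {δ : ℝ} (hδ : 0 ≤ δ)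
    (hS : ∀ n ∈ S, ∃ i ≤ l, |(n : ℝ) - ρ i * N| ≤ δ) : (S.ncard : ℝ) ≤ (l + 1) * (2 * δ + 1) := by
  have hsub : S ⊆ ⋃ i ∈ Finset.range (l + 1), {n : ℕ | |(n : ℝ) - ρ i * N| ≤ δ} := by
    intro n hn
    obtain ⟨i, hi, h⟩ := hS n hn
    exact Set.mem_biUnion (by simpa [Nat.lt_succ_iff] using hi) h
  have hfin : (⋃ i ∈ Finset.range (l + 1), {n : ℕ | |(n : ℝ) - ρ i * N| ≤ δ}).Finite :=
    Set.Finite.biUnion (Finset.finite_toSet _) fun i _ => (ncard_abs_sub_le _ hδ).1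
  calc (S.ncard : ℝ) ≤ (⋃ i ∈ Finset.range (l + 1), {n : ℕ | |(n : ℝ) - ρ i * N| ≤ δ}).ncard := by
        exact_mod_cast Set.ncard_le_ncard hsub hfin
    _ ≤ ∑ i ∈ Finset.range (l + 1), ({n : ℕ | |(n : ℝ) - ρ i * N| ≤ δ}.ncard : ℝ) := by
        exact_mod_cast Finset.set_ncard_biUnion_le _ _
    _ ≤ ∑ i ∈ Finset.range (l + 1), (2 * δ + 1) :=
        Finset.sum_le_sum fun i _ => (ncard_abs_sub_le _ hδ).2
    _ = (l + 1) * (2 * δ + 1) := by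
        rw [Finset.sum_const, Finset.card_range, nsmul_eq_mul]
        push_cast
        rfl

theorem exists_piecewise_periodic {R : Finset ℤ} {D₀ K : ℕ} (hD₀ : 0 < D₀) {𝒩 : Set ℕ}
    (h𝒩 : 𝒩.Infinite) {q : ℕ → ℕ → ℤ}
    (hq : ∀ N ∈ 𝒩, (∀ n ≤ N, q N n ∈ R) ∧ ∀ n, N < n → q N n = 0) {B : ℕ → Finset ℕ}
    (hBcard : ∀ N ∈ 𝒩, (B N).card ≤ K)
    (hB : ∀ N ∈ 𝒩, ∀ n ∉ B N, n + D₀ ≤ N → q N (n + D₀) = q N n) :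
    ∃ 𝒩' ⊆ 𝒩, 𝒩'.Infinite ∧
      ∃ l : ℕ, l ≤ D₀ * (K + 2) ∧
        ∃ ρ : ℕ → ℝ, ρ 0 = 0 ∧ ρ l = 1 ∧ (∀ j < l, ρ j < ρ (j + 1)) ∧
          ∃ ε : ℕ → ℕ → ℤ,
            (∀ j, 1 ≤ j → j ≤ l → ∀ m, 1 ≤ m → m ≤ D₀ * (K + 2) → ε j m ∈ R) ∧
            ∃ E : ℕ → ℕ → ℤ,
              (∀ N ∈ 𝒩', ∀ n : ℕ,
                |E N n| ≤ 2 * ((R.sup fun r => r.natAbs : ℕ) : ℤ)) ∧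
              Filter.Tendsto
                (fun N => (Set.ncard {n : ℕ | E N n ≠ 0} : ℝ) / N)
                (Filter.atTop ⊓ Filter.principal 𝒩') (nhds 0) ∧
              (∀ N ∈ 𝒩', ∀ n : ℕ,
                q N n =
                  (∑ j ∈ Finset.Icc 1 l,
                    if ρ (j - 1) * N < n ∧ (n : ℝ) < ρ j * N then
                      ε j (if n % (D₀ * (K + 2)) = 0 then D₀ * (K + 2) else n % (D₀ * (K + 2)))
                    else 0) + E N n) := by
  classical
  set D := D₀ * (K + 2) with hDdef
  have hD : 0 < D := by positivity
  obtain ⟨𝒩₁, h𝒩₁, h𝒩₁inf, Λ, hΛcard, hΛ, hlim⟩ := exists_infinite_subset_limit_points h𝒩 B hBcard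
  obtain ⟨l, hl, ρ, hρ0, hρl, hρ, hρΛ⟩ := exists_sorted_enumeration Λ hΛ
  obtain ⟨N₂, hN₂⟩ := h𝒩.nonempty
  let r₀ : R := ⟨q N₂ 0, (hq N₂ hN₂).1 0 (Nat.zero_le _)⟩
  let rep (N j m : ℕ) : ℕ := residueRepresentative D ⌊(ρ (j - 1) + ρ j) / 2 * N⌋₊ m
  let pattern (N : ℕ) (j : Fin (l + 1)) (m : Fin (D + 1)) : R :=
    if h : q N (rep N j m) ∈ R then ⟨_, h⟩ else r₀
  obtain ⟨y, hy⟩ := h𝒩₁inf.exists_infinite_fiber_of_finite pattern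
  set 𝒩' := {N ∈ 𝒩₁ | pattern N = y} with h𝒩'
  have hsub : 𝒩' ⊆ 𝒩 := fun N hN => h𝒩₁ hN.1
  let ε (j m : ℕ) : ℤ := if h : j < l + 1 ∧ m < D + 1 then y ⟨j, h.1⟩ ⟨m, h.2⟩ else r₀
  have hεR (j m : ℕ) : ε j m ∈ R := by
    simp only [ε]
    split_ifs
    · exact Subtype.property _
    · exact r₀.2
  have hε (N j m : ℕ) (hN : N ∈ 𝒩') (hj : j ≤ l) (hm : m ≤ D) (h : rep N j m ≤ N) :
      ε j m = q N (rep N j m) := by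
    have h1 := (hq N (hsub hN)).1 _ h
    simp only [ε]
    rw [dif_pos ⟨by omega, by omega⟩, ← hN.2]
    simp only [pattern]
    rw [dif_pos h1]
  let res (n : ℕ) : ℕ := if n % D = 0 then D else n % D
  let main (N n : ℕ) : ℤ := ∑ j ∈ Finset.Icc 1 l,
    if ρ (j - 1) * N < n ∧ (n : ℝ) < ρ j * N then ε j (res n) else 0
  have hRabs (r : ℤ) (hr : r ∈ R) : |r| ≤ ((R.sup fun r => r.natAbs : ℕ) : ℤ) := by
    rw [Int.abs_eq_natAbs]
    exact_mod_cast Finset.le_sup (f := fun r : ℤ => r.natAbs) hr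
  have hmain_abs (N n : ℕ) : |main N n| ≤ ((R.sup fun r => r.natAbs : ℕ) : ℤ) := by
    by_cases h : ∃ j ∈ Finset.Icc 1 l, ρ (j - 1) * N < n ∧ (n : ℝ) < ρ j * N
    · obtain ⟨j, hj, h1, h2⟩ := h
      rw [Finset.mem_Icc] at hj
      simp only [main]
      rw [sum_ite_Icc_eq hρ (fun j => ε j (res n)) hj.1 hj.2 h1 h2]
      exact hRabs _ (hεR _ _)
    · have : main N n = 0 := Finset.sum_eq_zero fun j hj => if_neg fun h' => h ⟨j, hj, h'⟩
      rw [this, abs_zero]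
      positivity
  have hq_abs (N n : ℕ) (hN : N ∈ 𝒩) : |q N n| ≤ ((R.sup fun r => r.natAbs : ℕ) : ℤ) := by
    rcases Nat.lt_or_ge N n with h | h
    · rw [(hq N hN).2 n h, abs_zero]
      positivity
    · exact hRabs _ ((hq N hN).1 n h)
  have hρle (j : ℕ) (hj : j ≤ l) : ρ j ≤ 1 := by
    rcases hj.eq_or_lt with rfl | h
    · exact hρl.le
    · exact hρl ▸ (hρ j l h le_rfl).le
  have hsupport (η : ℝ) (hη : 0 < η) : ∃ N₀, ∀ N ∈ 𝒩', N₀ ≤ N →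
      ∀ n, q N n - main N n ≠ 0 → ∃ i ≤ l, |(n : ℝ) - ρ i * N| ≤ η * N := by
    obtain ⟨N₀, hN₀⟩ := hlim (η / 3) (by positivity)
    refine ⟨max N₀ ⌈2 * (2 * D + 1) / η⌉₊, fun N hN hNle n hn => ?_⟩
    have hNη : 2 * (2 * D + 1) ≤ η * N := by
      rw [← div_le_iff₀' hη]
      exact (Nat.le_ceil _).trans (by exact_mod_cast (le_max_right _ _).trans hNle)
    rcases Nat.lt_or_ge N n with hNn | hnN
    · refine absurd ?_ hn
      rw [(hq N (hsub hN)).2 n hNn, zero_sub, neg_eq_zero]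
      refine Finset.sum_eq_zero fun j hj => if_neg fun h => ?_
      have h1 : ρ j * N ≤ 1 * N :=
        mul_le_mul_of_nonneg_right (hρle j (Finset.mem_Icc.1 hj).2) (Nat.cast_nonneg _)
      have h2 : (N : ℝ) < n := by exact_mod_cast hNn
      linarith [h.2]
    by_contra! hfar
    obtain ⟨j, hj1, hjl, h1, h2⟩ := exists_mem_gap_of_far hρ0 hρl (by positivity) hnN hfar
    have hpos : 0 ≤ η * N := by positivity
    have hBρ (b : ℕ) (hb : b ∈ B N) (hbN : b ≤ N) : ∃ i ≤ l, |(b : ℝ) - ρ i * N| ≤ η / 3 * N := by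
      obtain ⟨x, hx, hbx⟩ := hN₀ N hN.1 ((le_max_left _ _).trans hNle) b hb hbN
      obtain ⟨i, hi, rfl⟩ := hρΛ x hx
      exact ⟨i, hi, hbx⟩
    obtain ⟨hrN, hqr⟩ := eq_residueRepresentative hD (Dvd.intro _ rfl) (hB N (hsub hN)) hρ0 hρl hρ
      hNη hBρ hj1 hjl h1 h2
    refine hn ?_
    simp only [main]
    rw [sum_ite_Icc_eq hρ (fun j => ε j (res n)) hj1 hjl (by linarith) (by linarith),
      hε N j (res n) hN hjl (ite_mod_le hD n) hrN, sub_eq_zero]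
    exact hqr
  refine ⟨𝒩', hsub, hy, l, ?_, ρ, hρ0, hρl, fun j hj => hρ j (j + 1) j.lt_succ_self hj, ε,
    fun j _ _ m _ _ => hεR j m, fun N n => q N n - main N n, fun N hN n => ?_, ?_,
    fun N _ n => (add_sub_cancel _ _).symm⟩
  · have := Nat.le_mul_of_pos_left (K + 2) hD₀
    omega
  · have h1 := abs_sub (q N n) (main N n)
    have h2 := hq_abs N n (hsub hN)
    have h3 := hmain_abs N n
    linarith
  · rw [Metric.tendsto_nhds]
    intro δ hδ
    set η : ℝ := δ / (4 * (l + 1)) with hη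
    have hηpos : 0 < η := by positivity
    obtain ⟨N₀, hN₀⟩ := hsupport η hηpos
    rw [Filter.eventually_inf_principal]
    filter_upwards [Filter.eventually_ge_atTop N₀, Filter.eventually_gt_atTop 0,
      Filter.eventually_gt_atTop ⌈2 * (l + 1) / δ⌉₊] with N hN1 hN2 hN3 hN
    have hNpos : (0 : ℝ) < N := by exact_mod_cast hN2
    have h1 := ncard_near_le ρ (S := {n | q N n - main N n ≠ 0}) (δ := η * N) (by positivity)
      (hN₀ N hN hN1)
    have h2 : 2 * (l + 1) < δ * N := by
      rw [← div_lt_iff₀' hδ]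
      exact (Nat.le_ceil _).trans_lt (by exact_mod_cast hN3)
    rw [Real.dist_eq, sub_zero, abs_of_nonneg (by positivity), div_lt_iff₀ hNpos]
    have h3 : (l + 1) * (2 * (η * N) + 1) = δ * N / 2 + (l + 1) := by
      rw [hη]
      field_simp
      ring
    rw [h3] at h1
    linarith

/-- structural lemma for a sequence of polynomials with few unimodular
zeros of the real part. For `d ∈ ℕ` and finite `R ⊂ ℤ` there exists `D = D(R, d)` such
that: for any infinite `𝒩 ⊂ ℕ` and polynomials `Q_N` (for `N ∈ 𝒩`, given by coefficient
functions `q N`) with coefficients in `R`, degree `N`, such that `θ ↦ Re(Q_N(e^{iθ}))`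
has at most `d` distinct zeros in `[0, 2π]`, there exist an infinite `𝒩' ⊆ 𝒩`, `l ≤ D`,
`0 = ρ_0 < ρ_1 < ⋯ < ρ_l = 1` and sequences `(ε^{(j)}_m)_{m=1}^D ∈ R^D` with
`Q_N(z) = Σ_{j=1}^l Σ_{n ∈ (ρ_{j-1}N, ρ_j N)} ε^{(j)}_{n mod D} z^n + E_N(z)` for all
`N ∈ 𝒩'`, where each `E_N` has coefficients of absolute value at most `2 max_{r∈R} |r|`
and its number of nonzero coefficients is `o(N)` as `N → ∞` along `𝒩'`.
(Here `n mod D` denotes the residue of `n` in `{1, …, D}`.) -/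
theorem stmt4 (d : ℕ) (R : Finset ℤ) :
    ∃ D : ℕ, 0 < D ∧
      ∀ 𝒩 : Set ℕ, 𝒩.Infinite →
        ∀ q : ℕ → ℕ → ℤ,
          (∀ N ∈ 𝒩, (∀ n ≤ N, q N n ∈ R) ∧ q N N ≠ 0 ∧ ∀ n, N < n → q N n = 0) →
          (∀ N ∈ 𝒩, Set.ncard {θ : ℝ | θ ∈ Set.Icc 0 (2 * Real.pi) ∧
              (∑ n ∈ Finset.range (N + 1),
                (q N n : ℂ) * Complex.exp (θ * Complex.I) ^ n).re = 0} ≤ d) →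
          ∃ 𝒩' ⊆ 𝒩, 𝒩'.Infinite ∧
            ∃ l : ℕ, l ≤ D ∧
              ∃ ρ : ℕ → ℝ, ρ 0 = 0 ∧ ρ l = 1 ∧ (∀ j < l, ρ j < ρ (j + 1)) ∧
                ∃ ε : ℕ → ℕ → ℤ,
                  (∀ j, 1 ≤ j → j ≤ l → ∀ m, 1 ≤ m → m ≤ D → ε j m ∈ R) ∧
                  ∃ E : ℕ → ℕ → ℤ,
                    (∀ N ∈ 𝒩', ∀ n : ℕ,
                      |E N n| ≤ 2 * ((R.sup fun r => r.natAbs : ℕ) : ℤ)) ∧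
                    Filter.Tendsto
                      (fun N => (Set.ncard {n : ℕ | E N n ≠ 0} : ℝ) / N)
                      (Filter.atTop ⊓ Filter.principal 𝒩') (nhds 0) ∧
                    (∀ N ∈ 𝒩', ∀ n : ℕ,
                      q N n =
                        (∑ j ∈ Finset.Icc 1 l,
                          if ρ (j - 1) * N < n ∧ (n : ℝ) < ρ j * N then
                            ε j (if n % D = 0 then D else n % D) else 0) + E N n) := by
  classical
  obtain ⟨D₀, K, hD₀, h⟩ := exists_bad_set_shift_eq d R
  refine ⟨D₀ * (K + 2), by positivity, fun 𝒩 h𝒩 q hq hd => ?_⟩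
  choose! B hBcard hB using fun N (hN : N ∈ 𝒩) => h N (q N) (hq N hN).1 (hq N hN).2.1 (hd N hN)
  exact exists_piecewise_periodic hD₀ h𝒩 (fun N hN => ⟨(hq N hN).1, (hq N hN).2.2⟩) hBcard hB
end

section
/- Let D ∈ ℕ, r ∈ ℤ, let Λ be a finite set of positive integers, let δ_m ∈ ℤ with |δ_m| ≤ 2 for m ∈ Λ, let p_m be positive integers for m ∈ Λ, and set p = max_{m∈Λ} p_m. Define s(t) = Σ_{m∈Λ} δ_m ( sin(mt) − sin((m − p_m D)t) ). Then for every c > 0 and every real t with |t − 2πr/D| ≤ c/p, one has |s(t)| ≤ 2·|Λ|·D·c. In particular, for any C > 0 bounding |Λ| and any ρ > 0 one can choose c > 0 depending only on ρ, C and D such that |s(t)| < ρ whenever |t − 2πr/D| < c/p. -/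
/-- Near `2πr/D`, the functions `sin (m t)` and `sin ((m - q D) t)` differ by at most
`q D |t - 2πr/D|`, since they agree at `t = 2πr/D`. -/
theorem abs_sin_sub_sin_shift_le (D m q : ℕ) (r : ℤ) (t : ℝ) :
    |Real.sin (m * t) - Real.sin ((((m : ℤ) - q * D : ℤ) : ℝ) * t)| ≤
      q * D * |t - 2 * Real.pi * r / D| := by
  rcases Nat.eq_zero_or_pos D with rfl | hD
  · simp
  have hD' : (0 : ℝ) < D := by exact_mod_cast hD
  have hper := Real.sin_add_int_mul_two_pi ((((m : ℤ) - q * D : ℤ) : ℝ) * t) (q * r)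
  rw [← hper]
  refine (Real.abs_sin_sub_sin_le _ _).trans (le_of_eq ?_)
  have hfactor : (m : ℝ) * t - ((((m : ℤ) - q * D : ℤ) : ℝ) * t
      + ((q * r : ℤ) : ℝ) * (2 * Real.pi)) = q * D * (t - 2 * Real.pi * r / D) := by
    push_cast
    field_simp
    ring
  rw [hfactor, abs_mul, abs_of_nonneg (by positivity : (0 : ℝ) ≤ q * D)]

theorem abs_sum_sin_sub_sin_shift_le (D : ℕ) (r : ℤ) (Λ : Finset ℕ) (δ : ℕ → ℤ) (p : ℕ → ℕ)
    (hδ : ∀ m ∈ Λ, |δ m| ≤ 2) (hp : ∀ m ∈ Λ, 0 < p m) (c t : ℝ)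
    (ht : |t - 2 * Real.pi * r / D| ≤ c / ((Λ.sup p : ℕ) : ℝ)) :
    |∑ m ∈ Λ, (δ m : ℝ) *
        (Real.sin (m * t) - Real.sin ((((m : ℤ) - p m * D : ℤ) : ℝ) * t))| ≤
      2 * Λ.card * D * c := by
  have hterm : ∀ m ∈ Λ, |(δ m : ℝ) *
      (Real.sin (m * t) - Real.sin ((((m : ℤ) - p m * D : ℤ) : ℝ) * t))| ≤ 2 * (D * c) := by
    intro m hm
    have hle : (p m : ℝ) ≤ (Λ.sup p : ℕ) := by exact_mod_cast Finset.le_sup hm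
    have hpos : (0 : ℝ) < p m := by exact_mod_cast hp m hm
    have hδm : |(δ m : ℝ)| ≤ 2 := by exact_mod_cast hδ m hm
    rw [abs_mul]
    refine mul_le_mul hδm ((abs_sin_sub_sin_shift_le D m (p m) r t).trans ?_)
      (abs_nonneg _) zero_le_two
    have hdist : p m * |t - 2 * Real.pi * r / D| ≤ c :=
      (mul_le_mul_of_nonneg_right hle (abs_nonneg _)).trans
        ((le_div_iff₀' (hpos.trans_le hle)).mp ht)
    calc p m * D * |t - 2 * Real.pi * r / D| = D * (p m * |t - 2 * Real.pi * r / D|) := by ring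
      _ ≤ D * c := mul_le_mul_of_nonneg_left hdist (Nat.cast_nonneg D)
  calc _ ≤ _ := Finset.abs_sum_le_sum_abs _ _
    _ ≤ Λ.card • (2 * (D * c)) := Finset.sum_le_card_nsmul _ _ _ hterm
    _ = 2 * Λ.card * D * c := by rw [nsmul_eq_mul]; ring

/-- Let `D ∈ ℕ`, `r ∈ ℤ`, `Λ` a finite set of positive integers,
`δ_m ∈ ℤ` with `|δ_m| ≤ 2`, `p_m` positive integers, `p = max_{m∈Λ} p_m`, and
`s(t) = Σ_{m∈Λ} δ_m (sin(mt) - sin((m - p_m D)t))`. Then for every `c > 0` and every `t`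
with `|t - 2πr/D| ≤ c/p` one has `|s(t)| ≤ 2·|Λ|·D·c`. In particular, for any `C > 0`
bounding `|Λ|` and any `ρ > 0`, one can choose `c > 0` depending only on `ρ`, `C` and `D`
such that `|s(t)| < ρ` whenever `|t - 2πr/D| < c/p`. -/
theorem stmt14 (D : ℕ) :
    (∀ (r : ℤ) (Λ : Finset ℕ) (δ : ℕ → ℤ) (p : ℕ → ℕ),
      (∀ m ∈ Λ, 0 < m) → (∀ m ∈ Λ, |δ m| ≤ 2) → (∀ m ∈ Λ, 0 < p m) →
      ∀ c : ℝ, 0 < c → ∀ t : ℝ,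
        |t - 2 * Real.pi * r / D| ≤ c / ((Λ.sup p : ℕ) : ℝ) →
        |∑ m ∈ Λ, (δ m : ℝ) *
            (Real.sin (m * t) - Real.sin ((((m : ℤ) - p m * D : ℤ) : ℝ) * t))| ≤
          2 * Λ.card * D * c) ∧
    (∀ C ρ : ℝ, 0 < C → 0 < ρ → ∃ c : ℝ, 0 < c ∧
      ∀ (r : ℤ) (Λ : Finset ℕ) (δ : ℕ → ℤ) (p : ℕ → ℕ),
        (∀ m ∈ Λ, 0 < m) → (∀ m ∈ Λ, |δ m| ≤ 2) → (∀ m ∈ Λ, 0 < p m) →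
        (Λ.card : ℝ) ≤ C →
        ∀ t : ℝ, |t - 2 * Real.pi * r / D| < c / ((Λ.sup p : ℕ) : ℝ) →
          |∑ m ∈ Λ, (δ m : ℝ) *
              (Real.sin (m * t) - Real.sin ((((m : ℤ) - p m * D : ℤ) : ℝ) * t))| < ρ) := by
  refine ⟨fun r Λ δ p _ hδ hp c _ t ht => abs_sum_sin_sub_sin_shift_le D r Λ δ p hδ hp c t ht,
    fun C ρ hC hρ => ⟨ρ / (2 * C * D + 1), by positivity, ?_⟩⟩
  intro r Λ δ p _ hδ hp hcard t ht
  refine (abs_sum_sin_sub_sin_shift_le D r Λ δ p hδ hp _ t ht.le).trans_lt ?_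
  calc 2 * Λ.card * D * (ρ / (2 * C * D + 1)) ≤ 2 * C * D * (ρ / (2 * C * D + 1)) := by gcongr
    _ < ρ := by
      rw [← mul_div_assoc, div_lt_iff₀ (by positivity)]
      linarith
end

section
/- For every non-negative integer N, the cosine polynomial g_N(θ) = cos θ + Σ_{j=0}^N (−1)^j cos((2j+1)θ) has at most 2 distinct zeros in the interval [0, 2π). -/
/-- The signed odd cosine harmonics are the odd sine harmonics of the complementary angle. -/
theorem neg_one_pow_mul_cos_odd_mul (j : ℕ) (θ : ℝ) :
    (-1 : ℝ) ^ j * Real.cos ((2 * j + 1 : ℕ) * θ) =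
      Real.sin ((2 * j + 1) * (Real.pi / 2 - θ)) := by
  have h : (2 * j + 1) * (Real.pi / 2 - θ) =
      Real.pi / 2 - ((2 * j + 1 : ℕ) * θ - j * Real.pi) := by
    push_cast
    ring
  rw [h, Real.sin_pi_div_two_sub, Real.cos_sub_nat_mul_pi]

/-- A closed form for the sum of odd sine harmonics, multiplied by `sin φ`. -/
theorem sin_mul_sum_sin_odd_mul (n : ℕ) (φ : ℝ) :
    Real.sin φ * ∑ j ∈ Finset.range n, Real.sin ((2 * j + 1) * φ) = Real.sin (n * φ) ^ 2 := by
  induction n with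
  | zero => simp
  | succ n ih =>
    have h₁ : (2 * n + 1) * φ = n * φ + (n * φ + φ) := by ring
    have h₂ : ((n + 1 : ℕ) : ℝ) * φ = n * φ + φ := by
      push_cast
      ring
    rw [Finset.sum_range_succ, mul_add, ih, h₁, h₂, Real.sin_add (n * φ) (n * φ + φ),
      Real.sin_add, Real.cos_add]
    linear_combination -Real.sin (n * φ) ^ 2 * Real.sin_sq_add_cos_sq φ

/-- The only zeros of the cosine polynomial are the zeros of `cos`. -/
theorem cos_eq_zero_of_cos_add_sum_eq_zero {n : ℕ} {θ : ℝ}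
    (h : Real.cos θ + ∑ j ∈ Finset.range n,
      (-1 : ℝ) ^ j * Real.cos ((2 * j + 1 : ℕ) * θ) = 0) : Real.cos θ = 0 := by
  simp_rw [neg_one_pow_mul_cos_odd_mul] at h
  have hs := sin_mul_sum_sin_odd_mul n (Real.pi / 2 - θ)
  rw [Real.sin_pi_div_two_sub] at hs
  have hsum : Real.cos θ ^ 2 + Real.sin (n * (Real.pi / 2 - θ)) ^ 2 = 0 := by
    linear_combination Real.cos θ * h - hs
  exact sq_eq_zero_iff.mp (by
    linarith [sq_nonneg (Real.cos θ), sq_nonneg (Real.sin (n * (Real.pi / 2 - θ)))])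

/-- For every `N ≥ 0`, the cosine polynomial
`g_N(θ) = cos θ + Σ_{j=0}^N (-1)^j cos((2j+1)θ)` has at most `2` distinct zeros in
`[0, 2π)`. -/
theorem stmt19 (N : ℕ) :
    Set.ncard {θ : ℝ | θ ∈ Set.Ico 0 (2 * Real.pi) ∧
      Real.cos θ + ∑ j ∈ Finset.range (N + 1),
        (-1 : ℝ) ^ j * Real.cos ((2 * j + 1 : ℕ) * θ) = 0} ≤ 2 := by
  have hsub : {θ : ℝ | θ ∈ Set.Ico 0 (2 * Real.pi) ∧
      Real.cos θ + ∑ j ∈ Finset.range (N + 1),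
        (-1 : ℝ) ^ j * Real.cos ((2 * j + 1 : ℕ) * θ) = 0} ⊆
      {Real.pi / 2, 3 * Real.pi / 2} := by
    rintro θ ⟨⟨h0, h2⟩, hθ⟩
    obtain ⟨k, rfl⟩ := Real.cos_eq_zero_iff.mp (cos_eq_zero_of_cos_add_sum_eq_zero hθ)
    have hpi := Real.pi_pos
    have hk0 : (-1 : ℝ) < k := by nlinarith
    have hk2 : (k : ℝ) < 2 := by nlinarith
    norm_cast at hk0 hk2
    obtain rfl | rfl : k = 0 ∨ k = 1 := by lia
    · left
      norm_num
    · right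
      norm_num
  exact (Set.ncard_le_ncard hsub).trans ((Set.ncard_insert_le _ _).trans (by simp))
end
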